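/- Let Γ ⊆ ℝ³ be a smooth Jordan curve parametrized by γ : 𝕊¹ → ℝ³, and let ρ > 0 be such that the open tube T(Γ, ρ) is homeomorphic to an open solid torus 𝕊¹ × B, where B is the open unit disk in ℝ². Let E and E′ be regular strictly convex bounded domains with 0 ∈ E and closure(E) ⊆ E′, and let R_E be a uniform exterior sphere radius for E. Let P and P′ be polygons with closure(Int P′) ⊆ Int P and 0 ∈ Int P′, let X be a conformal minimal immersion on an open neighborhood of closure(Int P) with X(0) = 0, and let ε, a, b, c > 0 satisfy: (1) X(closure(Int P) \ Int P′) ⊆ E \ E_{−a}; (2) δ^H(Γ, X(closure(Int P) \ Int P′)) ≤ c; (3) the loop X restricted to P is homologous (i.e., freely homotopic) to γ within T(Γ, c); (4) c + M < ρ, where M = [ (2(2a+b) + R_E + δ^H(closure E, closure E′))² − (2(a+b) + R_E)² + (2b)² ]^{1/2} + ε. Then there exist a polygon Q and a conformal minimal immersion Y on an open neighborhood of closure(Int Q) with Y(0) = 0 such that: (d.1) closure(Int P′) ⊆ Int Q and closure(Int Q) ⊆ Int P; (d.2) dist_{(closure(Int Q), Y)}(z, P′) > 1/ε for every z ∈ Q;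 (d.3) Y(Q) ⊆ E′ \ E′_{−b}; (d.4) Y(Int Q \ Int P′) ⊆ ℝ³ \ E_{−2(a+b)}; (d.5) ‖Y(z) − X(z)‖ < ε for all z ∈ closure(Int P′); (d.6) δ^H(Γ, Y(closure(Int Q) \ Int P′)) < c + M; (d.7) the loop Y restricted to Q is homologous (i.e., freely homotopic) to γ within T(Γ, c + M). -/

import Mathlib

open Set Metric Function

noncomputable section

/-- ℝ³, identified with `EuclideanSpace ℝ (Fin 3)`. -/
abbrev R3 := EuclideanSpace ℝ (Fin 3)

/-- A real function on `ℂ ≃ ℝ²` is harmonic on a set if its Laplacian vanishes there. -/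
def HarmOn (f : ℂ → ℝ) (Ω : Set ℂ) : Prop :=
  ∀ z ∈ Ω,
    fderiv ℝ (fun w => fderiv ℝ f w 1) z 1 +
      fderiv ℝ (fun w => fderiv ℝ f w Complex.I) z Complex.I = 0

/-- A conformal minimal immersion on an open set `Ω ⊆ ℂ`: a smooth map whose coordinate
functions are harmonic and whose real derivative at each point of `Ω` is a positive scalar
multiple of a linear isometry (hence injective and conformal). -/
def ConfMinImmOn (X : ℂ → R3) (Ω : Set ℂ) : Prop :=
  ContDiffOn ℝ (⊤ : ℕ∞) X Ω ∧
  (∀ i : Fin 3, HarmOn (fun z => X z i) Ω) ∧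
  ∀ z ∈ Ω, ∃ c : ℝ, 0 < c ∧ ∀ v : ℂ, ‖fderiv ℝ X z v‖ = c * ‖v‖

/-- A path `γ : [0,1) → Ω` that eventually leaves every compact subset of `Ω`. -/
def DivergentPath (Ω : Set ℂ) (γ : ℝ → ℂ) : Prop :=
  ContinuousOn γ (Ico 0 1) ∧ MapsTo γ (Ico 0 1) Ω ∧
  ∀ K : Set ℂ, IsCompact K → K ⊆ Ω →
    ∃ t₀ ∈ Ico (0:ℝ) 1, ∀ t ∈ Ico t₀ 1, γ t ∉ K

/-- Completeness of an immersion `X` on `Ω`: every divergent path has image of infinite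
total variation (length). -/
def CompleteOn (X : ℂ → R3) (Ω : Set ℂ) : Prop :=
  ∀ γ : ℝ → ℂ, DivergentPath Ω γ → eVariationOn (X ∘ γ) (Ico 0 1) = ⊤

/-- Properness of `ψ : Ω → D`: preimages of compact subsets of `D` are compact. -/
def ProperIn (ψ : ℂ → R3) (Ω : Set ℂ) (D : Set R3) : Prop :=
  ∀ K : Set R3, IsCompact K → K ⊆ D → IsCompact (Ω ∩ ψ ⁻¹' K)

/-- The limit set of a map on the open unit disk. -/
def limitSet (ψ : ℂ → R3) : Set R3 :=
  closure (ψ '' ball (0:ℂ) 1) \ ψ '' ball (0:ℂ) 1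

/-- A regular strictly convex bounded domain: a nonempty bounded convex open set satisfying
uniform interior and exterior sphere conditions. -/
def RegStrictConvexDomain (C : Set R3) : Prop :=
  C.Nonempty ∧ IsOpen C ∧ Convex ℝ C ∧ Bornology.IsBounded C ∧
  ∃ r R : ℝ, 0 < r ∧ r ≤ R ∧
    ∀ p ∈ frontier C,
      (∃ x, p ∈ sphere x r ∧ closedBall x r ⊆ closure C) ∧
      (∃ y, p ∈ sphere y R ∧ closure C ⊆ closedBall y R)

/-- `R` is a uniform exterior sphere radius for `E`. -/
def ExtSphereRadius (E : Set R3) (R : ℝ) : Prop :=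
  0 < R ∧ ∀ p ∈ frontier E, ∃ y, p ∈ sphere y R ∧ closure E ⊆ closedBall y R

/-- `γ : ℝ → ℝ³`, `1`-periodic, parametrizes a smooth Jordan curve: it is `C^∞`, injective on
a period, and has nowhere-vanishing derivative. -/
def SmoothJordan (γ : ℝ → R3) : Prop :=
  ContDiff ℝ (⊤ : ℕ∞) γ ∧ Periodic γ 1 ∧
  (∀ s ∈ Ico (0:ℝ) 1, ∀ t ∈ Ico (0:ℝ) 1, γ s = γ t → s = t) ∧
  ∀ t, deriv γ t ≠ 0

/-- `p : ℝ → ℂ`, `1`-periodic, parametrizes a polygon: an injective piecewise-linear loop. -/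
def PolygonParam (p : ℝ → ℂ) : Prop :=
  Continuous p ∧ Periodic p 1 ∧
  (∀ s ∈ Ico (0:ℝ) 1, ∀ t ∈ Ico (0:ℝ) 1, p s = p t → s = t) ∧
  ∃ n : ℕ, 0 < n ∧ ∀ k : ℕ, k < n → ∀ s ∈ Icc ((k:ℝ)/n) ((k+1)/n),
    p s = p (k/n) + (((s - k/n) * n) : ℝ) • (p ((k+1)/n) - p (k/n))

/-- The interior region of a polygon `P ⊆ ℂ`: the union of the bounded connected components
of the complement of `P`. -/
def polyInt (P : Set ℂ) : Set ℂ :=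
  {z | z ∉ P ∧ Bornology.IsBounded (connectedComponentIn Pᶜ z)}

/-- The intrinsic distance, induced by `X`, within `W` from a point `z` to a set `S`:
the infimum of the lengths (total variations) of `X ∘ α` over continuous paths `α` in `W`
joining `z` to `S`. -/
def intrinsicDist (X : ℂ → R3) (W : Set ℂ) (z : ℂ) (S : Set ℂ) : ENNReal :=
  ⨅ (α : ℝ → ℂ) (_ : ContinuousOn α (Icc 0 1)) (_ : MapsTo α (Icc 0 1) W)
    (_ : α 0 = z) (_ : α 1 ∈ S), eVariationOn (X ∘ α) (Icc 0 1)

/-- Two `1`-periodic loops in `ℝ³` are freely homotopic within a set `T`. -/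
def HomotopicLoopsIn (T : Set R3) (f g : ℝ → R3) : Prop :=
  ∃ H : ℝ × ℝ → R3, Continuous H ∧
    (∀ t, H (t, 0) = f t) ∧ (∀ t, H (t, 1) = g t) ∧
    (∀ t s, H (t + 1, s) = H (t, s)) ∧
    ∀ t s, s ∈ Icc (0:ℝ) 1 → H (t, s) ∈ T

/-- The inner parallel body `E₋ₜ` of a convex open set. -/
def innerParallel (E : Set R3) (t : ℝ) : Set R3 :=
  {x ∈ E | t < infDist x Eᶜ}

/-- `f : ℝ → ℂ` has winding number `k` about the origin: it has a continuous logarithm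
increasing by `2πik` over a period. -/
def HasWind (f : ℝ → ℂ) (k : ℤ) : Prop :=
  ∃ L : ℝ → ℂ, Continuous L ∧ (∀ t, Complex.exp (L t) = f t) ∧
    ∀ t, L (t + 1) = L t + k * (2 * Real.pi * Complex.I)

theorem exists_int_eqOn_of_exp_eq {S : Set ℝ} (hS : IsPreconnected S) {L L' : ℝ → ℂ}
    (hL : ContinuousOn L S) (hL' : ContinuousOn L' S)
    (h : ∀ t ∈ S, Complex.exp (L t) = Complex.exp (L' t)) :
    ∃ n : ℤ, ∀ t ∈ S, L t = L' t + n * (2 * Real.pi * Complex.I) := by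
  have hn : ∀ t ∈ S, ∃ n : ℤ, L t = L' t + n * (2 * Real.pi * Complex.I) :=
    fun t ht => Complex.exp_eq_exp_iff_exists_int.1 (h t ht)
  rcases S.eq_empty_or_nonempty with rfl | ⟨t₀, ht₀⟩
  · exact ⟨0, by simp⟩
  choose! n hn using hn
  have hpi : (2 * Real.pi * Complex.I : ℂ) ≠ 0 := Complex.two_pi_I_ne_zero
  have hc : ContinuousOn (fun t => ((n t : ℝ))) S := by
    have : ContinuousOn (fun t => ((L t - L' t) / (2 * Real.pi * Complex.I)).re) S :=
      Complex.continuous_re.comp_continuousOn ((hL.sub hL').div_const _)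
    refine this.congr fun t ht => ?_
    dsimp only
    rw [hn t ht]
    simp only [add_sub_cancel_left]
    rw [mul_div_assoc, div_self hpi]
    simp
  have hc' : ContinuousOn n S := by
    rw [Int.isClosedEmbedding_coe_real.isEmbedding.continuousOn_iff]
    exact hc
  refine ⟨n t₀, fun t ht => ?_⟩
  rw [hn t ht, hS.constant hc' ht ht₀]

namespace HasWind

variable {f g : ℝ → ℂ} {k l : ℤ}

theorem continuous (h : HasWind f k) : Continuous f := by
  obtain ⟨L, hL, hf, -⟩ := h
  exact (Complex.continuous_exp.comp hL).congr hf

theorem ne_zero (h : HasWind f k) (t : ℝ) : f t ≠ 0 := by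
  obtain ⟨L, hL, hf, -⟩ := h
  rw [← hf]
  exact Complex.exp_ne_zero _

theorem unique (h : HasWind f k) (h' : HasWind f l) : k = l := by
  obtain ⟨L, hL, hf, hk⟩ := h
  obtain ⟨L', hL', hf', hl⟩ := h'
  obtain ⟨n, hn⟩ := exists_int_eqOn_of_exp_eq isPreconnected_univ hL.continuousOn hL'.continuousOn
    (fun t _ => by rw [hf, hf'])
  have h1 := hn (0 + 1) trivial
  rw [hk, hl, hn 0 trivial] at h1
  have hpi : (2 * Real.pi * Complex.I : ℂ) ≠ 0 := Complex.two_pi_I_ne_zero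
  have : ((k : ℂ) - l) * (2 * Real.pi * Complex.I) = 0 := by linear_combination h1
  rcases mul_eq_zero.1 this with h | h
  · exact_mod_cast sub_eq_zero.1 h
  · exact absurd h hpi

theorem exists_of_continuous (hf : Continuous f) (h0 : ∀ t, f t ≠ 0) (hp : Periodic f 1) :
    ∃ k, HasWind f k := by
  have hs : IsSimplyConnected (univ : Set ℝ) := by
    have := convex_univ.contractibleSpace (s := (univ : Set ℝ)) univ_nonempty
    exact (inferInstance : SimplyConnectedSpace (univ : Set ℝ))
  obtain ⟨L, hL, hLf⟩ := Complex.exists_continuousOn_eqOn_exp_comp hs isOpen_univ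
    hf.continuousOn (by rintro ⟨t, -, ht⟩; exact h0 t ht)
  have hL := continuousOn_univ.1 hL
  have hLf : ∀ t, Complex.exp (L t) = f t := fun t => hLf (mem_univ t)
  obtain ⟨n, hn⟩ := exists_int_eqOn_of_exp_eq (L := fun t => L (t + 1)) (L' := L)
    isPreconnected_univ (by fun_prop) hL.continuousOn
    (fun t _ => by rw [hLf, hLf, hp])
  exact ⟨n, L, hL, hLf, fun t => hn t trivial⟩

theorem mul (h : HasWind f k) (h' : HasWind g l) : HasWind (fun t => f t * g t) (k + l) := by
  obtain ⟨L, hL, hf, hk⟩ := h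
  obtain ⟨L', hL', hf', hl⟩ := h'
  refine ⟨fun t => L t + L' t, by fun_prop, fun t => by rw [Complex.exp_add, hf, hf'],
    fun t => ?_⟩
  dsimp only
  rw [hk, hl]
  push_cast
  ring

theorem inv (h : HasWind f k) : HasWind (fun t => (f t)⁻¹) (-k) := by
  obtain ⟨L, hL, hf, hk⟩ := h
  refine ⟨fun t => -L t, by fun_prop, fun t => by rw [Complex.exp_neg, hf],
    fun t => ?_⟩
  dsimp only
  rw [hk]
  push_cast
  ring

theorem of_mem_slitPlane (hf : Continuous f) (hs : ∀ t, f t ∈ Complex.slitPlane)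
    (hp : Periodic f 1) : HasWind f 0 := by
  refine ⟨fun t => Complex.log (f t), hf.clog hs, fun t => Complex.exp_log
    (Complex.slitPlane_ne_zero (hs t)), fun t => ?_⟩
  simp [hp t]

theorem congr_of_near (h : HasWind f k) (hg : Continuous g) (hfp : Periodic f 1)
    (hgp : Periodic g 1) (hfg : ∀ t, ‖g t - f t‖ < ‖f t‖) : HasWind g k := by
  have h1 : HasWind (fun t => 1 + (g t - f t) / f t) 0 := by
    refine of_mem_slitPlane ?_ (fun t => ?_) (fun t => ?_)
    · exact continuous_const.add ((hg.sub h.continuous).div h.continuous h.ne_zero)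
    · refine Complex.mem_slitPlane_of_norm_lt_one ?_
      rw [norm_div, div_lt_one (norm_pos_iff.2 (h.ne_zero t))]
      exact hfg t
    · simp only [hfp t, hgp t]
  have h2 := h.mul h1
  rw [add_zero] at h2
  convert h2 using 2 with t
  have := h.ne_zero t
  field_simp
  ring

theorem exp_two_pi (k : ℤ) :
    HasWind (fun t : ℝ => Complex.exp (k * (2 * Real.pi * Complex.I) * t)) k := by
  refine ⟨fun t => k * (2 * Real.pi * Complex.I) * t, by fun_prop, fun t => rfl, fun t => ?_⟩
  push_cast
  ring

end HasWind

/-- The winding number as a locally constant function of the base point. -/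
theorem HasWind.eq_of_isPreconnected {p : ℝ → ℂ} (hp : Continuous p) (hper : Periodic p 1)
    {C : Set ℂ} (hC : IsPreconnected C) (hCp : C ⊆ (range p)ᶜ) {z w : ℂ} (hz : z ∈ C) (hw : w ∈ C)
    {k : ℤ} (hk : HasWind (fun t => p t - z) k) : HasWind (fun t => p t - w) k := by
  have hex : ∀ w ∈ C, ∃ k, HasWind (fun t => p t - w) k := fun w hw =>
    HasWind.exists_of_continuous (by fun_prop)
      (fun t h => hCp hw ⟨t, sub_eq_zero.1 h⟩) (fun t => by simp only [hper t])
  choose! n hn using hex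
  have hc : ContinuousOn n C := by
    intro w hw
    have hcl : IsClosed (range p) := by
      have : range p = p '' Icc 0 1 := by
        have := hper.image_Icc one_pos 0
        rw [zero_add] at this
        exact this.symm
      rw [this]
      exact (isCompact_Icc.image hp).isClosed
    obtain ⟨r, hr, hb⟩ := Metric.isOpen_iff.1 hcl.isOpen_compl w (hCp hw)
    refine (tendsto_const_nhds (x := n w)).congr' ?_
    filter_upwards [self_mem_nhdsWithin, mem_nhdsWithin_of_mem_nhds (ball_mem_nhds w hr)]
      with w' hw' hwb
    refine HasWind.unique ((hn w hw).congr_of_near (by fun_prop) (fun t => by simp only [hper t])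
      (fun t => by simp only [hper t]) fun t => ?_) (hn w' hw')
    have h1 : r ≤ ‖p t - w‖ := by
      by_contra! hlt
      exact hb (mem_ball_iff_norm.2 hlt) ⟨t, rfl⟩
    have h2 : ‖w' - w‖ < r := mem_ball_iff_norm.1 hwb
    have h3 : p t - w' - (p t - w) = -(w' - w) := by ring
    rw [h3, norm_neg]
    exact h2.trans_le h1
  rw [(hn z hz).unique hk |>.symm, hC.constant hc hz hw]
  exact hn w hw

theorem HasWind.zero_of_norm_lt {p : ℝ → ℂ} (hp : Continuous p) (hper : Periodic p 1) {w : ℂ}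
    (h : ∀ t, ‖p t‖ < ‖w‖) : HasWind (fun t => p t - w) 0 := by
  have hw : w ≠ 0 := norm_pos_iff.1 ((norm_nonneg _).trans_lt (h 0))
  have hc : HasWind (fun _ => -w) 0 :=
    ⟨fun _ => Complex.log (-w), by fun_prop, fun t => Complex.exp_log (neg_ne_zero.2 hw), by simp⟩
  refine hc.congr_of_near (by fun_prop) (fun t => rfl) (fun t => by simp only [hper t])
    fun t => ?_
  simpa using h t

namespace PolygonParam

variable {p : ℝ → ℂ}

theorem continuous (hp : PolygonParam p) : Continuous p := hp.1

theorem periodic (hp : PolygonParam p) : Periodic p 1 := hp.2.1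

theorem range_eq (hp : PolygonParam p) (s : ℝ) : range p = p '' Icc s (s + 1) :=
  (hp.periodic.image_Icc one_pos s).symm

theorem isCompact_range (hp : PolygonParam p) : IsCompact (range p) := by
  rw [hp.range_eq 0]
  exact isCompact_Icc.image hp.continuous

theorem exists_int_of_eq (hp : PolygonParam p) {s t : ℝ} (h : p s = p t) :
    ∃ m : ℤ, s = t + m := by
  have hf : ∀ x : ℝ, p (Int.fract x) = p x := fun x => by
    have := hp.periodic.sub_zsmul_eq (x := x) ⌊x⌋
    rwa [zsmul_one] at this
  have := hp.2.2.1 (Int.fract s) ⟨Int.fract_nonneg s, Int.fract_lt_one s⟩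
    (Int.fract t) ⟨Int.fract_nonneg t, Int.fract_lt_one t⟩ (by rw [hf, hf, h])
  exact ⟨⌊s⌋ - ⌊t⌋, by push_cast; linarith [Int.fract_add_floor s, Int.fract_add_floor t]⟩

theorem exists_right_affine (hp : PolygonParam p) (s₀ : ℝ) :
    ∃ δ > 0, ∃ e : ℂ, ∀ h ∈ Icc 0 δ, p (s₀ + h) = p s₀ + h • e := by
  obtain ⟨n, hn, hk⟩ := hp.2.2.2
  have hn' : (0 : ℝ) < n := by exact_mod_cast hn
  have hf : ∀ h : ℝ, p (s₀ + h) = p (Int.fract s₀ + h) := fun h => by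
    have := hp.periodic.sub_zsmul_eq (x := s₀ + h) ⌊s₀⌋
    rw [zsmul_one] at this
    rw [← this, Int.fract]
    ring_nf
  set s := Int.fract s₀
  have hs0 : 0 ≤ s := Int.fract_nonneg s₀
  have hs1 : s < 1 := Int.fract_lt_one s₀
  set k := ⌊s * n⌋₊ with hkdef
  have hk1 : (k : ℝ) ≤ s * n := Nat.floor_le (by positivity)
  have hk2 : s * n < k + 1 := Nat.lt_floor_add_one _
  have hkn : k < n := by
    have : (k : ℝ) < n := by nlinarith
    exact_mod_cast this
  have h1 : (k : ℝ) / n ≤ s := by rwa [div_le_iff₀ hn']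
  have h2 : s < (k + 1 : ℝ) / n := by rwa [lt_div_iff₀ hn']
  refine ⟨(k + 1 : ℝ) / n - s, by linarith, (n : ℝ) • (p ((k + 1) / n) - p (k / n)),
    fun h hh => ?_⟩
  have h0 := hf 0
  rw [add_zero, add_zero] at h0
  rw [hf, h0, hk k hkn (s + h) ⟨by linarith [hh.1], by linarith [hh.2]⟩,
    hk k hkn s ⟨h1, h2.le⟩, smul_smul, add_assoc, ← add_smul]
  congr 2
  ring

theorem exists_left_affine (hp : PolygonParam p) (s₀ : ℝ) :
    ∃ δ > 0, ∃ e : ℂ, ∀ h ∈ Icc 0 δ, p (s₀ - h) = p s₀ + h • e := by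
  obtain ⟨n, hn, hk⟩ := hp.2.2.2
  have hn' : (0 : ℝ) < n := by exact_mod_cast hn
  set s := s₀ - (⌈s₀⌉ - 1 : ℤ) with hs
  have hf : ∀ h : ℝ, p (s₀ - h) = p (s - h) := fun h => by
    have := hp.periodic.sub_zsmul_eq (x := s₀ - h) (⌈s₀⌉ - 1)
    rw [zsmul_one] at this
    rw [← this, hs]
    ring_nf
  have hs0 : 0 < s := by rw [hs]; push_cast; linarith [Int.ceil_lt_add_one s₀]
  have hs1 : s ≤ 1 := by rw [hs]; push_cast; linarith [Int.le_ceil s₀]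
  have hc0 : 0 < ⌈s * n⌉₊ := Nat.ceil_pos.2 (by positivity)
  obtain ⟨k, hkdef⟩ : ∃ k, ⌈s * n⌉₊ = k + 1 := ⟨⌈s * n⌉₊ - 1, by omega⟩
  have hk1 : s * n ≤ k + 1 := by
    have := Nat.le_ceil (s * n)
    rw [hkdef] at this
    exact_mod_cast this
  have hk2 : (k : ℝ) < s * n := by
    have := Nat.ceil_lt_add_one (a := s * n) (by positivity)
    rw [hkdef] at this
    push_cast at this
    linarith
  have hkn : k < n := by
    have : (k : ℝ) < n := by nlinarith
    exact_mod_cast this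
  have h1 : (k : ℝ) / n < s := by rwa [div_lt_iff₀ hn']
  have h2 : s ≤ (k + 1 : ℝ) / n := by rwa [le_div_iff₀ hn']
  refine ⟨s - k / n, by linarith, -((n : ℝ) • (p ((k + 1) / n) - p (k / n))),
    fun h hh => ?_⟩
  have h0 := hf 0
  rw [sub_zero, sub_zero] at h0
  rw [hf, h0, hk k hkn (s - h) ⟨by linarith [hh.2], by linarith [hh.1]⟩,
    hk k hkn s ⟨h1.le, h2⟩, smul_neg, smul_smul, add_assoc, ← sub_eq_add_neg, ← sub_smul]
  congr 2
  ring

/-- Near each of its points a polygon consists of two radii. -/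
theorem exists_two_radii (hp : PolygonParam p) (s₀ : ℝ) :
    ∃ η > 0, ∃ θ₁ θ₂ : ℝ, θ₁ < θ₂ ∧ θ₂ < θ₁ + 2 * Real.pi ∧ ∀ w ∈ ball (p s₀) η,
      (w ∈ range p ↔ ∃ r : ℝ, 0 ≤ r ∧ r < η ∧
        (w = p s₀ + r * Complex.exp (θ₁ * Complex.I) ∨
          w = p s₀ + r * Complex.exp (θ₂ * Complex.I))) := by
  obtain ⟨δ₁, hδ₁, e₁, he₁⟩ := hp.exists_right_affine s₀
  obtain ⟨δ₂, hδ₂, e₂, he₂⟩ := hp.exists_left_affine s₀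
  obtain ⟨δ, hδ, hδ1, hδ2, hδ3⟩ : ∃ δ > 0, δ ≤ δ₁ ∧ δ ≤ δ₂ ∧ δ ≤ 1 / 3 :=
    ⟨min (min δ₁ δ₂) (1 / 3), by positivity, (min_le_left _ _).trans (min_le_left _ _),
      (min_le_left _ _).trans (min_le_right _ _), min_le_right _ _⟩
  replace he₁ : ∀ h ∈ Icc 0 δ, p (s₀ + h) = p s₀ + h • e₁ := fun h hh =>
    he₁ h ⟨hh.1, hh.2.trans hδ1⟩
  replace he₂ : ∀ h ∈ Icc 0 δ, p (s₀ - h) = p s₀ + h • e₂ := fun h hh =>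
    he₂ h ⟨hh.1, hh.2.trans hδ2⟩
  have hInt : ∀ m : ℤ, |(m : ℝ)| < 1 → m = 0 := fun m hm => by
    have : |m| < 1 := by exact_mod_cast hm
    exact Int.abs_lt_one_iff.1 this
  have hne1 : e₁ ≠ 0 := by
    rintro rfl
    obtain ⟨m, hm⟩ := hp.exists_int_of_eq (s := s₀ + δ) (t := s₀)
      (by rw [he₁ δ ⟨hδ.le, le_rfl⟩, smul_zero, add_zero])
    have : m = 0 := hInt m (by rw [abs_lt]; constructor <;> linarith)
    subst this
    push_cast at hm
    linarith
  have hne2 : e₂ ≠ 0 := by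
    rintro rfl
    obtain ⟨m, hm⟩ := hp.exists_int_of_eq (s := s₀ - δ) (t := s₀)
      (by rw [he₂ δ ⟨hδ.le, le_rfl⟩, smul_zero, add_zero])
    have : m = 0 := hInt m (by rw [abs_lt]; constructor <;> linarith)
    subst this
    push_cast at hm
    linarith
  have hn1 : 0 < ‖e₁‖ := norm_pos_iff.2 hne1
  have hn2 : 0 < ‖e₂‖ := norm_pos_iff.2 hne2
  have hpol : ∀ e : ℂ, e = (‖e‖ : ℂ) * Complex.exp (e.arg * Complex.I) := fun e =>
    (Complex.norm_mul_exp_arg_mul_I e).symm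
  have hargne : e₁.arg ≠ e₂.arg := by
    intro harg
    set x := δ * min 1 (‖e₂‖ / ‖e₁‖)
    set y := δ * min (‖e₁‖ / ‖e₂‖) 1
    have hx0 : 0 < x := by positivity
    have hy0 : 0 < y := by positivity
    have hx1 : x ≤ δ := mul_le_of_le_one_right hδ.le (min_le_left _ _)
    have hy1 : y ≤ δ := mul_le_of_le_one_right hδ.le (min_le_right _ _)
    have hxy : x * ‖e₁‖ = y * ‖e₂‖ := by
      simp only [x, y]
      rcases le_total ‖e₁‖ ‖e₂‖ with h | h
      · rw [min_eq_left ((one_le_div hn1).2 h), min_eq_left ((div_le_one hn2).2 h)]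
        field_simp
      · rw [min_eq_right ((div_le_one hn1).2 h), min_eq_right ((one_le_div hn2).2 h)]
        field_simp
    have hxy' : (x : ℂ) * ‖e₁‖ = y * ‖e₂‖ := by exact_mod_cast hxy
    obtain ⟨m, hm⟩ := hp.exists_int_of_eq (s := s₀ + x) (t := s₀ - y) (by
      rw [he₁ x ⟨hx0.le, hx1⟩, he₂ y ⟨hy0.le, hy1⟩, hpol e₁, hpol e₂, harg,
        Complex.real_smul, Complex.real_smul, ← mul_assoc, ← mul_assoc, hxy'])
    have : m = 0 := hInt m (by rw [abs_lt]; constructor <;> linarith)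
    subst this
    push_cast at hm
    linarith
  -- the rest of the polygon stays away
  have hK : IsCompact (p '' Icc (s₀ + δ) (s₀ + 1 - δ)) := isCompact_Icc.image hp.continuous
  have hKs : p s₀ ∉ p '' Icc (s₀ + δ) (s₀ + 1 - δ) := by
    rintro ⟨t, ht, hts⟩
    obtain ⟨m, hm⟩ := hp.exists_int_of_eq hts
    have : m = 0 := hInt m (by rw [abs_lt]; constructor <;> linarith [ht.1, ht.2])
    subst this
    push_cast at hm
    linarith [ht.1]
  obtain ⟨η₀, hη₀, hη₀K⟩ := Metric.isOpen_iff.1 hK.isClosed.isOpen_compl _ hKs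
  set η := min η₀ (min (δ * ‖e₁‖) (δ * ‖e₂‖)) with hη
  have hηpos : 0 < η := by positivity
  have hηa : η ≤ η₀ := min_le_left _ _
  have hη1 : η ≤ δ * ‖e₁‖ := (min_le_right _ _).trans (min_le_left _ _)
  have hη2 : η ≤ δ * ‖e₂‖ := (min_le_right _ _).trans (min_le_right _ _)
  have key : ∀ w ∈ ball (p s₀) η,
      (w ∈ range p ↔ ∃ r : ℝ, 0 ≤ r ∧ r < η ∧
        (w = p s₀ + r * Complex.exp (e₁.arg * Complex.I) ∨
          w = p s₀ + r * Complex.exp (e₂.arg * Complex.I))) := by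
    intro w hw
    constructor
    · intro hwp
      have hdist : ∀ (h : ℝ) (e : ℂ), 0 ≤ h → w = p s₀ + h • e →
          h * ‖e‖ < η ∧ w = p s₀ + (h * ‖e‖ : ℝ) * Complex.exp (e.arg * Complex.I) := by
        intro h e hh hwe
        constructor
        · have := mem_ball_iff_norm.1 hw
          rwa [hwe, add_sub_cancel_left, norm_smul, Real.norm_of_nonneg hh] at this
        · rw [hwe, Complex.real_smul, Complex.ofReal_mul, mul_assoc, ← hpol]
      rw [hp.range_eq (s₀ - δ)] at hwp
      obtain ⟨t, ht, rfl⟩ := hwp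
      rcases le_total t s₀ with h1 | h1
      · have hA := he₂ (s₀ - t) ⟨by linarith, by linarith [ht.1]⟩
        rw [sub_sub_cancel] at hA
        obtain ⟨h3, h4⟩ := hdist _ _ (by linarith) hA
        exact ⟨_, mul_nonneg (by linarith) hn2.le, h3, Or.inr h4⟩
      rcases le_total t (s₀ + δ) with h2 | h2
      · have hA := he₁ (t - s₀) ⟨by linarith, by linarith⟩
        rw [add_sub_cancel] at hA
        obtain ⟨h3, h4⟩ := hdist _ _ (by linarith) hA
        exact ⟨_, mul_nonneg (by linarith) hn1.le, h3, Or.inl h4⟩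
      · exact absurd ⟨t, ⟨h2, by linarith [ht.2]⟩, rfl⟩ (hη₀K (ball_subset_ball hηa hw))
    · rintro ⟨r, hr0, hrη, h | h⟩
      · refine ⟨s₀ + r / ‖e₁‖, ?_⟩
        rw [he₁ _ ⟨by positivity, (div_le_iff₀ hn1).2 (by linarith)⟩, h, Complex.real_smul]
        nth_rw 2 [hpol e₁]
        push_cast
        have : (‖e₁‖ : ℂ) ≠ 0 := by exact_mod_cast hn1.ne'
        field_simp
      · refine ⟨s₀ - r / ‖e₂‖, ?_⟩
        rw [he₂ _ ⟨by positivity, (div_le_iff₀ hn2).2 (by linarith)⟩, h, Complex.real_smul]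
        nth_rw 2 [hpol e₂]
        push_cast
        have : (‖e₂‖ : ℂ) ≠ 0 := by exact_mod_cast hn2.ne'
        field_simp
  rcases lt_or_gt_of_ne hargne with h | h
  · exact ⟨η, hηpos, _, _, h, by linarith [Complex.arg_le_pi e₂, Complex.neg_pi_lt_arg e₁], key⟩
  · refine ⟨η, hηpos, _, _, h, by linarith [Complex.arg_le_pi e₁, Complex.neg_pi_lt_arg e₂],
      fun w hw => (key w hw).trans ?_⟩
    simp only [or_comm]

end PolygonParam

/-- The open circular sector with vertex `c`, radius `η` and angles between `α` and `β`. -/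
def circSector (c : ℂ) (η α β : ℝ) : Set ℂ :=
  (fun q : ℝ × ℝ => c + q.1 * Complex.exp (q.2 * Complex.I)) '' (Ioo 0 η ×ˢ Ioo α β)

namespace circSector

variable {c : ℂ} {η α β : ℝ}

theorem isPreconnected : IsPreconnected (circSector c η α β) :=
  (isPreconnected_Ioo.prod isPreconnected_Ioo).image _ (by fun_prop)

theorem subset_ball : circSector c η α β ⊆ ball c η := by
  rintro _ ⟨⟨r, θ⟩, ⟨hr, -⟩, rfl⟩
  rw [mem_ball_iff_norm, add_sub_cancel_left, norm_mul, Complex.norm_exp_ofReal_mul_I, mul_one,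
    Complex.norm_real, Real.norm_of_nonneg hr.1.le]
  exact hr.2

theorem nonempty (hη : 0 < η) (hαβ : α < β) : (circSector c η α β).Nonempty :=
  (Set.Nonempty.prod (nonempty_Ioo.2 hη) (nonempty_Ioo.2 hαβ)).image _

theorem mem_closure (hη : 0 < η) (hαβ : α < β) {r θ : ℝ} (hr : r ∈ Icc 0 η) (hθ : θ ∈ Icc α β) :
    c + r * Complex.exp (θ * Complex.I) ∈ closure (circSector c η α β) := by
  refine image_closure_subset_closure_image (f := fun q : ℝ × ℝ =>
    c + q.1 * Complex.exp (q.2 * Complex.I)) (by fun_prop) ⟨(r, θ), ?_, rfl⟩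
  rw [closure_prod_eq, closure_Ioo hη.ne, closure_Ioo hαβ.ne]
  exact ⟨hr, hθ⟩

end circSector

theorem PolygonParam.exists_two_sides {p : ℝ → ℂ} (hp : PolygonParam p) (s₀ : ℝ) :
    ∃ η₀ > 0, ∀ η, 0 < η → η ≤ η₀ → ∃ S₁ S₂ : Set ℂ, IsPreconnected S₁ ∧ IsPreconnected S₂ ∧
      S₁.Nonempty ∧ S₂.Nonempty ∧
      ball (p s₀) η \ range p = S₁ ∪ S₂ ∧ ball (p s₀) η ∩ range p ⊆ closure S₁ ∧
      ball (p s₀) η ∩ range p ⊆ closure S₂ := by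
  obtain ⟨η₀, hη₀, θ₁, θ₂, h12, h21, H⟩ := hp.exists_two_radii s₀
  refine ⟨η₀, hη₀, fun η hη hηη => ⟨circSector (p s₀) η θ₁ θ₂,
    circSector (p s₀) η θ₂ (θ₁ + 2 * Real.pi), circSector.isPreconnected,
    circSector.isPreconnected, circSector.nonempty hη h12, circSector.nonempty hη h21, ?_, ?_, ?_⟩⟩
  · have hsec : ∀ r θ : ℝ, r ∈ Ioo 0 η → θ₁ < θ → θ < θ₁ + 2 * Real.pi → θ ≠ θ₂ →
        p s₀ + r * Complex.exp (θ * Complex.I) ∉ range p := by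
      intro r θ hr h1 h2 h3 hmem
      have hb : p s₀ + r * Complex.exp (θ * Complex.I) ∈ ball (p s₀) η₀ := by
        rw [mem_ball_iff_norm, add_sub_cancel_left, norm_mul, Complex.norm_exp_ofReal_mul_I,
          mul_one, Complex.norm_real, Real.norm_of_nonneg hr.1.le]
        exact hr.2.trans_le hηη
      have hcancel : ∀ r' θ' : ℝ, 0 ≤ r' → p s₀ + r * Complex.exp (θ * Complex.I) =
          p s₀ + r' * Complex.exp (θ' * Complex.I) → ∃ n : ℤ, θ = θ' + n * (2 * Real.pi) := by
        intro r' θ' hr' h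
        have h4 := add_left_cancel h
        have h5 := congrArg norm h4
        rw [norm_mul, norm_mul, Complex.norm_exp_ofReal_mul_I, Complex.norm_exp_ofReal_mul_I,
          mul_one, mul_one, Complex.norm_real, Complex.norm_real, Real.norm_of_nonneg hr.1.le,
          Real.norm_of_nonneg hr'] at h5
        subst h5
        have hr0 : (r : ℂ) ≠ 0 := by exact_mod_cast hr.1.ne'
        obtain ⟨n, hn⟩ := Complex.exp_eq_exp_iff_exists_int.1 (mul_left_cancel₀ hr0 h4)
        refine ⟨n, ?_⟩
        have : (θ : ℂ) * Complex.I = ((θ' + n * (2 * Real.pi) : ℝ) : ℂ) * Complex.I := by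
          rw [hn]; push_cast; ring
        exact_mod_cast mul_right_cancel₀ Complex.I_ne_zero this
      obtain ⟨r', hr'0, -, h4 | h4⟩ := (H _ hb).1 hmem
      · obtain ⟨n, hn⟩ := hcancel _ _ hr'0 h4
        have hn0 : 0 < (n : ℝ) := by
          by_contra! hcon
          nlinarith [Real.pi_pos]
        have hn1 : (n : ℝ) < 1 := by
          by_contra! hcon
          nlinarith [Real.pi_pos]
        have hn0' : 0 < n := by exact_mod_cast hn0
        have hn1' : n < 1 := by exact_mod_cast hn1
        omega
      · obtain ⟨n, hn⟩ := hcancel _ _ hr'0 h4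
        have hn0 : -1 < (n : ℝ) := by
          by_contra! hcon
          nlinarith [Real.pi_pos]
        have hn1 : (n : ℝ) < 1 := by
          by_contra! hcon
          nlinarith [Real.pi_pos]
        have hn0' : -1 < n := by exact_mod_cast hn0
        have hn1' : n < 1 := by exact_mod_cast hn1
        have : n = 0 := by omega
        subst this
        simp at hn
        exact h3 hn
    apply Subset.antisymm
    · rintro w ⟨hw, hwp⟩
      set r := ‖w - p s₀‖ with hr
      set θ := toIcoMod Real.two_pi_pos θ₁ (w - p s₀).arg with hθ
      have hθm := toIcoMod_mem_Ico Real.two_pi_pos θ₁ (w - p s₀).arg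
      rw [← hθ] at hθm
      have hwr : w = p s₀ + r * Complex.exp (θ * Complex.I) := by
        have h1 : Complex.exp (θ * Complex.I) = Complex.exp ((w - p s₀).arg * Complex.I) := by
          rw [hθ, toIcoMod, Complex.exp_eq_exp_iff_exists_int]
          refine ⟨-toIcoDiv Real.two_pi_pos θ₁ (w - p s₀).arg, ?_⟩
          rw [zsmul_eq_mul]
          push_cast
          ring
        rw [h1, hr, Complex.norm_mul_exp_arg_mul_I]
        ring
      have hrη : r < η := mem_ball_iff_norm.1 hw
      have hw₀ : w ∈ ball (p s₀) η₀ := ball_subset_ball hηη hw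
      have hr0 : 0 < r := by
        refine (norm_nonneg _).lt_of_ne fun h => hwp ⟨s₀, ?_⟩
        rw [eq_comm, norm_eq_zero, sub_eq_zero] at h
        exact h.symm
      have hθ1 : θ ≠ θ₁ := fun h => hwp ((H w hw₀).2 ⟨r, hr0.le, hrη.trans_le hηη,
        Or.inl (by rw [← h]; exact hwr)⟩)
      have hθ2 : θ ≠ θ₂ := fun h => hwp ((H w hw₀).2 ⟨r, hr0.le, hrη.trans_le hηη,
        Or.inr (by rw [← h]; exact hwr)⟩)
      rcases lt_or_gt_of_ne hθ2 with h | h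
      · exact Or.inl ⟨(r, θ), ⟨⟨hr0, hrη⟩, ⟨lt_of_le_of_ne hθm.1 hθ1.symm, h⟩⟩, hwr.symm⟩
      · exact Or.inr ⟨(r, θ), ⟨⟨hr0, hrη⟩, ⟨h, hθm.2⟩⟩, hwr.symm⟩
    · refine union_subset (fun w hw => ⟨circSector.subset_ball hw, ?_⟩)
        (fun w hw => ⟨circSector.subset_ball hw, ?_⟩)
      · obtain ⟨⟨r, θ⟩, ⟨hr, hθ⟩, rfl⟩ := hw
        exact hsec r θ hr hθ.1 (hθ.2.trans h21) hθ.2.ne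
      · obtain ⟨⟨r, θ⟩, ⟨hr, hθ⟩, rfl⟩ := hw
        exact hsec r θ hr (h12.trans hθ.1) hθ.2 hθ.1.ne'
  all_goals
    rintro w ⟨hw, hwp⟩
    obtain ⟨r, hr0, -, h⟩ := (H w (ball_subset_ball hηη hw)).1 hwp
    have hrη : r < η := by
      rcases h with h | h <;>
      · have := mem_ball_iff_norm.1 hw
        rwa [h, add_sub_cancel_left, norm_mul, Complex.norm_exp_ofReal_mul_I,
          mul_one, Complex.norm_real, Real.norm_of_nonneg hr0] at this
  · rcases h with rfl | rfl
    · exact circSector.mem_closure hη h12 ⟨hr0, hrη.le⟩ ⟨le_rfl, h12.le⟩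
    · exact circSector.mem_closure hη h12 ⟨hr0, hrη.le⟩ ⟨h12.le, le_rfl⟩
  · rcases h with rfl | rfl
    · have := circSector.mem_closure (c := p s₀) hη h21 (r := r) (θ := θ₁ + 2 * Real.pi)
        ⟨hr0, hrη.le⟩ ⟨h21.le, le_rfl⟩
      convert this using 3
      push_cast
      rw [add_mul, Complex.exp_add, Complex.exp_two_pi_mul_I, mul_one]
    · exact circSector.mem_closure hη h21 ⟨hr0, hrη.le⟩ ⟨le_rfl, h21.le⟩

namespace PolygonParam

variable {p : ℝ → ℂ}

theorem range_subset_closure_component (hp : PolygonParam p) {z : ℂ} (hz : z ∉ range p) :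
    range p ⊆ closure (connectedComponentIn (range p)ᶜ z) := by
  set C := connectedComponentIn (range p)ᶜ z with hC
  have hop : IsOpen (range p)ᶜ := hp.isCompact_range.isClosed.isOpen_compl
  have hCo : IsOpen C := hop.connectedComponentIn
  have hzC : z ∈ C := mem_connectedComponentIn hz
  have hCsub : C ⊆ (range p)ᶜ := connectedComponentIn_subset _ _
  have hcl : IsClosed {s | p s ∈ closure C} := isClosed_closure.preimage hp.continuous
  have hopen : IsOpen {s | p s ∈ closure C} := by
    rw [isOpen_iff_mem_nhds]
    intro s hs
    obtain ⟨η, hη, H⟩ := hp.exists_two_sides s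
    obtain ⟨S₁, S₂, h1, h2, -, -, hU, hc1, hc2⟩ := H η hη le_rfl
    obtain ⟨w, hwb, hwC⟩ := mem_closure_iff.1 hs _ isOpen_ball (mem_ball_self hη)
    have hw : w ∈ S₁ ∪ S₂ := hU ▸ ⟨hwb, hCsub hwC⟩
    have hsub : ∀ S, IsPreconnected S → S ⊆ S₁ ∪ S₂ → w ∈ S → S ⊆ C := by
      intro S hS hSU hwS
      have : S ⊆ (range p)ᶜ := fun x hx => ((hU.symm ▸ hSU hx : x ∈ ball (p s) η \ range p)).2
      have h3 := hS.subset_connectedComponentIn hwS this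
      rwa [← connectedComponentIn_eq hwC] at h3
    have hfin : ball (p s) η ∩ range p ⊆ closure C := by
      rcases hw with hw | hw
      · exact hc1.trans (closure_mono (hsub S₁ h1 subset_union_left hw))
      · exact hc2.trans (closure_mono (hsub S₂ h2 subset_union_right hw))
    filter_upwards [hp.continuous.continuousAt.preimage_mem_nhds (ball_mem_nhds (p s) hη)]
      with t ht
    exact hfin ⟨ht, t, rfl⟩
  have hne : {s | p s ∈ closure C}.Nonempty := by
    have hfr : (frontier C).Nonempty := by
      rw [nonempty_frontier_iff]
      exact ⟨⟨z, hzC⟩, fun h => hCsub (h ▸ mem_univ (p 0)) ⟨0, rfl⟩⟩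
    obtain ⟨w, hw⟩ := hfr
    have hwp : w ∈ range p := by
      by_contra hwp
      have h3 : w ∈ connectedComponentIn (range p)ᶜ w := mem_connectedComponentIn hwp
      have hwo : IsOpen (connectedComponentIn (range p)ᶜ w) := hop.connectedComponentIn
      obtain ⟨x, hx1, hx2⟩ := mem_closure_iff.1 hw.1 _ hwo h3
      have := (connectedComponentIn_eq hx1).trans (connectedComponentIn_eq hx2).symm
      rw [this] at h3
      exact hw.2 (by rwa [hCo.interior_eq])
    obtain ⟨s, rfl⟩ := hwp
    exact ⟨s, hw.1⟩
  have := IsClopen.eq_univ ⟨hcl, hopen⟩ hne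
  rintro _ ⟨s, rfl⟩
  exact (this ▸ mem_univ s : s ∈ {s | p s ∈ closure C})

end PolygonParam

theorem exp_two_arctan_mul_I {x y : ℝ} (hx : 0 < x) :
    Complex.exp (-(Real.pi * Complex.I) + 2 * Real.arctan (y / x) * Complex.I) =
      ((y : ℂ) - x * Complex.I) * ((y : ℂ) + x * Complex.I)⁻¹ := by
  have hxc : (x : ℂ) ≠ 0 := by exact_mod_cast hx.ne'
  set φ := Real.arctan (y / x)
  have hcos : 0 < Real.cos φ := Real.cos_arctan_pos _
  have hsin : Real.sin φ = y / x * Real.cos φ := by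
    rw [← Real.tan_mul_cos hcos.ne', Real.tan_arctan]
  have hden : (y : ℂ) + x * Complex.I ≠ 0 := by
    intro h
    have := congrArg Complex.im h
    simp at this
    exact hx.ne' this
  have h1 : Complex.exp (φ * Complex.I) * (x - y * Complex.I) =
      Complex.exp (-(φ * Complex.I)) * (x + y * Complex.I) := by
    rw [← neg_mul, ← Complex.ofReal_neg, Complex.exp_mul_I, Complex.exp_mul_I,
      ← Complex.ofReal_cos, ← Complex.ofReal_sin, ← Complex.ofReal_cos, ← Complex.ofReal_sin,
      Real.cos_neg, Real.sin_neg, hsin]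
    push_cast
    field_simp
    ring
  have h2 : Complex.exp (-(Real.pi * Complex.I)) = -1 := by
    rw [Complex.exp_neg, Complex.exp_pi_mul_I]
    norm_num
  have h3 : Complex.exp (2 * φ * Complex.I) =
      Complex.exp (φ * Complex.I) * Complex.exp (φ * Complex.I) := by
    rw [← Complex.exp_add]
    ring_nf
  have h4 : Complex.exp (φ * Complex.I) * Complex.exp (-(φ * Complex.I)) = 1 := by
    rw [← Complex.exp_add]
    simp
  rw [Complex.exp_add, h2, h3]
  rw [eq_mul_inv_iff_mul_eq₀ hden]
  have hI := Complex.I_mul_I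
  linear_combination (-Complex.I * Complex.exp (φ * Complex.I)) * h1 -
    Complex.I * (x + y * Complex.I) * h4 + (-Complex.exp (φ * Complex.I) ^ 2 * y - y) * hI

namespace PolygonParam

variable {p : ℝ → ℂ}

/-- Across the middle of an edge the winding number of a polygon jumps by one. -/
theorem exists_wind_jump (hp : PolygonParam p) :
    ∃ s₀, ∀ η > 0, ∃ w₁ ∈ ball (p s₀) η, ∃ w₂ ∈ ball (p s₀) η, w₁ ∉ range p ∧ w₂ ∉ range p ∧
      ∃ k : ℤ, HasWind (fun t => p t - w₁) (k + 1) ∧ HasWind (fun t => p t - w₂) k := by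
  obtain ⟨n, hn, hk⟩ := hp.2.2.2
  have hn' : (0 : ℝ) < n := by exact_mod_cast hn
  have hn1 : (1 : ℝ) ≤ n := by exact_mod_cast hn
  set τ : ℝ := 1 / n with hτ
  have hτ0 : 0 < τ := by positivity
  have hτ1 : τ ≤ 1 := by rw [hτ, div_le_one hn']; exact hn1
  have hedge : ∀ s ∈ Icc 0 τ, p s = p 0 + ((s * n : ℝ)) • (p τ - p 0) := by
    intro s hs
    have := hk 0 hn s (by simpa [hτ] using hs)
    simpa [hτ] using this
  set m := p (τ / 2) with hm
  have hmid : m = p 0 + (1 / 2 : ℝ) • (p τ - p 0) := by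
    rw [hm, hedge _ ⟨by positivity, by linarith⟩, hτ]
    congr 2
    field_simp
  have hAB : p τ - p 0 ≠ 0 := by
    intro h
    rw [h, smul_zero, add_zero] at hmid
    have := hp.2.2.1 (τ / 2) ⟨by positivity, by linarith⟩ 0 ⟨le_rfl, one_pos⟩ hmid
    linarith
  set l := ‖p τ - p 0‖ with hl
  have hl0 : 0 < l := norm_pos_iff.2 hAB
  have hlc : (l : ℂ) ≠ 0 := by exact_mod_cast hl0.ne'
  set e := (p τ - p 0) / l with he
  have hen : ‖e‖ = 1 := by
    rw [he, norm_div, Complex.norm_real, Real.norm_of_nonneg hl0.le, ← hl, div_self hl0.ne']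
  have he0 : e ≠ 0 := norm_pos_iff.1 (by rw [hen]; exact one_pos)
  have hee : p τ - p 0 = l * e := by rw [he]; field_simp
  set y : ℝ → ℝ := fun t => l * (t * n - 1 / 2) with hy
  have hpy : ∀ t ∈ Icc 0 τ, p t - m = e * y t := by
    intro t ht
    rw [hedge t ht, hmid, hee, hy, Complex.real_smul, Complex.real_smul]
    push_cast
    ring
  have hK : IsCompact (p '' Icc τ 1) := isCompact_Icc.image hp.continuous
  have hKm : m ∉ p '' Icc τ 1 := by
    rintro ⟨t, ht, hts⟩
    obtain ⟨j, hj⟩ := hp.exists_int_of_eq (hts.trans hm)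
    have h0 : 0 < (j : ℝ) := by linarith [ht.1]
    have h1 : (j : ℝ) < 1 := by linarith [ht.2]
    have h0' : 0 < j := by exact_mod_cast h0
    have h1' : j < 1 := by exact_mod_cast h1
    omega
  obtain ⟨η₀, hη₀, hηK⟩ := Metric.isOpen_iff.1 hK.isClosed.isOpen_compl _ hKm
  replace hηK : ∀ t ∈ Icc τ 1, η₀ ≤ ‖p t - m‖ := by
    intro t ht
    by_contra! hcon
    exact hηK (mem_ball_iff_norm.2 hcon) ⟨t, ht, rfl⟩
  refine ⟨τ / 2, fun η hη => ?_⟩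
  set x := min η η₀ / 4 with hx
  have hx0 : 0 < x := by positivity
  have hxη : 4 * x ≤ η := by rw [hx]; linarith [min_le_left η η₀]
  have hxη₀ : 4 * x ≤ η₀ := by rw [hx]; linarith [min_le_right η η₀]
  set w₁ := m + e * (x * Complex.I) with hw₁
  set w₂ := m - e * (x * Complex.I) with hw₂
  have hnx : ‖e * (x * Complex.I)‖ = x := by
    rw [norm_mul, hen, norm_mul, Complex.norm_I, Complex.norm_real, Real.norm_of_nonneg hx0.le]
    ring
  have hd1 : ∀ t ∈ Icc 0 τ, p t - w₁ = e * (y t - x * Complex.I) := fun t ht => by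
    linear_combination hpy t ht
  have hd2 : ∀ t ∈ Icc 0 τ, p t - w₂ = e * (y t + x * Complex.I) := fun t ht => by
    linear_combination hpy t ht
  have hf1 : ∀ t ∈ Icc τ 1, 3 * x ≤ ‖p t - w₁‖ := fun t ht => by
    have h1 := norm_sub_norm_le (p t - m) (e * (x * Complex.I))
    have h2 : p t - m - e * (x * Complex.I) = p t - w₁ := by rw [hw₁]; ring
    rw [h2, hnx] at h1
    linarith [hηK t ht]
  have hf2 : ∀ t ∈ Icc τ 1, 3 * x ≤ ‖p t - w₂‖ := fun t ht => by
    have h1 := norm_sub_le (p t - w₂) (e * (x * Complex.I))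
    have h2 : p t - w₂ - e * (x * Complex.I) = p t - m := by rw [hw₂]; ring
    rw [h2, hnx] at h1
    linarith [hηK t ht]
  have hpart : ∀ t, t ∈ Icc (0 : ℝ) 1 → t ∈ Icc 0 τ ∨ t ∈ Icc τ 1 := fun t ht => by
    rcases le_total t τ with h | h
    · exact Or.inl ⟨ht.1, h⟩
    · exact Or.inr ⟨h, ht.2⟩
  have hyx1 : ∀ t, (y t - x * Complex.I : ℂ) ≠ 0 := fun t h => by
    have := congrArg Complex.im h
    simp at this
    exact hx0.ne' this
  have hyx2 : ∀ t, (y t + x * Complex.I : ℂ) ≠ 0 := fun t h => by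
    have := congrArg Complex.im h
    simp at this
    exact hx0.ne' this
  have hw₁p : w₁ ∉ range p := by
    rw [hp.range_eq 0, zero_add]
    rintro ⟨t, ht, htw⟩
    rcases hpart t ht with h | h
    · have := hd1 t h
      rw [htw, sub_self, zero_eq_mul] at this
      exact this.elim he0 (hyx1 t)
    · have := hf1 t h
      rw [htw, sub_self, norm_zero] at this
      linarith
  have hw₂p : w₂ ∉ range p := by
    rw [hp.range_eq 0, zero_add]
    rintro ⟨t, ht, htw⟩
    rcases hpart t ht with h | h
    · have := hd2 t h
      rw [htw, sub_self, zero_eq_mul] at this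
      exact this.elim he0 (hyx2 t)
    · have := hf2 t h
      rw [htw, sub_self, norm_zero] at this
      linarith
  have hpc := hp.continuous
  have hpp := hp.periodic
  obtain ⟨k₁, hk₁⟩ := HasWind.exists_of_continuous (f := fun t => p t - w₁) (by fun_prop)
    (fun t h => hw₁p ⟨t, sub_eq_zero.1 h⟩) (fun t => by simp only [hpp t])
  obtain ⟨k₂, hk₂⟩ := HasWind.exists_of_continuous (f := fun t => p t - w₂) (by fun_prop)
    (fun t h => hw₂p ⟨t, sub_eq_zero.1 h⟩) (fun t => by simp only [hpp t])
  refine ⟨w₁, ?_, w₂, ?_, hw₁p, hw₂p, k₂, ?_, hk₂⟩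
  · rw [mem_ball_iff_norm, hw₁, ← hm, add_sub_cancel_left, hnx]
    linarith
  · rw [mem_ball_iff_norm, hw₂, ← hm, sub_sub_cancel_left, norm_neg, hnx]
    linarith
  have hq := hk₁.mul hk₂.inv
  have hfc := hq.continuous
  obtain ⟨L, hL, hLf, hLk⟩ := hq
  set f : ℝ → ℂ := fun t => (p t - w₁) * (p t - w₂)⁻¹ with hf
  have hyc : Continuous y := by fun_prop
  obtain ⟨a, ha⟩ := exists_int_eqOn_of_exp_eq (S := Icc 0 τ) isPreconnected_Icc hL.continuousOn
    (L' := fun t => -(Real.pi * Complex.I) + 2 * Real.arctan (y t / x) * Complex.I)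
    (by
      have : Continuous fun t => Real.arctan (y t / x) :=
        Real.continuous_arctan.comp (hyc.div_const x)
      fun_prop)
    (fun t ht => by
      rw [hLf, exp_two_arctan_mul_I hx0, show f t = (p t - w₁) * (p t - w₂)⁻¹ from rfl,
        hd1 t ht, hd2 t ht, mul_inv]
      field_simp)
  have hslit : ∀ t ∈ Icc τ 1, f t ∈ Complex.slitPlane := by
    intro t ht
    have h2 : 0 < ‖p t - w₂‖ := by linarith [hf2 t ht]
    have h3 : f t = 1 + (w₂ - w₁) / (p t - w₂) := by
      have := norm_pos_iff.1 h2
      simp only [hf]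
      field_simp
      ring
    rw [h3]
    refine Complex.mem_slitPlane_of_norm_lt_one ?_
    rw [norm_div, div_lt_one h2]
    have h4 : w₂ - w₁ = -(2 * (e * (x * Complex.I))) := by rw [hw₁, hw₂]; ring
    rw [h4, norm_neg, norm_mul, hnx]
    have := hf2 t ht
    norm_num
    linarith
  obtain ⟨b, hb⟩ := exists_int_eqOn_of_exp_eq (S := Icc τ 1) isPreconnected_Icc hL.continuousOn
    (L' := fun t => Complex.log (f t)) (hfc.continuousOn.clog hslit)
    (fun t ht => by
      rw [hLf, Complex.exp_log (Complex.slitPlane_ne_zero (hslit t ht))])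
  set φ := Real.arctan (l / 2 / x) with hφ
  have hφ0 : 0 < φ := Real.arctan_pos.2 (by positivity)
  have hφ1 : φ < Real.pi / 2 := Real.arctan_lt_pi_div_two _
  have hyτ : y τ = l / 2 := by
    simp only [hy, hτ]
    field_simp
    ring
  have hy0 : y 0 = -(l / 2) := by
    simp only [hy]
    ring
  have hfτ : f τ = Complex.exp (-(Real.pi * Complex.I) + 2 * φ * Complex.I) := by
    rw [hφ, ← hyτ, exp_two_arctan_mul_I hx0]
    simp only [hf]
    rw [hd1 τ ⟨hτ0.le, le_rfl⟩, hd2 τ ⟨hτ0.le, le_rfl⟩, mul_inv]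
    field_simp
  have hf0 : f 0 = Complex.exp (Real.pi * Complex.I - 2 * φ * Complex.I) := by
    have h1 : Complex.exp (Real.pi * Complex.I - 2 * φ * Complex.I) =
        Complex.exp (-(Real.pi * Complex.I) + 2 * Real.arctan (y 0 / x) * Complex.I) := by
      rw [hy0, neg_div, Real.arctan_neg, ← hφ, Complex.exp_eq_exp_iff_exists_int]
      refine ⟨1, ?_⟩
      push_cast
      ring
    rw [h1, exp_two_arctan_mul_I hx0]
    simp only [hf]
    rw [hd1 0 ⟨le_rfl, hτ0.le⟩, hd2 0 ⟨le_rfl, hτ0.le⟩, mul_inv]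
    field_simp
  have hlogτ : Complex.log (f τ) = -(Real.pi * Complex.I) + 2 * φ * Complex.I := by
    rw [hfτ, Complex.log_exp] <;> simp <;> linarith
  have hlog0 : Complex.log (f 0) = Real.pi * Complex.I - 2 * φ * Complex.I := by
    rw [hf0, Complex.log_exp] <;> simp <;> linarith
  have hf1 : f 1 = f 0 := by
    have := hpp 0
    rw [zero_add] at this
    simp only [hf, this]
  have e1 := ha 0 ⟨le_rfl, hτ0.le⟩
  have e2 := ha τ ⟨hτ0.le, le_rfl⟩
  have e3 := hb τ ⟨le_rfl, hτ1⟩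
  have e4 := hb 1 ⟨hτ1, le_rfl⟩
  have e5 := hLk 0
  rw [zero_add, e4, e1] at e5
  rw [e2] at e3
  rw [hf1, hlog0, hy0, neg_div, Real.arctan_neg, ← hφ] at e5
  rw [hlogτ, hyτ, ← hφ] at e3
  have hfin : ((k₁ - k₂ - 1 : ℤ) : ℂ) * (2 * Real.pi * Complex.I) = 0 := by
    push_cast at e5 e3 ⊢
    linear_combination (-1 : ℂ) * e5 - e3
  rcases mul_eq_zero.1 hfin with h | h
  · have h5 : k₁ - k₂ - 1 = 0 := by exact_mod_cast h
    rw [show k₂ + 1 = k₁ by omega]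
    exact hk₁
  · exact absurd h Complex.two_pi_I_ne_zero

end PolygonParam

/-- The complement of `U` has no nonempty compact relatively open part. -/
def NoHole (U : Set ℂ) : Prop :=
  ∀ K ⊆ Uᶜ, IsCompact K → IsClosed (Uᶜ \ K) → K = ∅

theorem isPreconnected_norm_gt {R : ℝ} (hR : 0 ≤ R) : IsPreconnected {z : ℂ | R < ‖z‖} := by
  have h : {z : ℂ | R < ‖z‖} = (fun q : ℝ × ℝ => (q.1 : ℂ) * Complex.exp (q.2 * Complex.I)) ''
      (Ioi R ×ˢ univ) := by
    ext z
    constructor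
    · intro hz
      exact ⟨(‖z‖, z.arg), ⟨hz, trivial⟩, Complex.norm_mul_exp_arg_mul_I z⟩
    · rintro ⟨⟨r, θ⟩, ⟨hr, -⟩, rfl⟩
      have hr : R < r := hr
      simp only [mem_ofPred_eq, norm_mul, Complex.norm_exp_ofReal_mul_I, mul_one, Complex.norm_real]
      rwa [Real.norm_of_nonneg (hR.trans hr.le)]
  rw [h]
  exact (isPreconnected_Ioi.prod isPreconnected_univ).image _ (by fun_prop)

theorem not_isBounded_norm_gt (R : ℝ) : ¬ Bornology.IsBounded {z : ℂ | R < ‖z‖} := by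
  intro h
  obtain ⟨C, hC⟩ := h.exists_norm_le
  have := hC ((|R| + |C| + 1 : ℝ) : ℂ) (by
    simp only [mem_ofPred_eq, Complex.norm_real]
    rw [Real.norm_of_nonneg (by positivity)]
    linarith [le_abs_self R, abs_nonneg C])
  rw [Complex.norm_real, Real.norm_of_nonneg (by positivity)] at this
  linarith [le_abs_self C, abs_nonneg R]

namespace PolygonParam

variable {p : ℝ → ℂ}

theorem isOpen_compl_range (hp : PolygonParam p) : IsOpen (range p)ᶜ :=
  hp.isCompact_range.isClosed.isOpen_compl

theorem side_subset_component (hp : PolygonParam p) {z : ℂ} (hz : z ∉ range p) {s η : ℝ}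
    (hη : 0 < η) {S₁ S₂ : Set ℂ} (h1 : IsPreconnected S₁) (h2 : IsPreconnected S₂)
    (hU : ball (p s) η \ range p = S₁ ∪ S₂) :
    S₁ ⊆ connectedComponentIn (range p)ᶜ z ∨ S₂ ⊆ connectedComponentIn (range p)ᶜ z := by
  obtain ⟨w, hwb, hwC⟩ := mem_closure_iff.1 (hp.range_subset_closure_component hz ⟨s, rfl⟩) _
    isOpen_ball (mem_ball_self hη)
  have hw : w ∈ S₁ ∪ S₂ := hU ▸ ⟨hwb, connectedComponentIn_subset _ _ hwC⟩
  have hsub : ∀ S, IsPreconnected S → S ⊆ S₁ ∪ S₂ → w ∈ S →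
      S ⊆ connectedComponentIn (range p)ᶜ z := by
    intro S hS hSU hwS
    have : S ⊆ (range p)ᶜ := fun x hx => ((hU.symm ▸ hSU hx : x ∈ ball (p s) η \ range p)).2
    have h3 := hS.subset_connectedComponentIn hwS this
    rwa [← connectedComponentIn_eq hwC] at h3
  rcases hw with hw | hw
  · exact Or.inl (hsub S₁ h1 subset_union_left hw)
  · exact Or.inr (hsub S₂ h2 subset_union_right hw)

/-- The Jordan curve theorem for polygons. -/
theorem exists_jordan (hp : PolygonParam p) : ∃ (z₀ z₁ : ℂ) (σ : ℤ), (σ = 1 ∨ σ = -1) ∧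
    z₀ ∉ range p ∧ z₁ ∉ range p ∧
    HasWind (fun t => p t - z₀) σ ∧ HasWind (fun t => p t - z₁) 0 ∧
    polyInt (range p) = connectedComponentIn (range p)ᶜ z₀ ∧
    Bornology.IsBounded (polyInt (range p)) ∧
    ¬ Bornology.IsBounded (connectedComponentIn (range p)ᶜ z₁) ∧
    (range p)ᶜ = polyInt (range p) ∪ connectedComponentIn (range p)ᶜ z₁ ∧
    Disjoint (polyInt (range p)) (connectedComponentIn (range p)ᶜ z₁) := by
  obtain ⟨s₀, hs₀⟩ := hp.exists_wind_jump
  obtain ⟨η, hη, H⟩ := hp.exists_two_sides s₀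
  obtain ⟨S₁, S₂, h1, h2, -, -, hU, -, -⟩ := H η hη le_rfl
  obtain ⟨w₁, hw₁, w₂, hw₂, hw₁p, hw₂p, k, hk₁, hk₂⟩ := hs₀ η hη
  have hpc := hp.continuous
  have hpp := hp.periodic
  have hSp : S₁ ∪ S₂ ⊆ (range p)ᶜ := hU ▸ fun x hx => hx.2
  have hnot : ∀ S, IsPreconnected S → S ⊆ S₁ ∪ S₂ → w₁ ∈ S → w₂ ∉ S := by
    intro S hS hSU h h'
    have := (hk₁.eq_of_isPreconnected hpc hpp hS (hSU.trans hSp) h h').unique hk₂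
    omega
  have hcomp : ∀ z ∉ range p,
      connectedComponentIn (range p)ᶜ z = connectedComponentIn (range p)ᶜ w₁ ∨
      connectedComponentIn (range p)ᶜ z = connectedComponentIn (range p)ᶜ w₂ := by
    intro z hz
    have hm₁ : w₁ ∈ S₁ ∪ S₂ := hU ▸ ⟨hw₁, hw₁p⟩
    have hm₂ : w₂ ∈ S₁ ∪ S₂ := hU ▸ ⟨hw₂, hw₂p⟩
    rcases hp.side_subset_component hz hη h1 h2 hU with h | h
    · rcases hm₁ with h3 | h3
      · exact Or.inl (connectedComponentIn_eq (h h3))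
      · exact Or.inr (connectedComponentIn_eq (h (hm₂.resolve_right
          (hnot _ h2 subset_union_right h3))))
    · rcases hm₁ with h3 | h3
      · exact Or.inr (connectedComponentIn_eq (h (hm₂.resolve_left
          (hnot _ h1 subset_union_left h3))))
      · exact Or.inl (connectedComponentIn_eq (h h3))
  obtain ⟨R, hR0, hR⟩ : ∃ R > 0, ∀ t, ‖p t‖ < R := by
    obtain ⟨R, hR⟩ := hp.isCompact_range.isBounded.exists_norm_le
    exact ⟨R + 1, by linarith [norm_nonneg (p 0), hR (p 0) ⟨0, rfl⟩],
      fun t => by linarith [hR (p t) ⟨t, rfl⟩]⟩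
  set E := {z : ℂ | R < ‖z‖} with hE
  have hEp : E ⊆ (range p)ᶜ := by
    rintro _ hz ⟨t, rfl⟩
    exact lt_asymm (hR t) hz
  have hnorm : ‖((R + 1 : ℝ) : ℂ)‖ = R + 1 := by
    rw [Complex.norm_real, Real.norm_of_nonneg (by linarith)]
  have heE : ((R + 1 : ℝ) : ℂ) ∈ E := by
    show R < _
    rw [hnorm]
    linarith
  set z₁ : ℂ := ((R + 1 : ℝ) : ℂ) with hz₁
  have hz₁p : z₁ ∉ range p := hEp heE
  have hEC : E ⊆ connectedComponentIn (range p)ᶜ z₁ :=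
    (isPreconnected_norm_gt hR0.le).subset_connectedComponentIn heE hEp
  have hub : ¬ Bornology.IsBounded (connectedComponentIn (range p)ᶜ z₁) :=
    fun h => not_isBounded_norm_gt R (h.subset hEC)
  have hwz₁ : HasWind (fun t => p t - z₁) 0 := HasWind.zero_of_norm_lt hpc hpp fun t => by
    rw [hnorm]
    linarith [hR t]
  have hsub : ∀ z ∉ range p, connectedComponentIn (range p)ᶜ z ≠
      connectedComponentIn (range p)ᶜ z₁ → connectedComponentIn (range p)ᶜ z ⊆ closedBall 0 R := by
    intro z hz hne w hw
    rw [mem_closedBall_zero_iff]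
    by_contra! hcon
    exact hne ((connectedComponentIn_eq hw).trans (connectedComponentIn_eq (hEC hcon)).symm)
  have hInt : ∀ z, z ∈ polyInt (range p) ↔ z ∉ range p ∧ connectedComponentIn (range p)ᶜ z ≠
      connectedComponentIn (range p)ᶜ z₁ := by
    intro z
    constructor
    · rintro ⟨hz, hb⟩
      exact ⟨hz, fun h => hub (h ▸ hb)⟩
    · rintro ⟨hz, hne⟩
      exact ⟨hz, isBounded_closedBall.subset (hsub z hz hne)⟩
  have hpre : ∀ z, IsPreconnected (connectedComponentIn (range p)ᶜ z) :=
    fun z => isPreconnected_connectedComponentIn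
  have hmem : ∀ z ∉ range p, z ∈ connectedComponentIn (range p)ᶜ z :=
    fun z hz => mem_connectedComponentIn hz
  have hsubset : ∀ z, connectedComponentIn (range p)ᶜ z ⊆ (range p)ᶜ :=
    fun z => connectedComponentIn_subset _ _
  -- the component other than the unbounded one
  obtain ⟨z₀, σ, hσ, hz₀p, hwz₀, hne, hall⟩ : ∃ (z₀ : ℂ) (σ : ℤ), (σ = 1 ∨ σ = -1) ∧
      z₀ ∉ range p ∧ HasWind (fun t => p t - z₀) σ ∧
      connectedComponentIn (range p)ᶜ z₀ ≠ connectedComponentIn (range p)ᶜ z₁ ∧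
      ∀ z ∉ range p, connectedComponentIn (range p)ᶜ z = connectedComponentIn (range p)ᶜ z₀ ∨
        connectedComponentIn (range p)ᶜ z = connectedComponentIn (range p)ᶜ z₁ := by
    have h12 : connectedComponentIn (range p)ᶜ w₁ ≠ connectedComponentIn (range p)ᶜ w₂ := by
      intro h
      have := (hk₁.eq_of_isPreconnected hpc hpp (hpre w₁) (hsubset w₁) (hmem w₁ hw₁p)
        (h ▸ hmem w₂ hw₂p)).unique hk₂
      omega
    rcases hcomp z₁ hz₁p with h | h
    · have := (hk₁.eq_of_isPreconnected hpc hpp (hpre w₁) (hsubset w₁) (hmem w₁ hw₁p)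
        (h ▸ hmem z₁ hz₁p)).unique hwz₁
      refine ⟨w₂, k, by omega, hw₂p, hk₂, h ▸ h12.symm, fun z hz => h ▸ (hcomp z hz).symm⟩
    · have := (hk₂.eq_of_isPreconnected hpc hpp (hpre w₂) (hsubset w₂) (hmem w₂ hw₂p)
        (h ▸ hmem z₁ hz₁p)).unique hwz₁
      refine ⟨w₁, k + 1, by omega, hw₁p, hk₁, h ▸ h12, fun z hz => h ▸ hcomp z hz⟩
  have heq : polyInt (range p) = connectedComponentIn (range p)ᶜ z₀ := by
    ext z
    rw [hInt]
    constructor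
    · rintro ⟨hz, hz'⟩
      exact (hall z hz).resolve_right hz' ▸ hmem z hz
    · intro hz
      exact ⟨hsubset _ hz, connectedComponentIn_eq hz ▸ hne⟩
  refine ⟨z₀, z₁, σ, hσ, hz₀p, hz₁p, hwz₀, hwz₁, heq, ?_, hub, ?_, ?_⟩
  · rw [heq]
    exact isBounded_closedBall.subset (hsub z₀ hz₀p hne)
  · rw [heq]
    refine Subset.antisymm (fun z hz => ?_) (union_subset (hsubset _) (hsubset _))
    rcases hall z hz with h | h
    · exact Or.inl (h ▸ hmem z hz)
    · exact Or.inr (h ▸ hmem z hz)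
  · rw [heq, Set.disjoint_left]
    intro z hz hz'
    exact hne ((connectedComponentIn_eq hz).trans (connectedComponentIn_eq hz').symm)

theorem isOpen_polyInt (hp : PolygonParam p) : IsOpen (polyInt (range p)) := by
  obtain ⟨z₀, z₁, σ, -, -, -, -, -, h, -⟩ := hp.exists_jordan
  rw [h]
  exact hp.isOpen_compl_range.connectedComponentIn

theorem isPreconnected_polyInt (hp : PolygonParam p) : IsPreconnected (polyInt (range p)) := by
  obtain ⟨z₀, z₁, σ, -, -, -, -, -, h, -⟩ := hp.exists_jordan
  rw [h]
  exact isPreconnected_connectedComponentIn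

theorem isBounded_polyInt (hp : PolygonParam p) : Bornology.IsBounded (polyInt (range p)) := by
  obtain ⟨z₀, z₁, σ, -, -, -, -, -, -, h, -⟩ := hp.exists_jordan
  exact h

theorem range_subset_closure_polyInt (hp : PolygonParam p) :
    range p ⊆ closure (polyInt (range p)) := by
  obtain ⟨z₀, z₁, σ, -, hz₀, -, -, -, h, -⟩ := hp.exists_jordan
  rw [h]
  exact hp.range_subset_closure_component hz₀

theorem noHole_polyInt (hp : PolygonParam p) : NoHole (polyInt (range p)) := by
  obtain ⟨z₀, z₁, σ, -, -, hz₁, -, -, h, -, hub, hun, hdis⟩ := hp.exists_jordan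
  set E := connectedComponentIn (range p)ᶜ z₁
  have hcl : (polyInt (range p))ᶜ = closure E := by
    apply Subset.antisymm
    · intro z hz
      by_cases hzp : z ∈ range p
      · exact hp.range_subset_closure_component hz₁ hzp
      · have : z ∈ (range p)ᶜ := hzp
        rw [hun] at this
        exact subset_closure (this.resolve_left hz)
    · exact closure_minimal (fun z hz => disjoint_right.1 hdis hz)
        hp.isOpen_polyInt.isClosed_compl
  intro K hK hKc hKcl
  rw [hcl] at hK hKcl
  by_contra hne
  have hpre : IsPreconnected (closure E) := isPreconnected_connectedComponentIn.closure
  have hsub : closure E ⊆ K := by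
    intro z hz
    by_contra hzK
    obtain ⟨w, -, hw1, hw2⟩ := (isPreconnected_closed_iff.1 hpre) K (closure E \ K) hKc.isClosed
      hKcl (fun x hx => by by_cases hxK : x ∈ K <;> simp [hx, hxK])
      (by rw [inter_eq_right.2 hK]; exact nonempty_iff_ne_empty.2 hne) ⟨z, hz, hz, hzK⟩
    exact hw2.2 hw1
  exact hub (hKc.isBounded.subset (subset_closure.trans hsub))

theorem closure_polyInt (hp : PolygonParam p) :
    closure (polyInt (range p)) = polyInt (range p) ∪ range p := by
  obtain ⟨z₀, z₁, σ, -, -, hz₁, -, -, h, -, hub, hun, hdis⟩ := hp.exists_jordan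
  refine Subset.antisymm (fun z hz => ?_)
    (union_subset subset_closure hp.range_subset_closure_polyInt)
  by_contra hcon
  rw [mem_union, not_or] at hcon
  have : z ∈ (range p)ᶜ := hcon.2
  rw [hun] at this
  have hzE := this.resolve_left hcon.1
  obtain ⟨w, hw1, hw2⟩ := mem_closure_iff.1 hz _ hp.isOpen_compl_range.connectedComponentIn hzE
  exact disjoint_left.1 hdis hw2 hw1

theorem polyInt_subset_compl_range : polyInt (range p) ⊆ (range p)ᶜ := fun _ hz => hz.1

theorem exists_wind (hp : PolygonParam p) : ∃ σ : ℤ, (σ = 1 ∨ σ = -1) ∧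
    (∀ z ∈ polyInt (range p), HasWind (fun t => p t - z) σ) ∧
    ∀ z, z ∉ range p → z ∉ polyInt (range p) → HasWind (fun t => p t - z) 0 := by
  obtain ⟨z₀, z₁, σ, hσ, hz₀, hz₁, hw₀, hw₁, h, -, hub, hun, hdis⟩ := hp.exists_jordan
  refine ⟨σ, hσ, fun z hz => ?_, fun z hz hzi => ?_⟩
  · rw [h] at hz
    exact hw₀.eq_of_isPreconnected hp.continuous hp.periodic isPreconnected_connectedComponentIn
      (connectedComponentIn_subset _ _) (mem_connectedComponentIn hz₀) hz
  · have : z ∈ (range p)ᶜ := hz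
    rw [hun] at this
    exact hw₁.eq_of_isPreconnected hp.continuous hp.periodic isPreconnected_connectedComponentIn
      (connectedComponentIn_subset _ _) (mem_connectedComponentIn hz₁) (this.resolve_left hzi)

/-- The interior of a polygon is locally connected at its boundary. -/
theorem isPreconnected_ball_inter_polyInt (hp : PolygonParam p) (s : ℝ) :
    ∃ η₀ > 0, ∀ η, 0 < η → η ≤ η₀ → IsPreconnected (ball (p s) η ∩ polyInt (range p)) := by
  obtain ⟨z₀, z₁, σ, -, hz₀, hz₁, -, -, h, -, hub, hun, hdis⟩ := hp.exists_jordan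
  obtain ⟨η₀, hη₀, H⟩ := hp.exists_two_sides s
  refine ⟨η₀, hη₀, fun η hη hηη => ?_⟩
  obtain ⟨S₁, S₂, h1, h2, hn1, hn2, hU, -, -⟩ := H η hη hηη
  have hfin : ∀ A B : Set ℂ, ball (p s) η \ range p = A ∪ B → A ⊆ polyInt (range p) →
      B ⊆ connectedComponentIn (range p)ᶜ z₁ → ball (p s) η ∩ polyInt (range p) = A := by
    intro A B hAB hA hB
    have hAball : A ⊆ ball (p s) η := fun x hx =>
      (hAB.symm ▸ Or.inl hx : x ∈ ball (p s) η \ range p).1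
    refine Subset.antisymm (fun x hx => ?_) (fun x hx => ⟨hAball hx, hA hx⟩)
    have : x ∈ A ∪ B := hAB ▸ ⟨hx.1, hx.2.1⟩
    exact this.resolve_right fun hxB => disjoint_left.1 hdis hx.2 (hB hxB)
  rcases hp.side_subset_component hz₀ hη h1 h2 hU with ha | ha <;>
  rcases hp.side_subset_component hz₁ hη h1 h2 hU with hb | hb <;> rw [← h] at ha
  · obtain ⟨x, hx⟩ := hn1
    exact absurd (hb hx) (disjoint_left.1 hdis (ha hx))
  · rw [hfin S₁ S₂ hU ha hb]
    exact h1
  · rw [hfin S₂ S₁ (by rw [hU, union_comm]) ha hb]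
    exact h2
  · obtain ⟨x, hx⟩ := hn2
    exact absurd (hb hx) (disjoint_left.1 hdis (ha hx))

end PolygonParam

theorem continuous_floor_fract {α : Type*} [TopologicalSpace α] {ψ : ℤ → ℝ → α}
    (hψ : ∀ n, Continuous (ψ n)) (hglue : ∀ n, ψ n 1 = ψ (n + 1) 0) :
    Continuous fun t : ℝ => ψ ⌊t⌋ (Int.fract t) := by
  rw [continuous_iff_continuousAt]
  intro t
  rw [continuousAt_iff_continuous_left_right]
  constructor
  · set m := ⌈t⌉ - 1
    have hm : (m : ℝ) < t := by
      have := Int.ceil_lt_add_one t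
      push_cast [m]
      linarith
    have hm' : t ≤ m + 1 := by
      have := Int.le_ceil t
      push_cast [m]
      linarith
    have key : ∀ s ∈ Ioc (m : ℝ) (m + 1), ψ ⌊s⌋ (Int.fract s) = ψ m (s - m) := by
      intro s hs
      rcases hs.2.lt_or_eq with h | h
      · have : ⌊s⌋ = m := Int.floor_eq_iff.2 ⟨hs.1.le, h⟩
        rw [Int.fract, this]
      · have : ⌊s⌋ = m + 1 := Int.floor_eq_iff.2 ⟨by push_cast; exact h.ge, by push_cast; linarith⟩
        rw [Int.fract, this, h]
        push_cast
        rw [sub_self, add_sub_cancel_left, hglue]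
    have hc : ContinuousWithinAt (fun s : ℝ => ψ m (s - m)) (Iic t) t :=
      ((hψ m).comp (continuous_id.sub continuous_const)).continuousWithinAt
    refine hc.congr_of_eventuallyEq ?_ (key t ⟨hm, hm'⟩)
    filter_upwards [Ioc_mem_nhdsLE hm] with s hs
    exact key s ⟨hs.1, hs.2.trans hm'⟩
  · set m := ⌊t⌋
    have key : ∀ s ∈ Ico (m : ℝ) (m + 1), ψ ⌊s⌋ (Int.fract s) = ψ m (s - m) := by
      intro s hs
      have : ⌊s⌋ = m := Int.floor_eq_iff.2 hs
      rw [Int.fract, this]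
    have hc : ContinuousWithinAt (fun s : ℝ => ψ m (s - m)) (Ici t) t :=
      ((hψ m).comp (continuous_id.sub continuous_const)).continuousWithinAt
    refine hc.congr_of_eventuallyEq ?_ (key t ⟨Int.floor_le t, Int.lt_floor_add_one t⟩)
    filter_upwards [Ico_mem_nhdsGE (Int.lt_floor_add_one t)] with s hs
    exact key s ⟨(Int.floor_le t).trans hs.1, hs.2⟩

theorem uniformContinuous_of_periodic {α : Type*} [UniformSpace α] {f : ℝ → α} (hf : Continuous f)
    (hp : Periodic f 1) : UniformContinuous f := by
  have : Fact ((0 : ℝ) < 1) := ⟨one_pos⟩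
  have hl : Continuous (hp.lift : AddCircle (1 : ℝ) → α) := continuous_quot_lift _ hf
  have hc : UniformContinuous ((↑) : ℝ → AddCircle (1 : ℝ)) :=
    uniformContinuous_of_continuousAt_zero (QuotientAddGroup.mk' _)
      (AddCircle.continuous_mk' 1).continuousAt
  exact (CompactSpace.uniformContinuous_of_continuous hl).comp hc

/-- A polygon is uniformly approximated by loops in its interior. -/
theorem PolygonParam.exists_inner_loop {p : ℝ → ℂ} (hp : PolygonParam p) {τ : ℝ} (hτ : 0 < τ) :
    ∃ q : ℝ → ℂ, Continuous q ∧ Periodic q 1 ∧ (∀ t, q t ∈ polyInt (range p)) ∧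
      ∀ t, ‖q t - p t‖ < τ := by
  choose η₀ hη₀ hpre using hp.isPreconnected_ball_inter_polyInt
  set η : ℝ → ℝ := fun s => min (η₀ s) (τ / 4)
  have hη : ∀ s, 0 < η s := fun s => lt_min (hη₀ s) (by positivity)
  obtain ⟨δ, hδ, hleb⟩ := lebesgue_number_lemma_of_metric (c := fun s => ball (p s) (η s))
    hp.isCompact_range (fun s => isOpen_ball)
    (by rintro _ ⟨s, rfl⟩; exact mem_iUnion.2 ⟨s, mem_ball_self (hη s)⟩)
  have hy : ∀ x : ℂ, ∃ y, x ∈ range p → y ∈ polyInt (range p) ∧ dist y x < δ / 2 := by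
    intro x
    by_cases hx : x ∈ range p
    · obtain ⟨y, hy, hyx⟩ := Metric.mem_closure_iff.1 (hp.range_subset_closure_polyInt hx) (δ / 2)
        (half_pos hδ)
      exact ⟨y, fun _ => ⟨hy, by rwa [dist_comm]⟩⟩
    · exact ⟨0, fun h => absurd h hx⟩
  choose y hy using hy
  have hF : ∀ x x' : ℂ, ∃ φ : ℝ → ℂ, x ∈ range p → x' ∈ range p → dist x' x < δ / 2 →
      Continuous φ ∧ φ 0 = y x ∧ φ 1 = y x' ∧
        ∀ t, φ t ∈ polyInt (range p) ∧ dist (φ t) x < τ / 2 := by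
    intro x x'
    by_cases hx : x ∈ range p ∧ x' ∈ range p ∧ dist x' x < δ / 2
    swap
    · exact ⟨0, fun h1 h2 h3 => absurd ⟨h1, h2, h3⟩ hx⟩
    obtain ⟨hx, hx', hd⟩ := hx
    obtain ⟨s, hs⟩ := hleb x hx
    have hyx : y x ∈ ball (p s) (η s) ∩ polyInt (range p) :=
      ⟨hs ((hy x hx).2.trans (by linarith)), (hy x hx).1⟩
    have hyx' : y x' ∈ ball (p s) (η s) ∩ polyInt (range p) :=
      ⟨hs ((dist_triangle _ x' _).trans_lt (by linarith [(hy x' hx').2])), (hy x' hx').1⟩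
    have hpc : IsPathConnected (ball (p s) (η s) ∩ polyInt (range p)) :=
      ((isOpen_ball.inter hp.isOpen_polyInt).isConnected_iff_isPathConnected).1
        ⟨⟨_, hyx⟩, hpre s _ (hη s) (min_le_left _ _)⟩
    have hj := hpc.joinedIn _ hyx _ hyx'
    refine ⟨hj.somePath.extend, fun _ _ _ => ⟨hj.somePath.continuous_extend, ?_, ?_, fun t => ?_⟩⟩
    · simp
    · simp
    · have hmem : hj.somePath.extend t ∈ ball (p s) (η s) ∩ polyInt (range p) :=
        hj.somePath_mem _
      refine ⟨hmem.2, (dist_triangle _ (p s) _).trans_lt ?_⟩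
      have h1 : dist (hj.somePath.extend t) (p s) < τ / 4 :=
        (mem_ball.1 hmem.1).trans_le (min_le_right _ _)
      have h2 : dist x (p s) < τ / 4 :=
        (mem_ball.1 (hs (mem_ball_self hδ))).trans_le (min_le_right _ _)
      rw [dist_comm x] at h2
      linarith
  choose F hF using hF
  obtain ⟨δ', hδ', huc⟩ := Metric.uniformContinuous_iff.1
    (uniformContinuous_of_periodic hp.continuous hp.periodic)
    (min (δ / 2) (τ / 2)) (lt_min (half_pos hδ) (half_pos hτ))
  obtain ⟨N, hN⟩ := exists_nat_gt (1 / δ')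
  have hN0 : (0 : ℝ) < N := lt_trans (by positivity) hN
  have hNδ : 1 / (N : ℝ) < δ' := by
    rw [div_lt_iff₀ hN0]
    rw [div_lt_iff₀ hδ'] at hN
    linarith
  set ψ : ℤ → ℝ → ℂ := fun n => F (p (n / N)) (p ((n + 1) / N))
  have hd : ∀ n : ℤ, dist (p ((n + 1) / N)) (p (n / N)) < δ / 2 := fun n => by
    refine (huc (b := (n : ℝ) / N) ?_).trans_le (min_le_left _ _)
    rw [Real.dist_eq, ← sub_div, add_sub_cancel_left, abs_of_pos (by positivity)]
    exact hNδ
  have hψ : ∀ n, Continuous (ψ n) ∧ ψ n 0 = y (p (n / N)) ∧ ψ n 1 = y (p ((n + 1) / N)) ∧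
      ∀ t, ψ n t ∈ polyInt (range p) ∧ dist (ψ n t) (p (n / N)) < τ / 2 := fun n =>
    hF _ _ ⟨_, rfl⟩ ⟨_, rfl⟩ (hd n)
  have hper : ∀ n : ℤ, ψ (n + N) = ψ n := fun n => by
    simp only [ψ]
    have h1 : (((n + N : ℤ) : ℝ)) / N = n / N + 1 := by push_cast; field_simp
    have h2 : ((((n + N : ℤ) : ℝ)) + 1) / N = (n + 1) / N + 1 := by push_cast; field_simp; ring
    rw [h1, h2, hp.periodic, hp.periodic]
  have hcont := continuous_floor_fract (fun n => (hψ n).1) (fun n => by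
    rw [(hψ n).2.2.1, (hψ (n + 1)).2.1]
    push_cast
    rfl)
  refine ⟨fun t => ψ ⌊t * N⌋ (Int.fract (t * N)), hcont.comp (continuous_mul_const _), fun t => ?_,
    fun t => ((hψ _).2.2.2 _).1, fun t => ?_⟩
  · have : (t + 1) * (N : ℝ) = t * N + (N : ℤ) := by push_cast; ring
    dsimp only
    rw [this, Int.floor_add_intCast, Int.fract_add_intCast, hper]
  · rw [← dist_eq_norm]
    have h1 := ((hψ ⌊t * N⌋).2.2.2 (Int.fract (t * N))).2
    have h2 : dist (p (⌊t * N⌋ / N)) (p t) < τ / 2 := by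
      refine (huc ?_).trans_le (min_le_right _ _)
      have : (⌊t * N⌋ : ℝ) / N - t = -(Int.fract (t * N) / N) := by
        rw [Int.fract]
        field_simp
        ring
      rw [Real.dist_eq, this, abs_neg, abs_of_nonneg (by positivity)]
      refine lt_of_le_of_lt ?_ hNδ
      gcongr
      exact (Int.fract_lt_one _).le
    linarith [dist_triangle (ψ ⌊t * N⌋ (Int.fract (t * N))) (p (⌊t * N⌋ / N)) (p t)]

/-- The Cauchy–Riemann operator. -/
def dbar (φ : ℂ → ℂ) (w : ℂ) : ℂ := (fderiv ℝ φ w 1 + Complex.I * fderiv ℝ φ w Complex.I) / 2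

theorem dbar_eq (φ : ℂ → ℂ) (w e : ℂ) :
    (starRingEnd ℂ e) * dbar φ w =
      (fderiv ℝ φ w e + Complex.I * fderiv ℝ φ w (Complex.I * e)) / 2 := by
  have h1 : fderiv ℝ φ w e = e.re * fderiv ℝ φ w 1 + e.im * fderiv ℝ φ w Complex.I := by
    conv_lhs => rw [show e = e.re • (1 : ℂ) + e.im • Complex.I by
      simp [Complex.re_add_im]]
    rw [map_add, map_smul, map_smul, Complex.real_smul, Complex.real_smul]
  have h2 : fderiv ℝ φ w (Complex.I * e) =
      e.re * fderiv ℝ φ w Complex.I - e.im * fderiv ℝ φ w 1 := by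
    conv_lhs => rw [show Complex.I * e = e.re • Complex.I - e.im • (1 : ℂ) by
      apply Complex.ext <;> simp]
    rw [map_sub, map_smul, map_smul, Complex.real_smul, Complex.real_smul]
  have h3 : (starRingEnd ℂ e) = e.re - e.im * Complex.I := by
    apply Complex.ext <;> simp
  rw [dbar, h1, h2, h3]
  linear_combination (e.im * fderiv ℝ φ w Complex.I / 2 * -1) * Complex.I_sq

open MeasureTheory in
/-- The Pompeiu formula. -/
theorem integral_dbar_div {φ : ℂ → ℂ} (hφ : ContDiff ℝ 1 φ) (hs : HasCompactSupport φ) (z : ℂ) :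
    ∫ w, dbar φ w / (w - z) = -Real.pi * φ z := by
  obtain ⟨R, hR0, hR⟩ : ∃ R, 0 < R ∧ ∀ w, R < ‖w‖ → fderiv ℝ φ (w + z) = 0 := by
    obtain ⟨R, hR⟩ := (hs.fderiv (𝕜 := ℝ)).isBounded.subset_closedBall z
    refine ⟨max R 1, by positivity, fun w hw => ?_⟩
    by_contra h
    have := hR (subset_tsupport _ (mem_support.2 h))
    rw [mem_closedBall, dist_eq_norm, add_sub_cancel_right] at this
    exact absurd hw (not_lt.2 (this.trans (le_max_left _ _)))
  have hfc : Continuous (fderiv ℝ φ) := hφ.continuous_fderiv one_ne_zero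
  set e : ℝ → ℂ := fun θ => Complex.exp (θ * Complex.I)
  have hec : Continuous e := by fun_prop
  have henorm : ∀ θ, ‖e θ‖ = 1 := fun θ => Complex.norm_exp_ofReal_mul_I θ
  set g₁ : ℝ × ℝ → ℂ := fun q => fderiv ℝ φ (q.1 * e q.2 + z) (e q.2)
  set g₂ : ℝ × ℝ → ℂ := fun q => fderiv ℝ φ (q.1 * e q.2 + z) (Complex.I * e q.2)
  have hg₁c : Continuous g₁ := by
    refine (hfc.comp ?_).clm_apply ?_ <;> fun_prop
  have hg₂c : Continuous g₂ := by
    refine (hfc.comp ?_).clm_apply ?_ <;> fun_prop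
  have hInt : ∀ g : ℝ × ℝ → ℂ, Continuous g → (∀ q, R < q.1 → g q = 0) →
      IntegrableOn g (Ioi 0 ×ˢ Ioo (-Real.pi) Real.pi) := by
    intro g hg hg0
    have h1 : IntegrableOn g (Icc 0 R ×ˢ Icc (-Real.pi) Real.pi) :=
      hg.continuousOn.integrableOn_compact (isCompact_Icc.prod isCompact_Icc)
    refine h1.of_forall_sdiff_eq_zero (measurableSet_Ioi.prod measurableSet_Ioo) ?_
    rintro ⟨r, θ⟩ ⟨⟨h2, h3⟩, h4⟩
    apply hg0
    by_contra h5
    exact h4 ⟨⟨le_of_lt h2, not_lt.1 h5⟩, Ioo_subset_Icc_self h3⟩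
  have hz0 : ∀ q : ℝ × ℝ, R < q.1 → fderiv ℝ φ (q.1 * e q.2 + z) = 0 := fun q hq => by
    apply hR
    rw [norm_mul, henorm, mul_one, Complex.norm_real]
    exact hq.trans_le (le_abs_self _)
  have hi₁ := hInt g₁ hg₁c fun q hq => by simp [g₁, hz0 q hq]
  have hi₂ := hInt g₂ hg₂c fun q hq => by simp [g₂, hz0 q hq]
  have hd : Differentiable ℝ φ := hφ.differentiable one_ne_zero
  have hI₁ : ∫ q in Ioi (0 : ℝ) ×ˢ Ioo (-Real.pi) Real.pi, g₁ q = -(2 * Real.pi) * φ z := by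
    have hsw := setIntegral_prod_swap (μ := volume) (ν := volume) (Ioi (0 : ℝ))
      (Ioo (-Real.pi) Real.pi) g₁
    rw [Measure.volume_eq_prod, ← hsw, setIntegral_prod]
    · have : ∀ θ : ℝ, ∫ r in Ioi (0 : ℝ), g₁ (r, θ) = -φ z := by
        intro θ
        have hc : ContDiff ℝ 1 fun r : ℝ => φ (r * e θ + z) :=
          hφ.comp ((Complex.ofRealCLM.contDiff.mul contDiff_const).add contDiff_const)
        have hcs : HasCompactSupport fun r : ℝ => φ (r * e θ + z) := by
          refine hs.comp_isClosedEmbedding (g := fun r : ℝ => (r * e θ + z : ℂ)) ?_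
          refine Isometry.isClosedEmbedding (Isometry.of_dist_eq fun r s => ?_)
          rw [dist_add_right, dist_eq_norm, ← sub_mul, norm_mul, henorm, mul_one,
            ← Complex.ofReal_sub, Complex.norm_real, Real.dist_eq, Real.norm_eq_abs]
        have := hcs.integral_Ioi_deriv_eq hc 0
        simp only [Complex.ofReal_zero, zero_mul, zero_add] at this
        rw [← this]
        congr 1
        ext r
        have h1 : HasDerivAt (fun r : ℝ => (r * e θ + z : ℂ)) (e θ) r := by
          simpa using ((Complex.ofRealCLM.hasDerivAt (x := r)).mul_const (e θ)).add_const z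
        exact (((hd _).hasFDerivAt.comp_hasDerivAt r h1).deriv).symm
      simp only [Prod.swap_prod_mk, this]
      rw [setIntegral_const]
      rw [Real.volume_real_Ioo_of_le (neg_le_self Real.pi_pos.le), Complex.real_smul]
      push_cast
      ring
    · exact hi₁.swap
  have hI₂ : ∫ q in Ioi (0 : ℝ) ×ˢ Ioo (-Real.pi) Real.pi, g₂ q = 0 := by
    rw [Measure.volume_eq_prod, setIntegral_prod _ hi₂]
    refine setIntegral_eq_zero_of_forall_eq_zero fun r hr => ?_
    have hr : (0 : ℝ) < r := hr
    rw [← integral_Ioc_eq_integral_Ioo,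
      ← intervalIntegral.integral_of_le (neg_le_self Real.pi_pos.le)]
    have h1 : ∀ θ : ℝ, HasDerivAt (fun θ : ℝ => φ (r * e θ + z) / r) (g₂ (r, θ)) θ := by
      intro θ
      have h2 : HasDerivAt (fun θ : ℝ => (r * e θ + z : ℂ)) (r * (Complex.I * e θ)) θ := by
        have : HasDerivAt e (e θ * Complex.I) θ := by
          have := ((Complex.ofRealCLM.hasDerivAt (x := θ)).mul_const Complex.I).cexp
          simpa [e] using this
        rw [mul_comm Complex.I]
        exact (this.const_mul _).add_const _
      have h3 := ((hd _).hasFDerivAt.comp_hasDerivAt θ h2).div_const (r : ℂ)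
      refine h3.congr_deriv ?_
      have : (r : ℂ) * (Complex.I * e θ) = r • (Complex.I * e θ) := by simp
      change fderiv ℝ φ (r * e θ + z) _ / r = fderiv ℝ φ (r * e θ + z) (Complex.I * e θ)
      rw [this, map_smul, Complex.real_smul, mul_div_cancel_left₀]
      exact_mod_cast hr.ne'
    rw [intervalIntegral.integral_eq_sub_of_hasDerivAt (fun θ _ => h1 θ)
      ((hg₂c.comp (by fun_prop : Continuous fun θ : ℝ => (r, θ))).intervalIntegrable _ _)]
    have : e (-Real.pi) = e Real.pi := by
      simp [e, Complex.exp_neg]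
    simp [this]
  have htrans : ∫ w, dbar φ w / (w - z) = ∫ w, dbar φ (w + z) / w := by
    rw [← integral_add_right_eq_self _ z]
    simp
  rw [htrans, ← Complex.integral_comp_polarCoord_symm, polarCoord_target]
  have hcong : ∀ q ∈ Ioi (0 : ℝ) ×ˢ Ioo (-Real.pi) Real.pi,
      q.1 • (dbar φ (Complex.polarCoord.symm q + z) / Complex.polarCoord.symm q) =
        (1 / 2) * (g₁ q + Complex.I * g₂ q) := by
    rintro ⟨r, θ⟩ ⟨hr, -⟩
    have hr : (0 : ℝ) < r := hr
    have hr' : (r : ℂ) ≠ 0 := by exact_mod_cast hr.ne'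
    have he : (Real.cos θ + Real.sin θ * Complex.I : ℂ) = e θ := by
      simp [e, Complex.exp_mul_I]
    rw [Complex.polarCoord_symm_apply]
    dsimp only
    rw [he]
    have h1 : (e θ) * starRingEnd ℂ (e θ) = 1 := by
      rw [Complex.mul_conj, Complex.normSq_eq_norm_sq, henorm]
      simp
    have h0 : e θ ≠ 0 := Complex.exp_ne_zero _
    have h2 := dbar_eq φ (r * e θ + z) (e θ)
    have h3 : starRingEnd ℂ (e θ) = (e θ)⁻¹ := eq_inv_of_mul_eq_one_right h1
    rw [h3] at h2
    simp only [g₁, g₂]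
    rw [Complex.real_smul, show (r : ℂ) * (dbar φ (r * e θ + z) / (r * e θ)) =
      (e θ)⁻¹ * dbar φ (r * e θ + z) by field_simp, h2]
    ring
  rw [setIntegral_congr_fun (measurableSet_Ioi.prod measurableSet_Ioo) hcong,
    integral_const_mul, integral_add hi₁ (hi₂.const_mul _), integral_const_mul, hI₁, hI₂]
  ring

/-- A compact subset of an open set without holes is contained in one with connected complement. -/
theorem NoHole.exists_hull {U K : Set ℂ} (hU : IsOpen U) (hN : NoHole U)
    (hK : IsCompact K) (hKU : K ⊆ U) : ∃ L, IsCompact L ∧ K ⊆ L ∧ L ⊆ U ∧ IsPreconnected Lᶜ := by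
  obtain ⟨R, hR0, hR⟩ : ∃ R, 0 ≤ R ∧ K ⊆ closedBall 0 R := by
    obtain ⟨R, hR⟩ := hK.isBounded.subset_closedBall 0
    exact ⟨max R 0, le_max_right _ _, hR.trans (closedBall_subset_closedBall (le_max_left _ _))⟩
  have hsub : {z : ℂ | R < ‖z‖} ⊆ Kᶜ := fun z hz hzK => by
    have := hR hzK
    rw [mem_closedBall_zero_iff] at this
    exact absurd (show R < ‖z‖ from hz) (not_lt.2 this)
  set z₁ : ℂ := ((R + 1 : ℝ) : ℂ)
  have hz₁ : R < ‖z₁‖ := by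
    rw [Complex.norm_real, Real.norm_eq_abs, abs_of_nonneg (by linarith)]
    linarith
  set V := connectedComponentIn Kᶜ z₁
  have hVsub : {z : ℂ | R < ‖z‖} ⊆ V :=
    (isPreconnected_norm_gt hR0).subset_connectedComponentIn hz₁ hsub
  have hVo : IsOpen V := hK.isClosed.isOpen_compl.connectedComponentIn
  refine ⟨Vᶜ, ?_, ?_, ?_, by rw [compl_compl]; exact isPreconnected_connectedComponentIn⟩
  · refine (isCompact_closedBall (0 : ℂ) R).of_isClosed_subset hVo.isClosed_compl fun z hz => ?_
    rw [mem_closedBall_zero_iff]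
    by_contra h
    exact hz (hVsub (not_le.1 h))
  · exact fun z hz hzV => connectedComponentIn_subset _ _ hzV hz
  · intro z hz
    by_contra hzU
    have hzK : z ∈ Kᶜ := fun h => hzU (hKU h)
    set C := connectedComponentIn Kᶜ z
    have hCo : IsOpen C := hK.isClosed.isOpen_compl.connectedComponentIn
    have hCV : Disjoint C V := by
      rw [disjoint_left]
      intro w hw hw'
      have h1 := connectedComponentIn_eq hw
      have h2 := connectedComponentIn_eq hw'
      have h3 : C = V := h1.trans h2.symm
      exact hz (h3 ▸ (mem_connectedComponentIn hzK : z ∈ C))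
    have hCcl : closure C ⊆ C ∪ K := by
      intro w hw
      by_contra h
      have hwK : w ∈ Kᶜ := fun h' => h (Or.inr h')
      obtain ⟨y, hy1, hy2⟩ := mem_closure_iff.1 hw _
        hK.isClosed.isOpen_compl.connectedComponentIn (mem_connectedComponentIn hwK)
      have h1 := connectedComponentIn_eq hy1
      have h2 := connectedComponentIn_eq hy2
      have h3 : connectedComponentIn Kᶜ w = C := h1.trans h2.symm
      exact h (Or.inl (h3 ▸ mem_connectedComponentIn hwK))
    have hCU : C ∩ Uᶜ = closure C ∩ Uᶜ := by
      refine Subset.antisymm (inter_subset_inter_left _ subset_closure) fun w hw => ⟨?_, hw.2⟩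
      exact (hCcl hw.1).resolve_right fun h => hw.2 (hKU h)
    have hCb : Bornology.IsBounded C := by
      refine isBounded_closedBall.subset (fun w hw => ?_ : C ⊆ closedBall 0 R)
      rw [mem_closedBall_zero_iff]
      by_contra h
      exact disjoint_left.1 hCV hw (hVsub (not_le.1 h))
    have hempty := hN (C ∩ Uᶜ) inter_subset_right ?_ ?_
    · have : z ∈ C ∩ Uᶜ := ⟨mem_connectedComponentIn hzK, hzU⟩
      rw [hempty] at this
      exact this
    · rw [hCU]
      exact hCb.isCompact_closure.inter_right hU.isClosed_compl
    · have : Uᶜ \ (C ∩ Uᶜ) = Uᶜ ∩ Cᶜ := by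
        ext w
        simp only [mem_sdiff, mem_inter_iff, mem_compl_iff]
        tauto
      rw [this]
      exact hU.isClosed_compl.inter hCo.isClosed_compl

open MeasureTheory Topology in
/-- Cauchy representation of a holomorphic function near a compact set by an area integral. -/
theorem exists_area_kernel {U K : Set ℂ} (hU : IsOpen U) (hK : IsCompact K) (hKU : K ⊆ U)
    {h : ℂ → ℂ} (hh : DifferentiableOn ℂ h U) :
    ∃ G : ℂ → ℂ, Continuous G ∧ HasCompactSupport G ∧ (∀ z ∈ K, ∀ᶠ w in 𝓝 z, G w = 0) ∧
      ∀ z ∈ K, ∫ w, G w * (w - z)⁻¹ = h z := by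
  obtain ⟨L, hL, hKL, hLU⟩ := exists_compact_between hK hU hKU
  obtain ⟨χ, hχ0, hχ1, -⟩ := exists_contMDiffMap_zero_one_nhds_of_isClosed (n := 1)
    (modelWithCornersSelf ℝ ℂ) (isOpen_interior (s := L)).isClosed_compl hK.isClosed
    (disjoint_left.2 fun z hz hzK => hz (hKL hzK))
  have hχ : ContDiff ℝ 1 χ := χ.contMDiff.contDiff
  have hz0 : ∀ z, z ∉ interior L → ∀ᶠ w in 𝓝 z, χ w = 0 := fun z hz =>
    Filter.eventually_iff.2 (mem_nhdsSet_iff_forall.1 hχ0 z hz)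
  have hz1 : ∀ z ∈ K, ∀ᶠ w in 𝓝 z, χ w = 1 := fun z hz =>
    Filter.eventually_iff.2 (mem_nhdsSet_iff_forall.1 hχ1 z hz)
  set φ : ℂ → ℂ := fun z => χ z * h z
  have hφ : ContDiff ℝ 1 φ := by
    rw [contDiff_iff_contDiffAt]
    intro z
    by_cases hz : z ∈ interior L
    · refine (Complex.ofRealCLM.contDiff.comp hχ).contDiffAt.mul ?_
      have : AnalyticAt ℂ h z := hh.analyticAt (hU.mem_nhds (hLU (interior_subset hz)))
      exact this.restrictScalars.contDiffAt
    · refine contDiffAt_const (c := (0 : ℂ)) |>.congr_of_eventuallyEq ?_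
      filter_upwards [hz0 z hz] with w hw
      simp [φ, hw]
  have hs : HasCompactSupport φ := HasCompactSupport.intro hL fun z hz => by
    have := (hz0 z fun h => hz (interior_subset h)).self_of_nhds
    simp [φ, this]
  have hdc : Continuous (dbar φ) := by
    have := hφ.continuous_fderiv one_ne_zero
    unfold dbar
    fun_prop
  have hdz : ∀ z ∈ K, ∀ᶠ w in 𝓝 z, dbar φ w = 0 := by
    intro z hz
    filter_upwards [(hz1 z hz).eventually_nhds, hU.mem_nhds (hKU hz)] with w hw hwU
    have h1 : φ =ᶠ[𝓝 w] h := by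
      filter_upwards [hw] with y hy
      simp [φ, hy]
    have h2 := (hh.differentiableAt (hU.mem_nhds hwU))
    rw [dbar, h1.fderiv_eq, h2.fderiv_restrictScalars ℝ]
    have : fderiv ℂ h w Complex.I = Complex.I * fderiv ℂ h w 1 := by
      conv_lhs => rw [show Complex.I = Complex.I • (1 : ℂ) by simp, map_smul, smul_eq_mul]
    simp only [ContinuousLinearMap.coe_restrictScalars']
    rw [this, ← mul_assoc, Complex.I_mul_I]
    ring
  refine ⟨fun w => -(1 / Real.pi : ℂ) * dbar φ w, continuous_const.mul hdc, ?_, fun z hz => ?_,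
    fun z hz => ?_⟩
  · refine HasCompactSupport.mul_left (f := fun _ => -(1 / Real.pi : ℂ)) ?_
    refine (hs.fderiv (𝕜 := ℝ)).comp_left
      (g := fun A : ℂ →L[ℝ] ℂ => (A 1 + Complex.I * A Complex.I) / 2) ?_
    simp
  · filter_upwards [hdz z hz] with w hw
    simp [hw]
  · have h1 := integral_dbar_div hφ hs z
    have h2 : φ z = h z := by simp [φ, (hz1 z hz).self_of_nhds]
    simp_rw [mul_assoc, ← div_eq_mul_inv]
    rw [integral_const_mul, h1, h2]
    have : (Real.pi : ℂ) ≠ 0 := by exact_mod_cast Real.pi_ne_zero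
    field_simp

open MeasureTheory Topology in
/-- Runge's theorem. -/
theorem NoHole.exists_polynomial_near {U K : Set ℂ} (hU : IsOpen U) (hN : NoHole U)
    (hK : IsCompact K) (hKU : K ⊆ U) {h : ℂ → ℂ} (hh : DifferentiableOn ℂ h U) {ε : ℝ}
    (hε : 0 < ε) : ∃ P : Polynomial ℂ, ∀ z ∈ K, ‖P.eval z - h z‖ < ε := by
  obtain ⟨L, hL, hKL, hLU, hLc⟩ := hN.exists_hull hU hK hKU
  obtain ⟨G, hGc, hGs, hG0, hGi⟩ := exists_area_kernel hU hL hLU hh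
  have : CompactSpace L := isCompact_iff_compactSpace.1 hL
  set A : Subalgebra ℂ C(L, ℂ) := (polynomialFunctions L).topologicalClosure
  have hA : IsClosed (A : Set C(L, ℂ)) := Subalgebra.isClosed_topologicalClosure _
  set x : C(L, ℂ) := Polynomial.toContinuousMapOnAlgHom L Polynomial.X
  have hx : x ∈ A := Subalgebra.le_topologicalClosure _ (by
    rw [polynomialFunctions.eq_adjoin_X]
    exact Algebra.subset_adjoin rfl)
  have hspec : spectrum ℂ x = L := by
    rw [ContinuousMap.spectrum_eq_range]
    ext z
    simp [x]
  have hres : ∀ w ∉ L, ∃ y ∈ A, ∀ z : L, y z = (w - z)⁻¹ := by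
    intro w hw
    have hwA : w ∉ spectrum ℂ (⟨x, hx⟩ : A) := by
      intro hmem
      have hb := Subalgebra.spectrum_isBounded_connectedComponentIn A ⟨x, hx⟩ hmem
      simp only [hspec] at hb
      rw [hLc.connectedComponentIn hw] at hb
      have := hb.union hL.isBounded
      rw [compl_union_self] at this
      exact NormedSpace.unbounded_univ ℂ ℂ this
    rw [spectrum.notMem_iff] at hwA
    obtain ⟨y, hy⟩ := hwA
    refine ⟨(↑y⁻¹ : A), (↑y⁻¹ : A).2, fun z => ?_⟩
    have h1 : ((y : A) : C(L, ℂ)) * ((↑y⁻¹ : A) : C(L, ℂ)) = 1 := by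
      exact congrArg Subtype.val y.mul_inv
    have h2 := congrArg (fun f : C(L, ℂ) => f z) h1
    rw [hy] at h2
    refine eq_inv_of_mul_eq_one_right ?_
    simpa [x] using h2
  set k : C(ℂ × L, ℂ) := ⟨fun q => G q.1 * (q.1 - q.2)⁻¹, by
    rw [continuous_iff_continuousAt]
    rintro ⟨w, z⟩
    by_cases hwz : w = z
    · have h0 := hG0 z z.2
      rw [← hwz] at h0
      refine (continuousAt_const (y := (0 : ℂ))).congr ?_
      filter_upwards [continuousAt_fst.eventually h0] with q hq
      rw [hq, zero_mul]
    · refine (hGc.comp continuous_fst).continuousAt.mul (ContinuousAt.inv₀ ?_ (sub_ne_zero.2 hwz))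
      fun_prop⟩
  set F : ℂ → C(L, ℂ) := fun w => k.curry w
  have hFc : Continuous F := k.curry.continuous
  have hFs : HasCompactSupport F := hGs.mono fun w hw hG => hw (by
    ext z
    simp [F, k, hG])
  have hFi : Integrable F := hFc.integrable_of_hasCompactSupport hFs
  have hFA : ∀ w, F w ∈ A := by
    intro w
    by_cases hw : w ∈ L
    · have : F w = 0 := by
        ext z
        simp [F, k, (hG0 w hw).self_of_nhds]
      rw [this]
      exact A.zero_mem
    · obtain ⟨y, hyA, hy⟩ := hres w hw
      have : F w = G w • y := by
        ext z
        simp [F, k, hy]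
      rw [this]
      exact A.smul_mem hyA _
  have hmem : ∫ w, F w ∈ A := by
    set S : Submodule ℝ C(L, ℂ) := (Subalgebra.toSubmodule A).restrictScalars ℝ
    have hS : IsClosed (S : Set C(L, ℂ)) := hA
    have : CompleteSpace S := hS.completeSpace_coe
    set F' : ℂ → S := fun w => ⟨F w, hFA w⟩
    have hFc' : Continuous F' := hFc.subtype_mk _
    have hFs' : HasCompactSupport F' := hFs.mono fun w hw h0 => hw (Subtype.ext h0)
    have := ContinuousLinearMap.integral_comp_comm S.subtypeL
      (hFc'.integrable_of_hasCompactSupport hFs' (μ := volume))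
    have h2 : ∫ w, F w = S.subtypeL (∫ w, F' w) := this
    rw [h2]
    exact (∫ w, F' w).2
  have hmem' : ∫ w, F w ∈ closure (polynomialFunctions L : Set C(L, ℂ)) := by
    rw [← Subalgebra.topologicalClosure_coe]
    exact hmem
  rw [polynomialFunctions_coe, Metric.mem_closure_iff] at hmem'
  obtain ⟨_, ⟨P, rfl⟩, hP⟩ := hmem' ε hε
  refine ⟨P, fun z hz => ?_⟩
  have h1 := (ContinuousMap.dist_apply_le_dist (⟨z, hKL hz⟩ : L)).trans_lt hP
  rw [ContinuousMap.integral_apply hFi, dist_comm] at h1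
  have h2 : ∫ w, F w ⟨z, hKL hz⟩ = h z := by
    rw [← hGi z (hKL hz)]
    rfl
  rw [h2, dist_eq_norm] at h1
  simpa using h1

theorem Polynomial.exists_derivative_eq (P : Polynomial ℂ) : ∃ Q, Polynomial.derivative Q = P := by
  refine ⟨P.sum fun n a => Polynomial.monomial (n + 1) (a / (n + 1)), ?_⟩
  rw [Polynomial.sum, Polynomial.derivative_sum]
  conv_rhs => rw [P.as_sum_support]
  refine Finset.sum_congr rfl fun n _ => ?_
  rw [Polynomial.derivative_monomial, Nat.add_sub_cancel]
  congr 1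
  push_cast
  have : (n : ℂ) + 1 ≠ 0 := Nat.cast_add_one_ne_zero n
  field_simp

open Filter Topology in
theorem NoHole.exists_primitive {U : Set ℂ} (hU : IsOpen U) (hN : NoHole U)
    (hUc : IsPreconnected U) {h : ℂ → ℂ} (hh : DifferentiableOn ℂ h U) :
    ∃ F : ℂ → ℂ, ∀ z ∈ U, HasDerivAt F (h z) z := by
  rcases U.eq_empty_or_nonempty with rfl | ⟨z₀, hz₀⟩
  · exact ⟨0, fun z hz => absurd hz (notMem_empty z)⟩
  have := hU.locallyCompactSpace
  let E := CompactExhaustion.choice U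
  have hP : ∀ n : ℕ, ∃ P : Polynomial ℂ, ∀ z ∈ ((↑) '' E n : Set ℂ),
      ‖P.eval z - h z‖ < 1 / ((n : ℝ) + 1) := fun n =>
    hN.exists_polynomial_near hU ((E.isCompact n).image continuous_subtype_val)
      (by rintro _ ⟨x, -, rfl⟩; exact x.2) hh (by positivity)
  choose P hP using hP
  have hlim : TendstoLocallyUniformlyOn (fun n z => (P n).eval z) h atTop U := by
    rw [tendstoLocallyUniformlyOn_iff_forall_isCompact hU]
    intro K hKU hK
    have hK' : IsCompact ((↑) ⁻¹' K : Set U) :=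
      Topology.IsInducing.subtypeVal.isCompact_preimage_iff (by simpa using hKU) |>.2 hK
    obtain ⟨m, hm⟩ := E.exists_superset_of_isCompact hK'
    rw [Metric.tendstoUniformlyOn_iff]
    intro ε hε
    filter_upwards [eventually_ge_atTop m,
      (tendsto_one_div_add_atTop_nhds_zero_nat (𝕜 := ℝ)).eventually (gt_mem_nhds hε)] with n hn hn'
    intro z hz
    rw [dist_comm, dist_eq_norm]
    exact (hP n z ⟨⟨z, hKU hz⟩, E.subset hn (hm hz), rfl⟩).trans hn'
  choose Q₀ hQ₀ using fun n => (P n).exists_derivative_eq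
  set Q : ℕ → ℂ → ℂ := fun n z => (Q₀ n).eval z - (Q₀ n).eval z₀
  have hQ : ∀ n z, HasDerivAt (Q n) ((P n).eval z) z := fun n z => by
    have := ((Q₀ n).hasDerivAt z).sub_const ((Q₀ n).eval z₀)
    rwa [hQ₀] at this
  set S : Set ℂ := {z | CauchySeq fun n => Q n z}
  have hball : ∀ z ∈ U, ∃ r > 0, ball z r ⊆ U ∧ UniformCauchySeqOn (fun n z => (P n).eval z) atTop
      (ball z r) := by
    intro z hz
    obtain ⟨r, hr, hrU⟩ := Metric.nhds_basis_closedBall.mem_iff.1 (hU.mem_nhds hz)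
    refine ⟨r, hr, ball_subset_closedBall.trans hrU, ?_⟩
    have := (tendstoLocallyUniformlyOn_iff_forall_isCompact hU).1 hlim _ hrU
      (isCompact_closedBall z r)
    exact this.uniformCauchySeqOn.mono ball_subset_closedBall
  have hspread : ∀ y r, UniformCauchySeqOn (fun n z => (P n).eval z) atTop (ball y r) →
      ∀ w ∈ ball y r, w ∈ S → ball y r ⊆ S := by
    intro y r hu w hw hwS x hx
    refine cauchy_map_of_uniformCauchySeqOn_fderiv (𝕜 := ℂ) isOpen_ball
      (convex_ball y r).isPreconnected (f := Q)
      (f' := fun n z => ContinuousLinearMap.toSpanSingleton ℂ ((P n).eval z)) ?_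
      (fun n z _ => (hQ n z).hasFDerivAt) hw hx hwS
    rw [Metric.uniformCauchySeqOn_iff] at hu ⊢
    intro ε hε
    obtain ⟨N, hN⟩ := hu ε hε
    refine ⟨N, fun m hm n hn z hz => ?_⟩
    have : ContinuousLinearMap.toSpanSingleton ℂ ((P m).eval z) -
        ContinuousLinearMap.toSpanSingleton ℂ ((P n).eval z) =
        ContinuousLinearMap.toSpanSingleton ℂ ((P m).eval z - (P n).eval z) := by
      ext
      simp
    rw [dist_eq_norm, this, ContinuousLinearMap.norm_toSpanSingleton, ← dist_eq_norm]
    exact hN m hm n hn z hz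
  have hSU : U ⊆ S := by
    have hz₀S : z₀ ∈ S := by
      simp only [S, mem_ofPred_eq, Q, sub_self]
      exact cauchySeq_const _
    have h1 : IsOpen (U ∩ S) := by
      rw [Metric.isOpen_iff]
      rintro z ⟨hz, hzS⟩
      obtain ⟨r, hr, hrU, hu⟩ := hball z hz
      exact ⟨r, hr, subset_inter hrU (hspread z r hu z (mem_ball_self hr) hzS)⟩
    have h2 : IsOpen (U \ S) := by
      rw [Metric.isOpen_iff]
      rintro z ⟨hz, hzS⟩
      obtain ⟨r, hr, hrU, hu⟩ := hball z hz
      exact ⟨r, hr, fun w hw => ⟨hrU hw, fun hwS => hzS (hspread z r hu w hw hwS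
        (mem_ball_self hr))⟩⟩
    have := hUc.subset_left_of_subset_union h1 h2
      (disjoint_left.2 fun z hz hz' => hz'.2 hz.2) (by rw [inter_union_sdiff]) ⟨z₀, hz₀, hz₀, hz₀S⟩
    exact this.trans inter_subset_right
  have hex : ∀ z, ∃ y, z ∈ U → Tendsto (fun n => Q n z) atTop (𝓝 y) := fun z => by
    by_cases hz : z ∈ U
    · obtain ⟨y, hy⟩ := cauchySeq_tendsto_of_complete (hSU hz)
      exact ⟨y, fun _ => hy⟩
    · exact ⟨0, fun h => absurd h hz⟩
  choose F hF using hex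
  exact ⟨F, fun z hz => hasDerivAt_of_tendstoLocallyUniformlyOn hU hlim
    (Eventually.of_forall fun n z _ => hQ n z) hF hz⟩

theorem NoHole.exists_log {U : Set ℂ} (hU : IsOpen U) (hN : NoHole U)
    (hUc : IsPreconnected U) {h : ℂ → ℂ} (hh : DifferentiableOn ℂ h U) (h0 : ∀ z ∈ U, h z ≠ 0) :
    ∃ L : ℂ → ℂ, DifferentiableOn ℂ L U ∧ ∀ z ∈ U, Complex.exp (L z) = h z := by
  rcases U.eq_empty_or_nonempty with rfl | ⟨z₀, hz₀⟩
  · exact ⟨0, differentiableOn_empty, fun z hz => absurd hz (notMem_empty z)⟩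
  obtain ⟨F, hF⟩ := hN.exists_primitive hU hUc ((hh.deriv hU).div hh h0)
  have hd : ∀ z ∈ U, HasDerivAt (fun z => h z * Complex.exp (-F z)) 0 z := fun z hz => by
    have h1 := (hh.differentiableAt (hU.mem_nhds hz)).hasDerivAt.mul (hF z hz).neg.cexp
    refine h1.congr_deriv ?_
    have := h0 z hz
    simp only [Pi.div_apply]
    field_simp
    ring
  obtain ⟨c, hc⟩ := hU.exists_is_const_of_deriv_eq_zero hUc
    (fun z hz => (hd z hz).differentiableAt.differentiableWithinAt) fun z hz => (hd z hz).deriv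
  have hc0 : c ≠ 0 := by
    rw [← hc z₀ hz₀]
    exact mul_ne_zero (h0 z₀ hz₀) (Complex.exp_ne_zero _)
  refine ⟨fun z => F z + Complex.log c,
    fun z hz => ((hF z hz).differentiableAt.add_const _).differentiableWithinAt, fun z hz => ?_⟩
  rw [Complex.exp_add, Complex.exp_log hc0, ← hc z hz, mul_comm, mul_assoc, ← Complex.exp_add]
  simp

open Filter Topology in
/-- Local form of Hurwitz's theorem. -/
theorem eventually_eq_zero_of_tendstoLocallyUniformlyOn {ι : Type*} {l : Filter ι} [l.NeBot]
    {U : Set ℂ} (hU : IsOpen U) {G : ι → ℂ → ℂ} {g : ℂ → ℂ}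
    (hG : ∀ n, DifferentiableOn ℂ (G n) U) (hG0 : ∀ n, ∀ z ∈ U, G n z ≠ 0)
    (hlim : TendstoLocallyUniformlyOn G g l U) {b : ℂ} (hb : b ∈ U) (hgb : g b = 0) :
    ∀ᶠ z in 𝓝 b, g z = 0 := by
  have hgd : DifferentiableOn ℂ g U := hlim.differentiableOn (Eventually.of_forall hG) hU
  rcases (hgd.analyticAt (hU.mem_nhds hb)).eventually_eq_zero_or_eventually_ne_zero with h | h
  · exact h
  exfalso
  obtain ⟨r, hr, hrU⟩ := Metric.nhds_basis_closedBall.mem_iff.1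
    (inter_mem (hU.mem_nhds hb) (mem_nhdsWithin_iff_exists_mem_nhds_inter.1 h).choose_spec.1)
  have hne : ∀ z ∈ sphere b r, g z ≠ 0 := by
    intro z hz
    have h1 := (mem_nhdsWithin_iff_exists_mem_nhds_inter.1 h).choose_spec.2
    exact h1 ⟨(hrU (sphere_subset_closedBall hz)).2, ne_of_mem_sphere hz hr.ne'⟩
  have hrU' : closedBall b r ⊆ U := hrU.trans inter_subset_left
  obtain ⟨z₁, hz₁, hmin⟩ := (isCompact_sphere b r).exists_isMinOn
    (NormedSpace.sphere_nonempty.2 hr.le)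
    ((hgd.continuousOn.mono (sphere_subset_closedBall.trans hrU')).norm)
  set m := ‖g z₁‖
  have hm : 0 < m := norm_pos_iff.2 (hne z₁ hz₁)
  have hu := (tendstoLocallyUniformlyOn_iff_forall_isCompact hU).1 hlim _ hrU'
    (isCompact_closedBall b r)
  obtain ⟨n, hn⟩ := (Metric.tendstoUniformlyOn_iff.1 hu (m / 2) (half_pos hm)).exists
  have hbd : ∀ z ∈ frontier (ball b r), ‖(G n z)⁻¹‖ ≤ (m / 2)⁻¹ := by
    intro z hz
    rw [frontier_ball b hr.ne'] at hz
    rw [norm_inv]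
    have h1 : m ≤ ‖g z‖ := hmin hz
    have h2 := hn z (sphere_subset_closedBall hz)
    rw [dist_eq_norm] at h2
    have h3 := norm_sub_norm_le (g z) (G n z)
    gcongr
    linarith
  have hd : DiffContOnCl ℂ (fun z => (G n z)⁻¹) (ball b r) := by
    refine DifferentiableOn.diffContOnCl ?_
    rw [closure_ball b hr.ne']
    exact ((hG n).mono hrU').inv fun z hz => hG0 n z (hrU' hz)
  have h1 := Complex.norm_le_of_forall_mem_frontier_norm_le isBounded_ball hd hbd
    (subset_closure (mem_ball_self hr))
  have h2 := hn b (mem_closedBall_self hr.le)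
  rw [hgb, dist_zero_left] at h2
  rw [norm_inv] at h1
  have := inv_strictAnti₀ (norm_pos_iff.2 (hG0 n b hb)) h2
  linarith

open Filter Topology in
/-- Montel's theorem along an ultrafilter. -/
theorem exists_tendstoLocallyUniformlyOn {ι : Type*} (l : Ultrafilter ι) {U : Set ℂ}
    (hU : IsOpen U) {G : ι → ℂ → ℂ} (hG : ∀ n, DifferentiableOn ℂ (G n) U)
    (hb : ∀ n, ∀ z ∈ U, ‖G n z‖ ≤ 1) :
    ∃ g : ℂ → ℂ, TendstoLocallyUniformlyOn G g l U := by
  have hex : ∀ z, ∃ y, z ∈ U → Tendsto (fun n => G n z) l (𝓝 y) := fun z => by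
    by_cases hz : z ∈ U
    · obtain ⟨y, -, hy⟩ := (isCompact_closedBall (0 : ℂ) 1).ultrafilter_le_nhds
        (l.map fun n => G n z) (by
          rw [le_principal_iff]
          exact Filter.mem_map.2
            (Eventually.of_forall fun n => mem_closedBall_zero_iff.2 (hb n z hz)))
      exact ⟨y, fun _ => hy⟩
    · exact ⟨0, fun h => absurd h hz⟩
  choose g hg using hex
  refine ⟨g, Metric.tendstoLocallyUniformlyOn_iff.2 fun ε hε x hx => ?_⟩
  obtain ⟨r, hr, hrU⟩ := Metric.isOpen_iff.1 hU x hx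
  have hlip : ∀ n, ∀ y ∈ ball x r, ‖G n y - G n x‖ ≤ 3 / r * ‖y - x‖ := by
    intro n y hy
    have := Complex.dist_le_div_mul_dist_of_mapsTo_ball (f := G n) (c := x) (R₁ := r) (R₂ := 3)
      ((hG n).mono hrU) (fun z hz => by
        rw [mem_closedBall, dist_eq_norm]
        linarith [norm_sub_le (G n z) (G n x), hb n z (hrU hz), hb n x hx]) hy
    rwa [dist_eq_norm, dist_eq_norm] at this
  set δ := min r (ε * r / 12)
  have hδ : 0 < δ := lt_min hr (by positivity)
  refine ⟨ball x δ, mem_nhdsWithin_of_mem_nhds (ball_mem_nhds x hδ), ?_⟩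
  have hclose : ∀ n, ∀ y ∈ ball x δ, ‖G n y - G n x‖ ≤ ε / 4 := by
    intro n y hy
    refine (hlip n y (ball_subset_ball (min_le_left _ _) hy)).trans ?_
    have : ‖y - x‖ ≤ ε * r / 12 := by
      rw [← dist_eq_norm]
      exact (mem_ball.1 hy).le.trans (min_le_right _ _)
    calc 3 / r * ‖y - x‖ ≤ 3 / r * (ε * r / 12) := by gcongr
      _ = ε / 4 := by field_simp; norm_num
  filter_upwards [(Metric.tendsto_nhds.1 (hg x hx)) (ε / 4) (by positivity)] with n hn y hy
  have hyU : y ∈ U := hrU (ball_subset_ball (min_le_left _ _) hy)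
  have h1 : ‖g y - g x‖ ≤ ε / 4 :=
    le_of_tendsto ((hg y hyU).sub (hg x hx)).norm (Eventually.of_forall fun n => hclose n y hy)
  have h2 := hclose n y hy
  rw [dist_eq_norm] at hn ⊢
  have : g y - G n y = (g y - g x) - (G n y - G n x) - (G n x - g x) := by ring
  rw [this]
  linarith [norm_sub_le ((g y - g x) - (G n y - G n x)) (G n x - g x),
    norm_sub_le (g y - g x) (G n y - G n x)]

/-- The disc automorphism exchanging `w` with the origin. -/
def discAut (w z : ℂ) : ℂ := (z - w) / (1 - starRingEnd ℂ w * z)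

theorem one_sub_conj_mul_ne_zero {w z : ℂ} (hw : ‖w‖ < 1) (hz : ‖z‖ < 1) :
    1 - starRingEnd ℂ w * z ≠ 0 := by
  intro h
  have h1 : starRingEnd ℂ w * z = 1 := (sub_eq_zero.1 h).symm
  have h2 : ‖w‖ * ‖z‖ = 1 := by rw [← RCLike.norm_conj w, ← norm_mul, h1, norm_one]
  nlinarith [norm_nonneg w, norm_nonneg z]

theorem norm_discAut_lt {w z : ℂ} (hw : ‖w‖ < 1) (hz : ‖z‖ < 1) : ‖discAut w z‖ < 1 := by
  have h0 := one_sub_conj_mul_ne_zero hw hz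
  rw [discAut, norm_div, div_lt_one (norm_pos_iff.2 h0)]
  refine lt_of_pow_lt_pow_left₀ 2 (norm_nonneg _) ?_
  have hw2 : ‖w‖ ^ 2 < 1 := by nlinarith [norm_nonneg w]
  have hz2 : ‖z‖ ^ 2 < 1 := by nlinarith [norm_nonneg z]
  rw [Complex.sq_norm, Complex.normSq_apply] at hw2 hz2 ⊢
  rw [Complex.sq_norm, Complex.normSq_apply]
  simp only [Complex.sub_re, Complex.sub_im, Complex.one_re, Complex.one_im, Complex.mul_re,
    Complex.mul_im, Complex.conj_re, Complex.conj_im]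
  nlinarith [mul_pos (sub_pos.2 hw2) (sub_pos.2 hz2)]

theorem hasDerivAt_discAut {w z : ℂ} (hw : ‖w‖ < 1) (hz : ‖z‖ < 1) :
    HasDerivAt (discAut w) ((1 - (‖w‖ : ℂ) ^ 2) / (1 - starRingEnd ℂ w * z) ^ 2) z := by
  have h0 := one_sub_conj_mul_ne_zero hw hz
  have h1 := ((hasDerivAt_id z).sub_const w).div
    (((hasDerivAt_id z).const_mul (starRingEnd ℂ w)).const_sub 1) h0
  refine h1.congr_deriv ?_
  simp only [id, mul_one, one_mul]
  congr 1
  rw [← Complex.mul_conj' w]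
  ring

theorem discAut_neg_discAut {w z : ℂ} (hw : ‖w‖ < 1) (hz : ‖z‖ < 1) :
    discAut (-w) (discAut w z) = z := by
  have h0 := one_sub_conj_mul_ne_zero hw hz
  have h1 := one_sub_conj_mul_ne_zero (w := -w) (by rwa [norm_neg]) (norm_discAut_lt hw hz)
  have h2 := one_sub_conj_mul_ne_zero hw hw
  unfold discAut at h1 ⊢
  rw [map_neg] at h1 ⊢
  rw [div_eq_iff h1]
  have h3 : (z - w) / (1 - starRingEnd ℂ w * z) * (1 - starRingEnd ℂ w * z) = z - w :=
    div_mul_cancel₀ _ h0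
  generalize (z - w) / (1 - starRingEnd ℂ w * z) = q at h3 ⊢
  refine mul_right_cancel₀ h0 ?_
  linear_combination (1 - starRingEnd ℂ w * z) * h3

theorem one_sub_norm_sq_ne_zero {w : ℂ} (hw : ‖w‖ < 1) : (1 - (‖w‖ : ℂ) ^ 2) ≠ 0 := by
  have : (1 - ‖w‖ ^ 2 : ℝ) ≠ 0 := by nlinarith [norm_nonneg w]
  exact_mod_cast this

open Filter Topology in
/-- The competitors in the extremal problem of the Riemann mapping theorem. -/
structure RiemannCandidate (U : Set ℂ) (g : ℂ → ℂ) : Prop where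
  diff : DifferentiableOn ℂ g U
  inj : InjOn g U
  deriv_ne : ∀ z ∈ U, deriv g z ≠ 0
  zero : g 0 = 0
  lt_one : ∀ z ∈ U, ‖g z‖ < 1

theorem RiemannCandidate.exists_larger {U : Set ℂ} (hU : IsOpen U) (hN : NoHole U)
    (hUc : IsPreconnected U) (h0 : (0 : ℂ) ∈ U) {g : ℂ → ℂ} (hg : RiemannCandidate U g)
    {w : ℂ} (hw : ‖w‖ < 1) (hwg : ∀ z ∈ U, g z ≠ w) :
    ∃ h, RiemannCandidate U h ∧ ‖deriv g 0‖ < ‖deriv h 0‖ := by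
  have hgd : ∀ z ∈ U, HasDerivAt g (deriv g z) z := fun z hz =>
    (hg.diff.differentiableAt (hU.mem_nhds hz)).hasDerivAt
  set h : ℂ → ℂ := fun z => discAut w (g z)
  have hhd : ∀ z ∈ U, HasDerivAt h
      ((1 - (‖w‖ : ℂ) ^ 2) / (1 - starRingEnd ℂ w * g z) ^ 2 * deriv g z) z := fun z hz =>
    (hasDerivAt_discAut hw (hg.lt_one z hz)).comp z (hgd z hz)
  have hh0 : ∀ z ∈ U, h z ≠ 0 := fun z hz =>
    div_ne_zero (sub_ne_zero.2 (hwg z hz)) (one_sub_conj_mul_ne_zero hw (hg.lt_one z hz))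
  obtain ⟨L, hL, hLe⟩ := hN.exists_log hU hUc
    (fun z hz => (hhd z hz).differentiableAt.differentiableWithinAt) hh0
  set k : ℂ → ℂ := fun z => Complex.exp (L z / 2)
  have hk2 : ∀ z ∈ U, k z ^ 2 = h z := fun z hz => by
    rw [← hLe z hz, ← Complex.exp_nat_mul]
    congr 1
    push_cast
    ring
  have hkd : ∀ z ∈ U, HasDerivAt k (deriv k z) z := fun z hz =>
    (((hL.differentiableAt (hU.mem_nhds hz)).div_const 2).cexp).hasDerivAt
  have hkne : ∀ z, k z ≠ 0 := fun z => Complex.exp_ne_zero _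
  have hkh : ∀ z ∈ U, 2 * k z * deriv k z =
      (1 - (‖w‖ : ℂ) ^ 2) / (1 - starRingEnd ℂ w * g z) ^ 2 * deriv g z := fun z hz => by
    have h1 := (hkd z hz).pow 2
    have h2 : HasDerivAt h (((2 : ℕ) : ℂ) * k z ^ (2 - 1) * deriv k z) z :=
      h1.congr_of_eventuallyEq (by
        filter_upwards [hU.mem_nhds hz] with y hy
        exact (hk2 y hy).symm)
    have h3 := h2.unique (hhd z hz)
    rw [← h3]
    norm_num
  have hk1 : ∀ z ∈ U, ‖k z‖ < 1 := fun z hz => by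
    have h1 : ‖k z‖ ^ 2 < 1 := by
      rw [← norm_pow, hk2 z hz]
      exact norm_discAut_lt hw (hg.lt_one z hz)
    nlinarith [norm_nonneg (k z)]
  have hkinj : InjOn k U := fun x hx y hy hxy => by
    refine hg.inj hx hy ?_
    have h1 : h x = h y := by rw [← hk2 x hx, ← hk2 y hy, hxy]
    have h2 := congrArg (discAut (-w)) h1
    rwa [discAut_neg_discAut hw (hg.lt_one x hx), discAut_neg_discAut hw (hg.lt_one y hy)] at h2
  have hkd0 : ∀ z ∈ U, deriv k z ≠ 0 := fun z hz hz0 => by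
    have h1 := hkh z hz
    rw [hz0, mul_zero] at h1
    exact mul_ne_zero (div_ne_zero (one_sub_norm_sq_ne_zero hw)
      (pow_ne_zero 2 (one_sub_conj_mul_ne_zero hw (hg.lt_one z hz)))) (hg.deriv_ne z hz) h1.symm
  have hk0 := hk1 0 h0
  have hd : ∀ z ∈ U, HasDerivAt (fun z => discAut (k 0) (k z))
      ((1 - (‖k 0‖ : ℂ) ^ 2) / (1 - starRingEnd ℂ (k 0) * k z) ^ 2 * deriv k z) z := fun z hz =>
    (hasDerivAt_discAut hk0 (hk1 z hz)).comp z (hkd z hz)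
  refine ⟨fun z => discAut (k 0) (k z),
    ⟨fun z hz => (hd z hz).differentiableAt.differentiableWithinAt,
    fun x hx y hy hxy => hkinj hx hy ?_, fun z hz => ?_, by simp [discAut],
    fun z hz => norm_discAut_lt hk0 (hk1 z hz)⟩, ?_⟩
  · have h2 := congrArg (discAut (-(k 0))) hxy
    rwa [discAut_neg_discAut hk0 (hk1 x hx), discAut_neg_discAut hk0 (hk1 y hy)] at h2
  · rw [(hd z hz).deriv]
    exact mul_ne_zero (div_ne_zero (one_sub_norm_sq_ne_zero hk0)
      (pow_ne_zero 2 (one_sub_conj_mul_ne_zero hk0 (hk1 z hz)))) (hkd0 z hz)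
  · rw [(hd 0 h0).deriv]
    have h1 := hkh 0 h0
    have h2 : k 0 ^ 2 = -w := by rw [hk2 0 h0]; simp [h, discAut, hg.zero]
    rw [hg.zero, mul_zero, sub_zero, one_pow, div_one] at h1
    set t := ‖k 0‖ with ht
    have htpos : 0 < t := norm_pos_iff.2 (hkne 0)
    have hw' : ‖w‖ = t ^ 2 := by rw [ht, ← norm_pow, h2, norm_neg]
    have hconj : starRingEnd ℂ (k 0) * k 0 = ((t ^ 2 : ℝ) : ℂ) := by
      rw [mul_comm, Complex.mul_conj', Complex.ofReal_pow]
    have h3 : 2 * t * ‖deriv k 0‖ = (1 - t ^ 4) * ‖deriv g 0‖ := by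
      have h4 := congrArg norm h1
      rw [norm_mul, norm_mul, norm_mul, ← ht] at h4
      have h5 : (1 - (‖w‖ : ℂ) ^ 2) = ((1 - t ^ 4 : ℝ) : ℂ) := by
        rw [hw']; push_cast; ring
      have ht4 : t ^ 4 ≤ 1 := pow_le_one₀ htpos.le hk0.le
      rw [h5, Complex.norm_real, Real.norm_of_nonneg (by linarith)] at h4
      simpa using h4
    rw [hconj]
    have h6 : (1 - (t : ℂ) ^ 2) / (1 - ((t ^ 2 : ℝ) : ℂ)) ^ 2 = (((1 - t ^ 2)⁻¹ : ℝ) : ℂ) := by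
      have : (1 - (t : ℂ) ^ 2) ≠ 0 := one_sub_norm_sq_ne_zero hk0
      push_cast
      field_simp
    have hlt : 0 < 1 - t ^ 2 := by nlinarith
    rw [h6, norm_mul, Complex.norm_real, Real.norm_of_nonneg (inv_nonneg.2 hlt.le)]
    have hgpos : 0 < ‖deriv g 0‖ := norm_pos_iff.2 (hg.deriv_ne 0 h0)
    rw [inv_mul_eq_div, lt_div_iff₀ hlt]
    have h7 : 2 * t * (‖deriv g 0‖ * (1 - t ^ 2)) < 2 * t * ‖deriv k 0‖ := by
      rw [h3]
      have : 0 < (1 - t ^ 2) * (1 - t) ^ 2 * ‖deriv g 0‖ :=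
        mul_pos (mul_pos hlt (pow_pos (sub_pos.2 hk0) 2)) hgpos
      nlinarith
    exact lt_of_mul_lt_mul_left h7 (by positivity)

open Filter Topology in
theorem exists_riemannCandidate_surjOn {U : Set ℂ} (hU : IsOpen U) (hN : NoHole U)
    (hUc : IsPreconnected U) (hb : Bornology.IsBounded U) (h0 : (0 : ℂ) ∈ U) :
    ∃ g, RiemannCandidate U g ∧ ∀ w, ‖w‖ < 1 → ∃ z ∈ U, g z = w := by
  obtain ⟨R, hR, hUR⟩ := hb.subset_ball_lt 0 0
  have hc0 : RiemannCandidate U (fun z => (R : ℂ)⁻¹ * z) := by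
    have hRne : (R : ℂ)⁻¹ ≠ 0 := inv_ne_zero (by exact_mod_cast hR.ne')
    refine ⟨by fun_prop, fun x _ y _ hxy => mul_left_cancel₀ hRne hxy, fun z _ => ?_, by simp,
      fun z hz => ?_⟩
    · rw [((hasDerivAt_id' z).const_mul (R : ℂ)⁻¹).deriv, mul_one]
      exact hRne
    · rw [norm_mul, norm_inv, Complex.norm_real, Real.norm_of_nonneg hR.le, inv_mul_lt_iff₀ hR,
        mul_one]
      exact mem_ball_zero_iff.1 (hUR hz)
  obtain ⟨r, hr, hrU⟩ := Metric.isOpen_iff.1 hU 0 h0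
  set S : Set ℝ := (fun g : ℂ → ℂ => ‖deriv g 0‖) '' {g | RiemannCandidate U g}
  have hSne : S.Nonempty := ⟨_, _, hc0, rfl⟩
  have hSb : BddAbove S := by
    refine ⟨1 / r, ?_⟩
    rintro _ ⟨g, hg, rfl⟩
    refine Complex.norm_deriv_le_div_of_mapsTo_ball (hg.diff.mono hrU) (fun z hz => ?_) hr
    rw [hg.zero]
    exact mem_closedBall_zero_iff.2 (hg.lt_one z (hrU hz)).le
  obtain ⟨x, -, hx, hxS⟩ := exists_seq_tendsto_sSup hSne hSb
  choose G hG hGx using hxS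
  have hs : 0 < sSup S :=
    (norm_pos_iff.2 (hc0.deriv_ne 0 h0)).trans_le (le_csSup hSb ⟨_, hc0, rfl⟩)
  obtain ⟨g₁, hlim₁⟩ := exists_tendstoLocallyUniformlyOn (hyperfilter ℕ) hU
    (fun n => (hG n).diff) (fun n z hz => ((hG n).lt_one z hz).le)
  have hle : ((hyperfilter ℕ : Ultrafilter ℕ) : Filter ℕ) ≤ atTop := by
    rw [← Nat.cofinite_eq_atTop]; exact hyperfilter_le_cofinite
  set l : Filter ℕ := ((hyperfilter ℕ : Ultrafilter ℕ) : Filter ℕ)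
  have hgdiff := hlim₁.differentiableOn (Eventually.of_forall fun n => (hG n).diff) hU
  have hlimd := hlim₁.deriv (Eventually.of_forall fun n => (hG n).diff) hU
  have hd0 : ‖deriv g₁ 0‖ = sSup S := by
    refine tendsto_nhds_unique (hlimd.tendsto_at h0).norm ?_
    refine (hx.mono_left hle).congr fun n => ?_
    exact (hGx n).symm
  have hd0' : deriv g₁ 0 ≠ 0 := norm_ne_zero_iff.1 (hd0 ▸ hs.ne')
  have hderiv : ∀ z ∈ U, deriv g₁ z ≠ 0 := by
    intro z hz hz0
    have h1 := eventually_eq_zero_of_tendstoLocallyUniformlyOn hU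
      (fun n => ((hG n).diff.deriv hU)) (fun n => (hG n).deriv_ne) hlimd hz hz0
    have h2 := ((hgdiff.deriv hU).analyticOnNhd hU).eqOn_zero_of_preconnected_of_eventuallyEq_zero
      hUc hz h1
    exact hd0' (h2 h0)
  have hconst : ∀ z ∈ U, ∀ y, ¬ ∀ᶠ ζ in 𝓝 z, g₁ ζ = y := fun z hz y h => by
    refine hderiv z hz ?_
    rw [Filter.EventuallyEq.deriv_eq (f := fun _ => y) h]
    simp
  have hg : RiemannCandidate U g₁ := by
    refine ⟨hgdiff, fun x hx y hy hxy => ?_, hderiv, ?_, fun z hz => ?_⟩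
    · by_contra hne
      have hU' : IsOpen (U \ {x}) := hU.sdiff isClosed_singleton
      have h1 : TendstoLocallyUniformlyOn (fun n ζ => G n ζ - G n x) (fun ζ => g₁ ζ - g₁ x) l
          (U \ {x}) := by
        refine (hlim₁.mono sdiff_subset).sub ?_
        exact ((hlim₁.tendsto_at hx).tendstoUniformlyOn_const _).tendstoLocallyUniformlyOn
      have h2 := eventually_eq_zero_of_tendstoLocallyUniformlyOn hU'
        (fun n => (((hG n).diff.mono sdiff_subset).sub_const _))
        (fun n z hz h => hz.2 ((hG n).inj hz.1 hx (sub_eq_zero.1 h))) h1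
        (b := y) ⟨hy, fun h => hne h.symm⟩ (sub_eq_zero.2 hxy.symm)
      exact hconst y hy (g₁ x) (h2.mono fun ζ hζ => sub_eq_zero.1 hζ)
    · refine tendsto_nhds_unique (hlim₁.tendsto_at h0) ?_
      exact tendsto_const_nhds.congr fun n => (hG n).zero.symm
    · have hle1 : ∀ ζ ∈ U, ‖g₁ ζ‖ ≤ 1 := fun ζ hζ =>
        le_of_tendsto (hlim₁.tendsto_at hζ).norm
          (Eventually.of_forall fun n => ((hG n).lt_one ζ hζ).le)
      refine (hle1 z hz).lt_of_ne fun h => ?_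
      refine hconst z hz (g₁ z) (Complex.eventually_eq_of_isLocalMax_norm ?_ ?_)
      · filter_upwards [hU.mem_nhds hz] with y hy
        exact hgdiff.differentiableAt (hU.mem_nhds hy)
      · filter_upwards [hU.mem_nhds hz] with y hy
        simp only [Function.comp, h]
        exact hle1 y hy
  refine ⟨g₁, hg, fun w hw => ?_⟩
  by_contra! hcon
  obtain ⟨h, hh, hlt⟩ := hg.exists_larger hU hN hUc h0 hw hcon
  rw [hd0] at hlt
  exact absurd (le_csSup hSb ⟨h, hh, rfl⟩) (not_le.2 hlt)

open Filter Topology in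
/-- The Riemann mapping theorem for bounded domains without holes. -/
theorem NoHole.exists_riemann_map {U : Set ℂ} (hU : IsOpen U) (hN : NoHole U)
    (hUc : IsPreconnected U) (hb : Bornology.IsBounded U) (h0 : (0 : ℂ) ∈ U) :
    ∃ f g : ℂ → ℂ, DifferentiableOn ℂ f (ball 0 1) ∧ MapsTo f (ball 0 1) U ∧
      DifferentiableOn ℂ g U ∧ MapsTo g U (ball 0 1) ∧ (∀ z ∈ U, f (g z) = z) ∧
      (∀ w ∈ ball (0 : ℂ) 1, g (f w) = w) ∧ f 0 = 0 ∧ g 0 = 0 := by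
  obtain ⟨g, hg, hsurj⟩ := exists_riemannCandidate_surjOn hU hN hUc hb h0
  set f := Function.invFunOn g U
  have hf : ∀ w ∈ ball (0 : ℂ) 1, f w ∈ U ∧ g (f w) = w := fun w hw =>
    Function.invFunOn_pos (hsurj w (mem_ball_zero_iff.1 hw))
  have hfg : ∀ z ∈ U, f (g z) = z := fun z hz =>
    hg.inj (hf _ (mem_ball_zero_iff.2 (hg.lt_one z hz))).1 hz
      (hf _ (mem_ball_zero_iff.2 (hg.lt_one z hz))).2
  refine ⟨f, g, fun w hw => ?_, fun w hw => (hf w hw).1, hg.diff,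
    fun z hz => mem_ball_zero_iff.2 (hg.lt_one z hz), hfg, fun w hw => (hf w hw).2, ?_, hg.zero⟩
  · have hwU := (hf w hw).1
    have hgw := (hf w hw).2
    have hdiff := hg.diff.differentiableAt (hU.mem_nhds hwU)
    refine (HasDerivAt.of_local_left_inverse (f' := deriv g (f w)) ?_ hdiff.hasDerivAt
      (hg.deriv_ne _ hwU) ?_).differentiableAt.differentiableWithinAt
    · intro V hV
      have hop := hdiff.hasDerivAt
      have han : AnalyticAt ℂ g (f w) := hg.diff.analyticAt (hU.mem_nhds hwU)
      rcases han.eventually_constant_or_nhds_le_map_nhds with h | h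
      · refine absurd ?_ (hg.deriv_ne _ hwU)
        rw [Filter.EventuallyEq.deriv_eq (f := fun _ => g (f w)) h]
        simp
      · rw [hgw] at h
        have h1 : V ∩ U ∈ 𝓝 (f w) := inter_mem hV (hU.mem_nhds hwU)
        have h2 := h (Filter.image_mem_map h1)
        refine Filter.mem_map.2 (mem_of_superset h2 ?_)
        rintro _ ⟨z, hz, rfl⟩
        rw [mem_preimage, hfg z hz.2]
        exact hz.1
    · filter_upwards [isOpen_ball.mem_nhds hw] with y hy
      exact (hf y hy).2
  · have := hfg 0 h0
    rwa [hg.zero] at this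

/-- The real part of a vector of `ℂ³`. -/
def reV (w : Fin 3 → ℂ) : R3 := WithLp.toLp 2 fun i => (w i).re

@[simp] theorem reV_apply (w : Fin 3 → ℂ) (i : Fin 3) : reV w i = (w i).re := rfl

/-- The quadratic parametrization of the null cone of `ℂ³`. -/
def nul (a b : ℂ) : Fin 3 → ℂ := ![a ^ 2 - b ^ 2, Complex.I * (a ^ 2 + b ^ 2), 2 * a * b]

@[simp] theorem nul_apply_zero (a b : ℂ) : nul a b 0 = a ^ 2 - b ^ 2 := rfl
@[simp] theorem nul_apply_one (a b : ℂ) : nul a b 1 = Complex.I * (a ^ 2 + b ^ 2) := rfl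
@[simp] theorem nul_apply_two (a b : ℂ) : nul a b 2 = 2 * a * b := rfl

theorem norm_reV_mul_nul (l a b : ℂ) :
    ‖reV fun i => l * nul a b i‖ = ‖l‖ * (‖a‖ ^ 2 + ‖b‖ ^ 2) := by
  rw [← sq_eq_sq₀ (norm_nonneg _) (by positivity), EuclideanSpace.real_norm_sq_eq,
    Fin.sum_univ_three, mul_pow, Complex.sq_norm, Complex.sq_norm, Complex.sq_norm]
  simp only [reV_apply, nul_apply_zero, nul_apply_one, nul_apply_two, Complex.normSq_apply,
    Complex.mul_re,
    Complex.sub_re, Complex.sub_im, Complex.add_re, Complex.add_im, pow_two, Complex.mul_im,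
    Complex.I_re, Complex.I_im, Complex.re_ofNat, Complex.im_ofNat]
  ring

theorem norm_reV_le {w : Fin 3 → ℂ} {r : ℝ} (hr : 0 ≤ r) (hw : ∀ i, ‖w i‖ ≤ r) :
    ‖reV w‖ ≤ 2 * r := by
  rw [← sq_le_sq₀ (norm_nonneg _) (by positivity), EuclideanSpace.real_norm_sq_eq,
    Fin.sum_univ_three]
  have h : ∀ i, (reV w i) ^ 2 ≤ r ^ 2 := fun i => by
    rw [reV_apply, ← sq_abs]
    exact pow_le_pow_left₀ (abs_nonneg _) ((Complex.abs_re_le_norm _).trans (hw i)) 2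
  nlinarith [h 0, h 1, h 2]

/-- The real differential of the real part of a holomorphic curve. -/
def reVFDeriv (D : Fin 3 → ℂ) : ℂ →L[ℝ] R3 :=
  LinearMap.toContinuousLinearMap
    { toFun := fun v => reV fun i => v * D i
      map_add' := fun x y => by
        ext i
        simp [add_mul]
      map_smul' := fun c x => by
        ext i
        simp [mul_assoc, mul_sub] }

@[simp] theorem reVFDeriv_apply (D : Fin 3 → ℂ) (v : ℂ) :
    reVFDeriv D v = reV fun i => v * D i := rfl

theorem hasFDerivAt_reV {H : Fin 3 → ℂ → ℂ} {D : Fin 3 → ℂ} {z : ℂ}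
    (h : ∀ i, HasDerivAt (H i) (D i) z) :
    HasFDerivAt (fun z => reV fun i => H i z) (reVFDeriv D) z := by
  rw [← hasFDerivWithinAt_univ, hasFDerivWithinAt_euclidean]
  intro i
  rw [hasFDerivWithinAt_univ]
  have h1 := Complex.reCLM.hasFDerivAt.comp z ((h i).hasFDerivAt.restrictScalars ℝ)
  refine h1.congr_fderiv ?_
  ext v
  simp

theorem harmonicAt_iff_of_contDiffAt {f : ℂ → ℝ} {z : ℂ} (hf : ContDiffAt ℝ 2 f z) :
    Laplacian.laplacian f z = fderiv ℝ (fun w => fderiv ℝ f w 1) z 1 +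
      fderiv ℝ (fun w => fderiv ℝ f w Complex.I) z Complex.I := by
  have h1 : DifferentiableAt ℝ (fderiv ℝ f) z :=
    (hf.fderiv_right (m := 1) (by norm_num)).differentiableAt (by norm_num)
  have h2 : ∀ e : ℂ, fderiv ℝ (fun w => fderiv ℝ f w e) z e = fderiv ℝ (fderiv ℝ f) z e e := by
    intro e
    rw [fderiv_clm_apply h1 (differentiableAt_const e)]
    simp
  rw [InnerProductSpace.laplacian_eq_iteratedFDeriv_complexPlane, h2, h2]
  simp [iteratedFDeriv_two_apply]

/-- The real part of a null holomorphic immersion is a conformal minimal immersion. -/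
theorem confMinImmOn_reV {V : Set ℂ} (hV : IsOpen V) {H : Fin 3 → ℂ → ℂ} {D : ℂ → Fin 3 → ℂ}
    (hH : ∀ z ∈ V, ∀ i, HasDerivAt (H i) (D z i) z)
    (hD : ∀ z ∈ V, ∃ l a b : ℂ, l ≠ 0 ∧ (a ≠ 0 ∨ b ≠ 0) ∧ ∀ i, D z i = l * nul a b i) :
    ConfMinImmOn (fun z => reV fun i => H i z) V := by
  have han : ∀ i, ∀ z ∈ V, AnalyticAt ℂ (H i) z := fun i z hz =>
    DifferentiableOn.analyticAt (s := V)
      (fun y hy => (hH y hy i).differentiableAt.differentiableWithinAt) (hV.mem_nhds hz)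
  have hre : ∀ i, ∀ z ∈ V, AnalyticAt ℝ (fun z => (H i z).re) z := fun i z hz =>
    (Complex.reCLM.analyticAt (H i z)).comp (han i z hz).restrictScalars
  refine ⟨?_, fun i z hz => ?_, fun z hz => ?_⟩
  · refine contDiffOn_euclidean.2 fun i z hz => ?_
    exact ((hre i z hz).contDiffAt).contDiffWithinAt
  · have h1 := (han i z hz).harmonicAt_re
    have h2 := harmonicAt_iff_of_contDiffAt h1.1
    exact h2.symm.trans h1.2.self_of_nhds
  · obtain ⟨l, a, b, hl, hab, h⟩ := hD z hz
    refine ⟨‖l‖ * (‖a‖ ^ 2 + ‖b‖ ^ 2), ?_, fun v => ?_⟩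
    · refine mul_pos (norm_pos_iff.2 hl) ?_
      rcases hab with h | h
      · have := norm_pos_iff.2 h
        positivity
      · have := norm_pos_iff.2 h
        positivity
    · rw [(hasFDerivAt_reV (hH z hz)).fderiv, reVFDeriv_apply]
      have : (fun i => v * D z i) = fun i => (v * l) * nul a b i := by
        ext i; rw [h i, mul_assoc]
      rw [this, norm_reV_mul_nul, norm_mul]
      ring

theorem HarmOn.harmonicAt {f : ℂ → ℝ} {U : Set ℂ} (hU : IsOpen U)
    (hf : ContDiffOn ℝ 2 f U) (h : HarmOn f U) {z : ℂ} (hz : z ∈ U) :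
    InnerProductSpace.HarmonicAt f z := by
  refine ⟨hf.contDiffAt (hU.mem_nhds hz), ?_⟩
  filter_upwards [hU.mem_nhds hz] with y hy
  rw [harmonicAt_iff_of_contDiffAt (hf.contDiffAt (hU.mem_nhds hy))]
  exact h y hy

theorem HarmonicAt.comp_analyticAt {f : ℂ → ℝ} {g : ℂ → ℂ} {z : ℂ}
    (hf : InnerProductSpace.HarmonicAt f (g z)) (hg : AnalyticAt ℂ g z) :
    InnerProductSpace.HarmonicAt (f ∘ g) z := by
  obtain ⟨e, he, hball⟩ := Metric.isOpen_iff.1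
    (InnerProductSpace.isOpen_setOfPred_harmonicAt (f := f)) (g z) hf
  obtain ⟨F, hF, hFe⟩ := InnerProductSpace.HarmonicOnNhd.exists_analyticOnNhd_ball_re_eq
    (f := f) (z := g z) (R := e) fun y hy => hball hy
  have h1 := ((hF (g z) (mem_ball_self he)).comp hg).harmonicAt_re
  refine (InnerProductSpace.harmonicAt_congr_nhds ?_).1 h1
  filter_upwards [hg.continuousAt.preimage_mem_nhds (ball_mem_nhds (g z) he)] with y hy
  exact hFe hy

/-- A conformal minimal immersion pulled back to a disc is the real part of a null curve. -/
theorem ConfMinImmOn.exists_null {U : Set ℂ} (hU : IsOpen U) {X : ℂ → R3}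
    (hX : ConfMinImmOn X U) {f : ℂ → ℂ} {R : ℝ} (hR : 0 < R)
    (hf : DifferentiableOn ℂ f (ball 0 R))
    (hfU : MapsTo f (ball 0 R) U) (hf' : ∀ z ∈ ball (0 : ℂ) R, deriv f z ≠ 0)
    (hX0 : X (f 0) = 0) :
    ∃ H D : Fin 3 → ℂ → ℂ, (∀ i, ∀ z ∈ ball (0 : ℂ) R, HasDerivAt (H i) (D i z) z) ∧
      (∀ i, DifferentiableOn ℂ (D i) (ball 0 R)) ∧ (∀ i, H i 0 = 0) ∧
      (∀ z ∈ ball (0 : ℂ) R, X (f z) = reV fun i => H i z) ∧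
      (∀ z ∈ ball (0 : ℂ) R, D 0 z ^ 2 + D 1 z ^ 2 + D 2 z ^ 2 = 0) ∧
      ∀ z ∈ ball (0 : ℂ) R, ∃ i, D i z ≠ 0 := by
  have hharm : ∀ i : Fin 3, InnerProductSpace.HarmonicOnNhd (fun z => X (f z) i) (ball 0 R) := by
    intro i z hz
    refine HarmonicAt.comp_analyticAt (f := fun z => X z i) ?_
      (hf.analyticAt (isOpen_ball.mem_nhds hz))
    exact HarmOn.harmonicAt hU
      ((contDiffOn_euclidean.1 hX.1 i).of_le (WithTop.coe_le_coe.2 (le_top : (2 : ℕ∞) ≤ ⊤)))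
      (hX.2.1 i) (hfU hz)
  choose F hF hFX using fun i => (hharm i).exists_analyticOnNhd_ball_re_eq
  have hH : ∀ i, ∀ z ∈ ball (0 : ℂ) R,
      HasDerivAt (fun z => F i z - F i 0) (deriv (F i) z) z := fun i z hz =>
    ((hF i z hz).differentiableAt.hasDerivAt).sub_const _
  have hXH : ∀ z ∈ ball (0 : ℂ) R, X (f z) = reV fun i => F i z - F i 0 := by
    intro z hz
    ext i
    have h1 := hFX i hz
    have h2 := hFX i (mem_ball_self hR)
    dsimp only at h1 h2
    rw [hX0] at h2
    rw [reV_apply, Complex.sub_re, h1, h2]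
    simp
  have hconf : ∀ z ∈ ball (0 : ℂ) R, ∃ c : ℝ, 0 < c ∧
      ∀ v : ℂ, ‖reV fun i => v * deriv (F i) z‖ = c * ‖v‖ := by
    intro z hz
    obtain ⟨c, hc, h⟩ := hX.2.2 (f z) (hfU hz)
    have hfd := (hf.differentiableAt (isOpen_ball.mem_nhds hz)).hasDerivAt
    refine ⟨c * ‖deriv f z‖, mul_pos hc (norm_pos_iff.2 (hf' z hz)), fun v => ?_⟩
    have h1 : HasFDerivAt (fun z => X (f z)) (reVFDeriv fun i => deriv (F i) z) z :=
      (hasFDerivAt_reV (hH · z hz)).congr_of_eventuallyEq (by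
        filter_upwards [isOpen_ball.mem_nhds hz] with y hy
        exact hXH y hy)
    have h2 : HasFDerivAt X (fderiv ℝ X (f z)) (f z) :=
      ((hX.1.contDiffAt (hU.mem_nhds (hfU hz))).differentiableAt (by simp)).hasFDerivAt
    have h3 := h2.comp z (hfd.hasFDerivAt.restrictScalars ℝ)
    have h4 := congrArg (fun L => L v) (h1.unique h3)
    simp only [reVFDeriv_apply, ContinuousLinearMap.comp_apply] at h4
    rw [h4, h]
    simp
    ring
  refine ⟨fun i z => F i z - F i 0, fun i => deriv (F i), hH, fun i => ?_, fun i => sub_self _,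
    hXH, fun z hz => ?_, fun z hz => ?_⟩
  · exact fun z hz => (hF i z hz).deriv.differentiableAt.differentiableWithinAt
  · obtain ⟨c, hc, h⟩ := hconf z hz
    have h1 := congrArg (· ^ 2) (h 1)
    have h2 := congrArg (· ^ 2) (h Complex.I)
    have h3 := congrArg (· ^ 2) (h (1 + Complex.I))
    have hn : ‖(1 + Complex.I : ℂ)‖ ^ 2 = 2 := by
      rw [Complex.sq_norm, Complex.normSq_apply]; norm_num
    simp only [EuclideanSpace.real_norm_sq_eq, Fin.sum_univ_three, mul_pow, hn, norm_one,
      Complex.norm_I, reV_apply, one_mul, Complex.mul_re, Complex.I_re, Complex.I_im,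
      Complex.add_re, Complex.add_im, Complex.one_re, Complex.one_im] at h1 h2 h3
    apply Complex.ext
    · simp only [pow_two, Complex.add_re, Complex.mul_re, Complex.zero_re]
      linarith
    · simp only [pow_two, Complex.add_im, Complex.mul_im, Complex.zero_im]
      linarith
  · obtain ⟨c, hc, h⟩ := hconf z hz
    by_contra! hcon
    have h1 := h 1
    have : (fun i => (1 : ℂ) * deriv (F i) z) = fun _ => 0 := by
      ext i; rw [hcon i, mul_zero]
    rw [this] at h1
    have h2 : ‖reV fun _ => 0‖ ≤ 2 * 0 := norm_reV_le le_rfl (by simp)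
    rw [h1, norm_one] at h2
    linarith

theorem noHole_ball {R : ℝ} (hR : 0 < R) : NoHole (ball (0 : ℂ) R) := by
  intro K hK hKc hcl
  have hcompl : (ball (0 : ℂ) R)ᶜ = {z : ℂ | R ≤ ‖z‖} := by
    ext z; simp
  have hpre : IsPreconnected {z : ℂ | R ≤ ‖z‖} := by
    refine (isPreconnected_norm_gt hR.le).subset_closure
      (fun z (hz : R < ‖z‖) => show R ≤ ‖z‖ from hz.le) ?_
    intro z hz
    have hz' : R ≤ ‖z‖ := hz
    have h1 : Filter.Tendsto (fun n : ℕ => (1 + 1 / ((n : ℝ) + 1) : ℝ) • z) Filter.atTop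
        (nhds ((1 + 0 : ℝ) • z)) :=
      (tendsto_const_nhds.add tendsto_one_div_add_atTop_nhds_zero_nat).smul_const z
    rw [add_zero, one_smul] at h1
    refine mem_closure_of_tendsto h1 (Filter.Eventually.of_forall fun n => ?_)
    have hp : 0 < 1 / ((n : ℝ) + 1) := by positivity
    simp only [mem_ofPred_eq]
    rw [norm_smul, Real.norm_of_nonneg (by positivity)]
    nlinarith
  rw [hcompl] at hK hcl
  by_contra hne
  have hKne : K.Nonempty := nonempty_iff_ne_empty.2 hne
  have hall : {z : ℂ | R ≤ ‖z‖} ⊆ K := by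
    by_contra hnot
    obtain ⟨y, hy, hyK⟩ := not_subset.1 hnot
    obtain ⟨x, hx⟩ := hKne
    obtain ⟨w, -, hw1, hw2⟩ := isPreconnected_closed_iff.1 hpre K _ hKc.isClosed hcl
      (fun z hz => by
        by_cases h : z ∈ K
        · exact Or.inl h
        · exact Or.inr ⟨hz, h⟩) ⟨x, hK hx, hx⟩ ⟨y, hy, hy, hyK⟩
    exact hw2.2 hw1
  exact not_isBounded_norm_gt R
    (hKc.isBounded.subset fun z (hz : R < ‖z‖) => hall (show R ≤ ‖z‖ from hz.le))

open Filter Topology in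
/-- A holomorphic function which is locally a square, with finitely many zeros, is a square. -/
theorem exists_sq_eq_of_locally {U : Set ℂ} (hU : IsOpen U) (hN : NoHole U)
    (hUc : IsPreconnected U) : ∀ (Z : Finset ℂ) (ψ : ℂ → ℂ), DifferentiableOn ℂ ψ U →
    (∀ z ∈ U, ψ z = 0 → z ∈ Z) →
    (∀ z ∈ U, ψ z = 0 → ∃ s, AnalyticAt ℂ s z ∧ ∀ᶠ y in 𝓝 z, ψ y = s y ^ 2) →
    ∃ u : ℂ → ℂ, DifferentiableOn ℂ u U ∧ ∀ z ∈ U, u z ^ 2 = ψ z := by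
  intro Z
  induction Z using Finset.strongInduction with
  | H Z ih =>
    intro ψ hψ hZ hloc
    by_cases hz : ∃ z ∈ U, ψ z = 0
    swap
    · push Not at hz
      obtain ⟨L, hL, hLe⟩ := hN.exists_log hU hUc hψ hz
      refine ⟨fun z => Complex.exp (L z / 2), (hL.div_const 2).cexp, fun z hz => ?_⟩
      rw [← hLe z hz, ← Complex.exp_nat_mul]
      congr 1
      push_cast
      ring
    obtain ⟨z₀, hz₀, hψz⟩ := hz
    obtain ⟨s, hs, hsψ⟩ := hloc z₀ hz₀ hψz
    have hs0 : ¬ ∀ᶠ z in 𝓝 z₀, s z = 0 := by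
      intro h
      have h1 : ∀ᶠ z in 𝓝 z₀, z ∈ (Z : Set ℂ) := by
        filter_upwards [h, hsψ, hU.mem_nhds hz₀] with y h2 h3 h4
        exact hZ y h4 (by rw [h3, h2]; norm_num)
      exact (infinite_of_mem_nhds z₀ h1) Z.finite_toSet
    obtain ⟨n, t, ht, ht0, hst⟩ := hs.exists_eventuallyEq_pow_smul_nonzero_iff.2 hs0
    have hψt : ∀ᶠ z in 𝓝 z₀, ψ z = (z - z₀) ^ (2 * n) * t z ^ 2 := by
      filter_upwards [hsψ, hst] with y h1 h2
      rw [h1, h2, smul_eq_mul]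
      ring
    have hn : n ≠ 0 := by
      rintro rfl
      have := hψt.self_of_nhds
      rw [hψz] at this
      simp at this
      exact ht0 (pow_eq_zero_iff (by norm_num) |>.1 this.symm)
    classical
    set ψ₁ : ℂ → ℂ := Function.update (fun z => ψ z / (z - z₀) ^ (2 * n)) z₀ (t z₀ ^ 2) with hψ₁
    have hne : ∀ z, z ≠ z₀ → ψ₁ z = ψ z / (z - z₀) ^ (2 * n) := fun z hz =>
      Function.update_of_ne hz _ _
    have hnear : ψ₁ =ᶠ[𝓝 z₀] fun z => t z ^ 2 := by
      filter_upwards [hψt] with y hy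
      by_cases h : y = z₀
      · rw [h, hψ₁, Function.update_self]
      · rw [hne y h, hy, mul_comm, mul_div_assoc, div_self, mul_one]
        exact pow_ne_zero _ (sub_ne_zero.2 h)
    have hmul : ∀ z, z ∈ U → (z - z₀) ^ (2 * n) * ψ₁ z = ψ z := fun z _ => by
      by_cases h : z = z₀
      · rw [h, sub_self, zero_pow (by omega), zero_mul, hψz]
      · rw [hne z h, mul_div_cancel₀]
        exact pow_ne_zero _ (sub_ne_zero.2 h)
    have hfar : ∀ z, z ≠ z₀ → ψ₁ =ᶠ[𝓝 z] fun z => ψ z / (z - z₀) ^ (2 * n) := fun z hz => by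
      filter_upwards [isOpen_ne.mem_nhds hz] with y hy
      exact hne y hy
    obtain ⟨w, hw, hw2⟩ := ih (Z.erase z₀) (Finset.erase_ssubset (hZ z₀ hz₀ hψz)) ψ₁
      (fun z hz => by
        by_cases h : z = z₀
        · rw [h]
          exact (hnear.differentiableAt_iff.2 (ht.pow 2).differentiableAt).differentiableWithinAt
        · refine DifferentiableAt.differentiableWithinAt ((hfar z h).differentiableAt_iff.2 ?_)
          exact (hψ.differentiableAt (hU.mem_nhds hz)).div (by fun_prop)
            (pow_ne_zero _ (sub_ne_zero.2 h)))
      (fun z hz h0 => by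
        refine Finset.mem_erase.2 ⟨?_, hZ z hz ?_⟩
        · rintro rfl
          rw [hψ₁, Function.update_self] at h0
          exact ht0 (pow_eq_zero_iff (by norm_num) |>.1 h0)
        · rw [← hmul z hz, h0, mul_zero])
      (fun z hz h0 => by
        have h : z ≠ z₀ := by
          rintro rfl
          rw [hψ₁, Function.update_self] at h0
          exact ht0 (pow_eq_zero_iff (by norm_num) |>.1 h0)
        obtain ⟨σ, hσ, hσψ⟩ := hloc z hz (by rw [← hmul z hz, h0, mul_zero])
        refine ⟨fun y => σ y / (y - z₀) ^ n, hσ.div (by fun_prop)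
          (pow_ne_zero _ (sub_ne_zero.2 h)), ?_⟩
        filter_upwards [hσψ, hfar z h] with y h1 h2
        rw [h2, h1, div_pow, ← pow_mul, mul_comm n 2])
    refine ⟨fun z => (z - z₀) ^ n * w z, (by fun_prop : DifferentiableOn ℂ
      (fun z : ℂ => (z - z₀) ^ n) U).mul hw, fun z hz => ?_⟩
    rw [mul_pow, hw2 z hz, ← pow_mul, mul_comm n 2]
    exact hmul z hz

open Filter Topology in
theorem exists_analyticAt_sq_eq {χ : ℂ → ℂ} {z : ℂ} (h : AnalyticAt ℂ χ z) (h0 : χ z ≠ 0) :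
    ∃ s, AnalyticAt ℂ s z ∧ s z ≠ 0 ∧ ∀ᶠ y in 𝓝 z, χ y = s y ^ 2 := by
  obtain ⟨c, hc⟩ := IsSquare.exists_sq _ ((isSquare_iff_exists_sq _).2
    ⟨_, (Complex.cpow_nat_inv_pow (χ z) (n := 2) (by norm_num)).symm⟩)
  have hc0 : c ≠ 0 := by rintro rfl; simp at hc; exact h0 hc
  refine ⟨fun y => c * Complex.exp (Complex.log (χ y / χ z) / 2), ?_, ?_, ?_⟩
  · refine analyticAt_const.mul (AnalyticAt.cexp (AnalyticAt.div_const (AnalyticAt.clog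
      h.div_const ?_)))
    rw [div_self h0]
    exact Complex.one_mem_slitPlane
  · exact mul_ne_zero hc0 (Complex.exp_ne_zero _)
  · filter_upwards [h.continuousAt.eventually_ne h0] with y hy
    rw [mul_pow, ← Complex.exp_nat_mul, ← hc]
    push_cast
    rw [mul_div_cancel₀ _ (two_ne_zero), Complex.exp_log (div_ne_zero hy h0), mul_div_cancel₀ _ h0]

open Filter Topology in
theorem exists_sq_eq_of_mul_eq_sq {R R' : ℝ} (hR' : 0 < R') (hRR : R' < R) {ψ χ ω : ℂ → ℂ}
    (hψ : DifferentiableOn ℂ ψ (ball 0 R)) (hχ : DifferentiableOn ℂ χ (ball 0 R))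
    (hω : DifferentiableOn ℂ ω (ball 0 R)) (h : ∀ z ∈ ball (0 : ℂ) R, ψ z * χ z = ω z ^ 2)
    (hne : ∀ z ∈ ball (0 : ℂ) R, ψ z = 0 → χ z ≠ 0) :
    ∃ u : ℂ → ℂ, DifferentiableOn ℂ u (ball 0 R') ∧ ∀ z ∈ ball (0 : ℂ) R', u z ^ 2 = ψ z := by
  have hsub : ball (0 : ℂ) R' ⊆ ball 0 R := ball_subset_ball hRR.le
  have han : ∀ {ζ : ℂ → ℂ}, DifferentiableOn ℂ ζ (ball 0 R) → AnalyticOnNhd ℂ ζ (ball 0 R) :=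
    fun h => h.analyticOnNhd isOpen_ball
  by_cases hz : ∃ z ∈ ball (0 : ℂ) R, ∀ᶠ y in 𝓝 z, ψ y = 0
  · obtain ⟨z, hz, hev⟩ := hz
    have h1 := (han hψ).eqOn_zero_of_preconnected_of_eventuallyEq_zero
      (convex_ball (0 : ℂ) R).isPreconnected hz hev
    exact ⟨fun _ => 0, differentiableOn_const _, fun z hz => by
      rw [h1 (hsub hz)]; simp⟩
  push Not at hz
  have hfin : ({z | ψ z = 0} ∩ closedBall 0 R').Finite := by
    have hsubc : closedBall (0 : ℂ) R' ⊆ ball 0 R := closedBall_subset_ball hRR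
    by_contra hinf
    obtain ⟨x, hx, hacc⟩ := Set.Infinite.exists_accPt_of_subset_isCompact hinf
      (isCompact_closedBall (0 : ℂ) R') inter_subset_right
    rcases (han hψ x (hsubc hx)).eventually_eq_zero_or_eventually_ne_zero with h1 | h1
    · exact hz x (hsubc hx) (h1.mono fun y hy => not_not.2 hy)
    · rw [accPt_iff_frequently_nhdsNE] at hacc
      exact hacc (h1.mono fun y hy hy' => hy hy'.1)
  refine exists_sq_eq_of_locally isOpen_ball (noHole_ball hR')
    (convex_ball (0 : ℂ) R').isPreconnected hfin.toFinset ψ (hψ.mono hsub) (fun z hz h0 => ?_)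
    fun z hz h0 => ?_
  · exact hfin.mem_toFinset.2 ⟨h0, ball_subset_closedBall hz⟩
  · obtain ⟨s, hs, hs0, hsχ⟩ := exists_analyticAt_sq_eq (han hχ z (hsub hz)) (hne z (hsub hz) h0)
    refine ⟨fun y => ω y / s y, (han hω z (hsub hz)).div hs hs0, ?_⟩
    filter_upwards [hsχ, hs.continuousAt.eventually_ne hs0,
      isOpen_ball.mem_nhds (hsub hz)] with y h1 h2 h3
    rw [div_pow, eq_div_iff (pow_ne_zero 2 h2), ← h1, h y h3]

theorem exists_spinor {R R' : ℝ} (hR' : 0 < R') (hRR : R' < R) {D : Fin 3 → ℂ → ℂ}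
    (hD : ∀ i, DifferentiableOn ℂ (D i) (ball 0 R))
    (hnull : ∀ z ∈ ball (0 : ℂ) R, D 0 z ^ 2 + D 1 z ^ 2 + D 2 z ^ 2 = 0)
    (hne : ∀ z ∈ ball (0 : ℂ) R, ∃ i, D i z ≠ 0) :
    ∃ u v : ℂ → ℂ, DifferentiableOn ℂ u (ball 0 R') ∧ DifferentiableOn ℂ v (ball 0 R') ∧
      ∀ z ∈ ball (0 : ℂ) R', ∀ i, D i z = nul (u z) (v z) i := by
  have hsub : ball (0 : ℂ) R' ⊆ ball 0 R := ball_subset_ball hRR.le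
  set ψ : ℂ → ℂ := fun z => (D 0 z - Complex.I * D 1 z) / 2
  set χ : ℂ → ℂ := fun z => -(D 0 z + Complex.I * D 1 z) / 2
  set ω : ℂ → ℂ := fun z => D 2 z / 2
  have hψ : DifferentiableOn ℂ ψ (ball 0 R) :=
    ((hD 0).sub ((hD 1).const_mul _)).div_const _
  have hχ : DifferentiableOn ℂ χ (ball 0 R) :=
    (((hD 0).add ((hD 1).const_mul _)).neg).div_const _
  have hω : DifferentiableOn ℂ ω (ball 0 R) := (hD 2).div_const _
  have hprod : ∀ z ∈ ball (0 : ℂ) R, ψ z * χ z = ω z ^ 2 := fun z hz => by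
    have h1 := hnull z hz
    simp only [ψ, χ, ω]
    linear_combination (-1 / 4) * h1 + (1 / 4) * D 1 z ^ 2 * Complex.I_sq
  have hcommon : ∀ z ∈ ball (0 : ℂ) R, ψ z = 0 → χ z ≠ 0 := fun z hz h1 h2 => by
    obtain ⟨i, hi⟩ := hne z hz
    have h3 := hprod z hz
    rw [h1, zero_mul] at h3
    have h4 : ω z = 0 := pow_eq_zero_iff (by norm_num) |>.1 h3.symm
    simp only [ψ, χ, ω] at h1 h2 h4
    have h0 : D 0 z = 0 := by linear_combination h1 - h2
    have h5 : Complex.I * D 1 z = 0 := by linear_combination -h1 - h2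
    have h6 : D 1 z = 0 := (mul_eq_zero.1 h5).resolve_left Complex.I_ne_zero
    have h7 : D 2 z = 0 := by linear_combination 2 * h4
    fin_cases i
    · exact hi h0
    · exact hi h6
    · exact hi h7
  obtain ⟨u, hu, hu2⟩ := exists_sq_eq_of_mul_eq_sq hR' hRR hψ hχ hω hprod hcommon
  obtain ⟨v, hv, hv2⟩ := exists_sq_eq_of_mul_eq_sq hR' hRR hχ hψ hω
    (fun z hz => by rw [mul_comm, hprod z hz]) (fun z hz h1 h2 => hcommon z hz h2 h1)
  have hfin : ∀ w : ℂ → ℂ, (∀ z ∈ ball (0 : ℂ) R', w z ^ 2 = χ z) →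
      (∀ z ∈ ball (0 : ℂ) R', u z * w z = ω z) →
      ∀ z ∈ ball (0 : ℂ) R', ∀ i, D i z = nul (u z) (w z) i := by
    intro w hw hm z hz i
    have h1 := hu2 z hz
    have h2 := hw z hz
    have h3 := hm z hz
    simp only [ψ, χ, ω] at h1 h2 h3
    fin_cases i
    · simp only [Fin.zero_eta, nul_apply_zero]
      linear_combination -h1 + h2
    · simp only [Fin.mk_one, nul_apply_one]
      linear_combination -Complex.I * h1 - Complex.I * h2 + D 1 z * (Complex.I_sq)
    · simp only [Fin.reduceFinMk, nul_apply_two]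
      linear_combination -2 * h3
  have hdich := AnalyticOnNhd.eq_zero_or_eq_zero_of_mul_eq_zero
    (f := fun z => u z * v z - ω z) (g := fun z => u z * v z + ω z) (U := ball (0 : ℂ) R')
    (((hu.mul hv).sub (hω.mono hsub)).analyticOnNhd isOpen_ball)
    (((hu.mul hv).add (hω.mono hsub)).analyticOnNhd isOpen_ball)
    (fun z hz => by
      have h1 := hprod z (hsub hz)
      rw [← hu2 z hz, ← hv2 z hz] at h1
      linear_combination h1) (convex_ball (0 : ℂ) R').isPreconnected
  rcases hdich with hd | hd
  · exact ⟨u, v, hu, hv, hfin v hv2 fun z hz => sub_eq_zero.1 (hd z hz)⟩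
  · refine ⟨u, fun z => -v z, hu, hv.neg, hfin _ (fun z hz => by rw [neg_sq]; exact hv2 z hz) ?_⟩
    intro z hz
    have := hd z hz
    linear_combination -this

/-- Spinor data on a disc of radius larger than one. -/
structure Surf where
  R : ℝ
  hR : 1 < R
  u : ℂ → ℂ
  v : ℂ → ℂ
  hu : DifferentiableOn ℂ u (ball 0 R)
  hv : DifferentiableOn ℂ v (ball 0 R)

namespace Surf

theorem differentiableOn_nul (S : Surf) (i : Fin 3) :
    DifferentiableOn ℂ (fun z => nul (S.u z) (S.v z) i) (ball 0 S.R) := by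
  have hu := S.hu
  have hv := S.hv
  fin_cases i
  · exact (hu.pow 2).sub (hv.pow 2)
  · exact ((hu.pow 2).add (hv.pow 2)).const_mul _
  · exact (hu.const_mul 2).mul hv

theorem exists_H (S : Surf) (i : Fin 3) : ∃ H : ℂ → ℂ,
    (∀ z ∈ ball (0 : ℂ) S.R, HasDerivAt H (nul (S.u z) (S.v z) i) z) ∧ H 0 = 0 := by
  have hR : 0 < S.R := one_pos.trans S.hR
  obtain ⟨H, hH⟩ := (noHole_ball hR).exists_primitive isOpen_ball
    (convex_ball (0 : ℂ) S.R).isPreconnected (S.differentiableOn_nul i)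
  exact ⟨fun z => H z - H 0, fun z hz => (hH z hz).sub_const _, sub_self _⟩

/-- The null curve of spinor data, normalized to vanish at the origin. -/
def H (S : Surf) (i : Fin 3) : ℂ → ℂ := (S.exists_H i).choose

theorem hasDerivAt_H (S : Surf) (i : Fin 3) {z : ℂ} (hz : z ∈ ball (0 : ℂ) S.R) :
    HasDerivAt (S.H i) (nul (S.u z) (S.v z) i) z := (S.exists_H i).choose_spec.1 z hz

@[simp] theorem H_zero (S : Surf) (i : Fin 3) : S.H i 0 = 0 := (S.exists_H i).choose_spec.2

/-- The minimal surface of spinor data. -/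
def X (S : Surf) (z : ℂ) : R3 := reV fun i => S.H i z

/-- The conformal factor of the induced metric. -/
def mu (S : Surf) (z : ℂ) : ℝ := ‖S.u z‖ ^ 2 + ‖S.v z‖ ^ 2

theorem eqOn_H (S : Surf) {i : Fin 3} {G : ℂ → ℂ} {r : ℝ} (hr : 0 < r) (hrR : r ≤ S.R)
    (hG : ∀ z ∈ ball (0 : ℂ) r, HasDerivAt G (nul (S.u z) (S.v z) i) z) (hG0 : G 0 = 0) :
    EqOn G (S.H i) (ball 0 r) := by
  have hsub : ball (0 : ℂ) r ⊆ ball 0 S.R := ball_subset_ball hrR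
  have := isOpen_ball.eqOn_of_deriv_eq (𝕜 := ℂ) (f := G) (g := S.H i) (s := ball (0 : ℂ) r)
    (convex_ball (0 : ℂ) r).isPreconnected
    (fun z hz => (hG z hz).differentiableAt.differentiableWithinAt)
    (fun z hz => (S.hasDerivAt_H i (hsub hz)).differentiableAt.differentiableWithinAt)
    (fun z hz => by rw [(hG z hz).deriv, (S.hasDerivAt_H i (hsub hz)).deriv])
    (mem_ball_self hr) (by rw [hG0, H_zero])
  exact this

theorem closedBall_subset (S : Surf) : closedBall (0 : ℂ) 1 ⊆ ball 0 S.R :=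
  closedBall_subset_ball S.hR

@[simp] theorem X_zero (S : Surf) : S.X 0 = 0 := by
  ext i; simp [X]

theorem continuousOn_X (S : Surf) : ContinuousOn S.X (ball 0 S.R) := fun _ hz =>
  (hasFDerivAt_reV fun i => S.hasDerivAt_H i hz).continuousAt.continuousWithinAt

theorem continuousOn_mu (S : Surf) : ContinuousOn S.mu (ball 0 S.R) :=
  ((S.hu.continuousOn.norm).pow 2).add ((S.hv.continuousOn.norm).pow 2)

theorem mu_nonneg (S : Surf) (z : ℂ) : 0 ≤ S.mu z := by unfold mu; positivity

end Surf

/-- A conformal minimal immersion pulled back to a slightly larger disc comes from spinors. -/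
theorem ConfMinImmOn.exists_surf {U : Set ℂ} (hU : IsOpen U) {X : ℂ → R3}
    (hX : ConfMinImmOn X U) {f : ℂ → ℂ} {R : ℝ} (hR : 1 < R)
    (hf : DifferentiableOn ℂ f (ball 0 R))
    (hfU : MapsTo f (ball 0 R) U) (hf' : ∀ z ∈ ball (0 : ℂ) R, deriv f z ≠ 0)
    (hX0 : X (f 0) = 0) :
    ∃ S : Surf, S.R < R ∧ ∀ z ∈ ball (0 : ℂ) S.R, S.X z = X (f z) := by
  obtain ⟨H, D, hH, hD, hH0, hXH, hnull, hne⟩ :=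
    hX.exists_null hU (one_pos.trans hR) hf hfU hf' hX0
  obtain ⟨R', h1R, hRR⟩ := exists_between hR
  obtain ⟨u, v, hu, hv, huv⟩ := exists_spinor (one_pos.trans h1R) hRR hD hnull hne
  have hsub : ball (0 : ℂ) R' ⊆ ball 0 R := ball_subset_ball hRR.le
  refine ⟨⟨R', h1R, u, v, hu, hv⟩, hRR, fun z hz => ?_⟩
  rw [hXH z (hsub hz), Surf.X]
  congr 1
  ext i
  refine (Surf.eqOn_H ⟨R', h1R, u, v, hu, hv⟩ (one_pos.trans h1R) le_rfl (fun z hz => ?_)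
    (hH0 i) hz).symm
  rw [← huv z hz i]
  exact hH i z (hsub hz)

/-- Charts of a disc turn immersed spinor surfaces into conformal minimal immersions. -/
theorem Surf.confMinImmOn_comp (S : Surf) {V : Set ℂ} (hV : IsOpen V) {k : ℂ → ℂ}
    (hk : DifferentiableOn ℂ k V) (hkm : MapsTo k V (ball 0 S.R))
    (hk' : ∀ z ∈ V, deriv k z ≠ 0) (hne : ∀ z ∈ V, S.u (k z) ≠ 0 ∨ S.v (k z) ≠ 0) :
    ConfMinImmOn (fun z => S.X (k z)) V := by
  refine confMinImmOn_reV hV (H := fun i z => S.H i (k z))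
    (D := fun z i => deriv k z * nul (S.u (k z)) (S.v (k z)) i) (fun z hz i => ?_) fun z hz => ?_
  · refine ((S.hasDerivAt_H i (hkm hz)).comp z
      (hk.differentiableAt (hV.mem_nhds hz)).hasDerivAt).congr_deriv ?_
    rw [mul_comm]
  · exact ⟨deriv k z, _, _, hk' z hz, hne z hz, fun i => rfl⟩

/-- A primitive of `z ^ n * P z` with `P` bounded is small for large `n`. -/
theorem norm_le_of_hasDerivAt_pow_mul {G P : ℂ → ℂ} {n : ℕ} {C : ℝ} (hG0 : G 0 = 0)
    (hG : ∀ z ∈ closedBall (0 : ℂ) 1, HasDerivAt G (z ^ n * P z) z)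
    (hP : ∀ z ∈ closedBall (0 : ℂ) 1, ‖P z‖ ≤ C) {z : ℂ} (hz : z ∈ closedBall (0 : ℂ) 1) :
    ‖G z‖ ≤ C / (n + 1) := by
  have hz1 : ‖z‖ ≤ 1 := by simpa using hz
  have hC : 0 ≤ C := (norm_nonneg _).trans (hP 0 (by simp))
  have hmem : ∀ t ∈ Icc (0 : ℝ) 1, (t : ℂ) * z ∈ closedBall (0 : ℂ) 1 := fun t ht => by
    rw [mem_closedBall_zero_iff, norm_mul, Complex.norm_real, Real.norm_of_nonneg ht.1]
    exact mul_le_one₀ ht.2 (norm_nonneg _) hz1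
  have hd : ∀ t ∈ Icc (0 : ℝ) 1, HasDerivAt (fun t : ℝ => G (t * z))
      (((t : ℂ) * z) ^ n * P (t * z) * z) t := fun t ht => by
    have h1 : HasDerivAt (fun t : ℝ => (t : ℂ) * z) (1 * z) t :=
      (HasDerivAt.ofReal_comp (hasDerivAt_id t)).mul_const z
    rw [one_mul] at h1
    exact (hG _ (hmem t ht)).comp t h1
  have hB : ∀ t : ℝ, HasDerivAt (fun t : ℝ => C * (t ^ (n + 1) / (n + 1))) (C * t ^ n) t :=
    fun t => by
      refine (((hasDerivAt_pow (n + 1) t).div_const _).const_mul C).congr_deriv ?_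
      push_cast
      field_simp
  have := image_norm_le_of_norm_deriv_right_le_deriv_boundary (a := (0 : ℝ)) (b := 1)
    (f := fun t : ℝ => G (t * z)) (B := fun t : ℝ => C * (t ^ (n + 1) / (n + 1)))
    (f' := fun t : ℝ => ((t : ℂ) * z) ^ n * P (t * z) * z) (B' := fun t : ℝ => C * t ^ n)
    (fun t ht => (hd t ht).continuousAt.continuousWithinAt)
    (fun t ht => (hd t ⟨ht.1, ht.2.le⟩).hasDerivWithinAt) (by simp [hG0]) hB
    (fun t ht => by
      rw [norm_mul, norm_mul, norm_pow, norm_mul, Complex.norm_real, Real.norm_of_nonneg ht.1]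
      have h1 := hP _ (hmem t ⟨ht.1, ht.2.le⟩)
      have h2 : (t * ‖z‖) ^ n ≤ t ^ n :=
        pow_le_pow_left₀ (mul_nonneg ht.1 (norm_nonneg _)) (mul_le_of_le_one_right ht.1 hz1) n
      calc (t * ‖z‖) ^ n * ‖P (t * z)‖ * ‖z‖ ≤ t ^ n * C * 1 := by
            have := pow_nonneg ht.1 n
            gcongr
        _ = C * t ^ n := by ring) (x := 1) (by simp)
  simpa [div_eq_mul_inv] using this

theorem reV_sub (w w' : Fin 3 → ℂ) : reV w - reV w' = reV fun i => w i - w' i := by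
  ext i; simp

theorem norm_nul_add_sub_le {a b c d : ℂ} {K δ : ℝ} (ha : ‖a‖ ≤ K) (hb : ‖b‖ ≤ K)
    (hc : ‖c‖ ≤ δ) (hd : ‖d‖ ≤ δ) (i : Fin 3) :
    ‖nul (a + c) (b + d) i - nul a b i‖ ≤ 4 * K * δ + 2 * δ ^ 2 := by
  have hK : 0 ≤ K := (norm_nonneg _).trans ha
  have hδ : 0 ≤ δ := (norm_nonneg _).trans hc
  have e : ∀ {x y : ℂ} {p q : ℝ}, ‖x‖ ≤ p → ‖y‖ ≤ q → ‖x * y‖ ≤ p * q := fun hx hy => by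
    rw [norm_mul]
    exact mul_le_mul hx hy (norm_nonneg _) ((norm_nonneg _).trans hx)
  have h2 : ‖(2 : ℂ)‖ ≤ 2 := by simp
  have hI : ‖Complex.I‖ ≤ 1 := by simp
  have q : ∀ {x y : ℂ}, ‖x‖ ≤ K → ‖y‖ ≤ δ → ‖2 * (x * y) + y * y‖ ≤ 2 * (K * δ) + δ * δ :=
    fun hx hy => (norm_add_le _ _).trans (add_le_add (e h2 (e hx hy)) (e hy hy))
  fin_cases i
  · have : nul (a + c) (b + d) 0 - nul a b 0 = (2 * (a * c) + c * c) - (2 * (b * d) + d * d) := by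
      simp only [nul_apply_zero]; ring
    simp only [Fin.zero_eta, this]
    linarith [norm_sub_le (2 * (a * c) + c * c) (2 * (b * d) + d * d), q ha hc, q hb hd]
  · have : nul (a + c) (b + d) 1 - nul a b 1 =
        Complex.I * ((2 * (a * c) + c * c) + (2 * (b * d) + d * d)) := by
      simp only [nul_apply_one]; ring
    simp only [Fin.mk_one, this, norm_mul, Complex.norm_I, one_mul]
    linarith [norm_add_le (2 * (a * c) + c * c) (2 * (b * d) + d * d), q ha hc, q hb hd]
  · have : nul (a + c) (b + d) 2 - nul a b 2 = 2 * (a * d + b * c + c * d) := by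
      simp only [nul_apply_two]; ring
    simp only [Fin.reduceFinMk, this, norm_mul, Complex.norm_ofNat]
    linarith [norm_add_le (a * d + b * c) (c * d), norm_add_le (a * d) (b * c), e ha hd, e hb hc,
      e hc hd]

namespace Surf

theorem exists_norm_le (S : Surf) : ∃ K : ℝ, 0 < K ∧ ∀ z ∈ closedBall (0 : ℂ) 1,
    ‖S.u z‖ ≤ K ∧ ‖S.v z‖ ≤ K := by
  obtain ⟨K₁, h1⟩ := (isCompact_closedBall (0 : ℂ) 1).exists_bound_of_continuousOn
    (S.hu.continuousOn.mono S.closedBall_subset)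
  obtain ⟨K₂, h2⟩ := (isCompact_closedBall (0 : ℂ) 1).exists_bound_of_continuousOn
    (S.hv.continuousOn.mono S.closedBall_subset)
  exact ⟨max 1 (max K₁ K₂), by positivity, fun z hz =>
    ⟨(h1 z hz).trans ((le_max_left _ _).trans (le_max_right _ _)),
      (h2 z hz).trans ((le_max_right _ _).trans (le_max_right _ _))⟩⟩

theorem exists_ne_zero_near (S : Surf) {e : ℝ} (he : 0 < e) : ∃ S' : Surf, S'.R = S.R ∧
    (∀ z ∈ ball (0 : ℂ) S'.R, S'.u z ≠ 0 ∨ S'.v z ≠ 0) ∧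
    ∀ z ∈ closedBall (0 : ℂ) 1, ‖S'.X z - S.X z‖ ≤ e ∧ S.mu z - e ≤ S'.mu z := by
  obtain ⟨K, hK, hKb⟩ := S.exists_norm_le
  set δ : ℝ := min 1 (e / (2 * (4 * K + 2))) with hδ
  have hδ0 : 0 < δ := lt_min one_pos (by positivity)
  have hδ1 : δ ≤ 1 := min_le_left _ _
  have hδe : (4 * K + 2) * δ ≤ e / 2 := by
    have := min_le_right 1 (e / (2 * (4 * K + 2)))
    rw [← hδ, le_div_iff₀ (by positivity)] at this
    linarith
  have hcd : ContDiffOn ℝ 1 (fun z => (S.u z, S.v z)) (ball 0 S.R) :=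
    ((S.hu.contDiffOn isOpen_ball).restrict_scalars ℝ).prodMk
      ((S.hv.contDiffOn isOpen_ball).restrict_scalars ℝ)
  have hdense := hcd.dense_compl_image_of_dimH_lt_finrank (convex_ball (0 : ℂ) S.R) Subset.rfl (by
    refine (dimH_mono (subset_univ _)).trans_lt ?_
    rw [Real.dimH_univ_eq_finrank, Module.finrank_prod, Complex.finrank_real_complex]
    norm_num)
  obtain ⟨⟨c, d⟩, hcd', hnot⟩ := hdense.exists_dist_lt 0 hδ0
  rw [dist_zero_left, Prod.norm_def, max_lt_iff] at hnot
  have hc : ‖-c‖ ≤ δ := by rw [norm_neg]; exact hnot.1.le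
  have hd : ‖-d‖ ≤ δ := by rw [norm_neg]; exact hnot.2.le
  set S' : Surf := ⟨S.R, S.hR, fun z => S.u z + -c, fun z => S.v z + -d, S.hu.add_const _,
    S.hv.add_const _⟩ with hS'
  refine ⟨S', rfl, fun z hz => ?_, fun z hz => ⟨?_, ?_⟩⟩
  · by_contra! h
    refine hcd' ⟨z, hz, ?_⟩
    have h1 : S.u z + -c = 0 := h.1
    have h2 : S.v z + -d = 0 := h.2
    exact Prod.ext (add_neg_eq_zero.1 h1) (add_neg_eq_zero.1 h2)
  · have hδδ : 4 * K * δ + 2 * δ ^ 2 ≤ e / 2 := by nlinarith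
    rw [X, X, reV_sub]
    have := norm_reV_le (r := e / 2) (by positivity) (w := fun i => S'.H i z - S.H i z) fun i => by
      have := norm_le_of_hasDerivAt_pow_mul (n := 0) (G := fun z => S'.H i z - S.H i z)
        (P := fun z => nul (S'.u z) (S'.v z) i - nul (S.u z) (S.v z) i) (C := e / 2) (by simp)
        (fun z hz => ((S'.hasDerivAt_H i (S'.closedBall_subset hz)).sub
          (S.hasDerivAt_H i (S.closedBall_subset hz))).congr_deriv (by simp))
        (fun z hz => (norm_nul_add_sub_le (hKb z hz).1 (hKb z hz).2 hc hd i).trans hδδ) hz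
      simpa using this
    linarith
  · have h1 : ∀ x y : ℂ, ‖x‖ ≤ K → ‖y‖ ≤ δ → ‖x‖ ^ 2 - 2 * K * δ ≤ ‖x + y‖ ^ 2 := by
      intro x y hx hy
      have h2 : ‖x‖ ≤ ‖x + y‖ + ‖y‖ := by
        have := norm_sub_le (x + y) y
        rwa [add_sub_cancel_right] at this
      by_cases h3 : ‖x‖ ≤ δ
      · nlinarith [sq_nonneg ‖x + y‖, norm_nonneg x]
      · nlinarith [norm_nonneg x, norm_nonneg (x + y), norm_nonneg y, sq_nonneg (‖x + y‖ - ‖x‖)]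
    have h2 := h1 _ _ (hKb z hz).1 hc
    have h3 := h1 _ _ (hKb z hz).2 hd
    simp only [mu, hS']
    nlinarith

end Surf

open Filter Topology in
theorem tendsto_sqrt_div_atTop (C C' : ℝ) :
    Tendsto (fun k : ℕ => (√(2 * k + 1) * C + C') / ((k : ℝ) + 1)) atTop (𝓝 0) := by
  have h1 : Tendsto (fun k : ℕ => √((k : ℝ) + 1)) atTop atTop :=
    Real.tendsto_sqrt_atTop.comp
      (tendsto_atTop_add_const_right _ _ tendsto_natCast_atTop_atTop)
  have h2 : Tendsto (fun k : ℕ => (2 * |C| + |C'|) * (√((k : ℝ) + 1))⁻¹) atTop (𝓝 0) := by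
    simpa using (tendsto_inv_atTop_zero.comp h1).const_mul (2 * |C| + |C'|)
  refine squeeze_zero_norm (fun k => ?_) h2
  have hk : (0 : ℝ) ≤ k := k.cast_nonneg
  have hs : √((k : ℝ) + 1) * √((k : ℝ) + 1) = k + 1 := Real.mul_self_sqrt (by positivity)
  have hs1 : 1 ≤ √((k : ℝ) + 1) := Real.one_le_sqrt.2 (by linarith)
  have hs2 : √(2 * k + 1) ≤ 2 * √((k : ℝ) + 1) := by
    refine Real.sqrt_le_iff.2 ⟨by positivity, ?_⟩
    rw [mul_pow, Real.sq_sqrt (by positivity)]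
    linarith
  rw [Real.norm_eq_abs, abs_div, abs_of_pos (by positivity : (0 : ℝ) < k + 1), ← div_eq_mul_inv,
    div_le_div_iff₀ (by positivity) (by positivity)]
  have h3 : |√(2 * k + 1) * C + C'| ≤ 2 * √((k : ℝ) + 1) * |C| + √((k : ℝ) + 1) * |C'| := by
    refine (abs_add_le _ _).trans (add_le_add ?_ ?_)
    · rw [abs_mul, abs_of_nonneg (Real.sqrt_nonneg _)]
      gcongr
    · nlinarith [abs_nonneg C']
  calc _ ≤ (2 * √((k : ℝ) + 1) * |C| + √((k : ℝ) + 1) * |C'|) * √((k : ℝ) + 1) := by gcongr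
    _ = (2 * |C| + |C'|) * (√((k : ℝ) + 1) * √((k : ℝ) + 1)) := by ring
    _ = _ := by rw [hs]

open Filter Topology in
theorem tendsto_sqrt_mul_pow {q : ℝ} (h0 : 0 ≤ q) (h1 : q < 1) :
    Tendsto (fun k : ℕ => √(2 * k + 1) * q ^ k) atTop (𝓝 0) := by
  have h2 : Tendsto (fun k : ℕ => 2 * ((k : ℝ) * q ^ k) + q ^ k) atTop (𝓝 0) := by
    simpa using ((tendsto_self_mul_const_pow_of_lt_one h0 h1).const_mul 2).add
      (tendsto_pow_atTop_nhds_zero_of_lt_one h0 h1)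
  refine squeeze_zero (fun k => by positivity) (fun k => ?_) h2
  have hk : (0 : ℝ) ≤ k := k.cast_nonneg
  have h3 : √(2 * (k : ℝ) + 1) ≤ 2 * k + 1 := Real.sqrt_le_iff.2 ⟨by positivity, by nlinarith⟩
  have := pow_nonneg h0 k
  nlinarith

/-- The polarization of the quadratic map `nul`. -/
def nulPol (a b c d : ℂ) : Fin 3 → ℂ :=
  ![2 * (a * c - b * d), 2 * (Complex.I * (a * c + b * d)), 2 * (a * d + b * c)]

theorem nul_add_mul (a b c d l : ℂ) (i : Fin 3) :
    nul (a + l * c) (b + l * d) i = nul a b i + l * nulPol a b c d i + l ^ 2 * nul c d i := by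
  fin_cases i <;> simp [nulPol, nul] <;> ring

theorem norm_nulPol_le {a b c d : ℂ} {K L : ℝ} (ha : ‖a‖ ≤ K) (hb : ‖b‖ ≤ K) (hc : ‖c‖ ≤ L)
    (hd : ‖d‖ ≤ L) (i : Fin 3) : ‖nulPol a b c d i‖ ≤ 4 * (K * L) := by
  have e : ∀ {x y : ℂ}, ‖x‖ ≤ K → ‖y‖ ≤ L → ‖x * y‖ ≤ K * L := fun hx hy => by
    rw [norm_mul]
    exact mul_le_mul hx hy (norm_nonneg _) ((norm_nonneg _).trans hx)
  have e' : ∀ {x y : ℂ}, ‖x‖ ≤ K * L → ‖y‖ ≤ K * L → ‖x + y‖ ≤ 2 * (K * L) ∧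
      ‖x - y‖ ≤ 2 * (K * L) := fun {x y} hx hy =>
    ⟨by linarith [norm_add_le x y], by linarith [norm_sub_le x y]⟩
  fin_cases i
  · simp only [nulPol, Fin.zero_eta, Matrix.cons_val_zero, norm_mul, Complex.norm_ofNat]
    linarith [(e' (e ha hc) (e hb hd)).2]
  · simp only [nulPol, Fin.mk_one, Matrix.cons_val_one, norm_mul, Complex.norm_ofNat,
      Complex.norm_I, one_mul, Matrix.cons_val_zero]
    linarith [(e' (e ha hc) (e hb hd)).1]
  · simp only [nulPol, Fin.reduceFinMk, Matrix.cons_val, norm_mul, Complex.norm_ofNat]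
    linarith [(e' (e ha hd) (e hb hc)).1]

theorem differentiable_nul {A B : ℂ → ℂ} (hA : Differentiable ℂ A) (hB : Differentiable ℂ B)
    (i : Fin 3) : Differentiable ℂ fun z => nul (A z) (B z) i := by
  fin_cases i
  · exact (hA.pow 2).sub (hB.pow 2)
  · exact ((hA.pow 2).add (hB.pow 2)).const_mul _
  · exact (hA.const_mul 2).mul hB

namespace Surf

/-- High-frequency spinor perturbation. -/
def osc (S : Surf) {A B : ℂ → ℂ} (hA : Differentiable ℂ A) (hB : Differentiable ℂ B) (k : ℕ) :
    Surf where
  R := S.R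
  hR := S.hR
  u := fun z => S.u z + ((√(2 * k + 1) : ℝ) * z ^ k) * A z
  v := fun z => S.v z + ((√(2 * k + 1) : ℝ) * z ^ k) * B z
  hu := S.hu.add (Differentiable.differentiableOn (by fun_prop))
  hv := S.hv.add (Differentiable.differentiableOn (by fun_prop))

open Filter Topology in
theorem eventually_osc (S : Surf) {A B : ℂ → ℂ} (hA : Differentiable ℂ A)
    (hB : Differentiable ℂ B) {e : ℝ} (he : 0 < e) :
    ∀ᶠ k : ℕ in atTop, ∀ z ∈ closedBall (0 : ℂ) 1, ∀ i,
      ‖(S.osc hA hB k).H i z - S.H i z - z ^ (2 * k + 1) * nul (A z) (B z) i‖ ≤ e := by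
  obtain ⟨K, hK, hKb⟩ := S.exists_norm_le
  have hbd : ∀ {f : ℂ → ℂ}, Continuous f → ∃ L : ℝ, ∀ z ∈ closedBall (0 : ℂ) 1, ‖f z‖ ≤ L :=
    fun hf => (isCompact_closedBall (0 : ℂ) 1).exists_bound_of_continuousOn hf.continuousOn
  obtain ⟨L₁, hL₁⟩ := hbd hA.continuous
  obtain ⟨L₂, hL₂⟩ := hbd hB.continuous
  have hder : ∀ i, ∃ L : ℝ, ∀ z ∈ closedBall (0 : ℂ) 1,
      ‖deriv (fun z => nul (A z) (B z) i) z‖ ≤ L := fun i => by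
    refine hbd ?_
    exact ((differentiable_nul hA hB i).contDiff (n := 1)).continuous_deriv le_rfl
  choose L' hL' using hder
  set L := max L₁ L₂
  set M := ∑ i, |L' i|
  have hev := (tendsto_sqrt_div_atTop (4 * (K * L)) M).eventually_lt_const he
  filter_upwards [hev] with k hk z hz i
  refine le_trans ?_ hk.le
  have hs : ((√(2 * k + 1) : ℝ) : ℂ) ^ 2 = 2 * k + 1 := by
    rw [← Complex.ofReal_pow, Real.sq_sqrt (by positivity)]
    push_cast
    rfl
  refine norm_le_of_hasDerivAt_pow_mul (n := k)
    (G := fun z => (S.osc hA hB k).H i z - S.H i z - z ^ (2 * k + 1) * nul (A z) (B z) i)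
    (P := fun z => (√(2 * k + 1) : ℝ) * nulPol (S.u z) (S.v z) (A z) (B z) i -
      z ^ (k + 1) * deriv (fun z => nul (A z) (B z) i) z) (by simp) (fun z hz => ?_)
    (fun z hz => ?_) hz
  · refine (((((S.osc hA hB k).hasDerivAt_H i (S.closedBall_subset hz)).sub
      (S.hasDerivAt_H i (S.closedBall_subset hz)))).sub ((hasDerivAt_pow (2 * k + 1) z).mul
      (differentiable_nul hA hB i z).hasDerivAt)).congr_deriv ?_
    simp only [osc, nul_add_mul, mul_pow, hs]
    push_cast
    ring_nf
  · have hz1 : ‖z‖ ≤ 1 := by simpa using hz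
    refine (norm_sub_le _ _).trans (add_le_add ?_ ?_)
    · rw [norm_mul, Complex.norm_real, Real.norm_of_nonneg (Real.sqrt_nonneg _)]
      gcongr
      exact norm_nulPol_le (hKb z hz).1 (hKb z hz).2 ((hL₁ z hz).trans (le_max_left _ _))
        ((hL₂ z hz).trans (le_max_right _ _)) i
    · rw [norm_mul, norm_pow]
      calc ‖z‖ ^ (k + 1) * _ ≤ 1 * |L' i| := by
            gcongr
            · exact pow_le_one₀ (norm_nonneg _) hz1
            · exact (hL' i z hz).trans (le_abs_self _)
        _ ≤ M := by
            rw [one_mul]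
            exact Finset.single_le_sum (f := fun i => |L' i|) (fun _ _ => abs_nonneg _)
              (Finset.mem_univ i)

end Surf

open Filter Topology in
/-- Uniform Laurent approximation of continuous functions on the unit circle. -/
theorem exists_laurent_near {h : ℂ → ℂ} (hh : ContinuousOn h (sphere 0 1)) {δ : ℝ}
    (hδ : 0 < δ) : ∃ p₀ : ℕ, ∀ p, p₀ ≤ p → ∃ A : ℂ → ℂ, Differentiable ℂ A ∧
      ∀ w ∈ sphere (0 : ℂ) 1, ‖A w - w ^ p * h w‖ ≤ δ := by
  have : Fact ((0 : ℝ) < 1) := ⟨one_pos⟩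
  have hmem : ∀ x : AddCircle (1 : ℝ), (x.toCircle : ℂ) ∈ sphere (0 : ℂ) 1 := fun x => by
    rw [mem_sphere_zero_iff_norm]
    exact Circle.norm_coe _
  set g : C(AddCircle (1 : ℝ), ℂ) := ⟨fun x => h x.toCircle, hh.comp_continuous
    (by fun_prop) hmem⟩ with hg
  have hcl : g ∈
      closure (Submodule.span ℂ (Set.range (@fourier 1)) : Set C(AddCircle (1 : ℝ), ℂ)) := by
    rw [← Submodule.topologicalClosure_coe, span_fourier_closure_eq_top]
    trivial
  obtain ⟨f, hf, hfg⟩ := Metric.mem_closure_iff.1 hcl δ hδ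
  have key : ∃ p₀ : ℕ, ∀ p, p₀ ≤ p → ∃ A : ℂ → ℂ, Differentiable ℂ A ∧
      ∀ x : AddCircle (1 : ℝ), A x.toCircle = (x.toCircle : ℂ) ^ p * f x := by
    refine Submodule.span_induction (p := fun f _ => ∃ p₀ : ℕ, ∀ p, p₀ ≤ p →
      ∃ A : ℂ → ℂ, Differentiable ℂ A ∧
        ∀ x : AddCircle (1 : ℝ), A x.toCircle = (x.toCircle : ℂ) ^ p * f x) ?_ ?_ ?_ ?_ hf
    · rintro _ ⟨n, rfl⟩
      refine ⟨n.natAbs, fun p hp => ⟨fun z => z ^ (p + n).toNat, by fun_prop, fun x => ?_⟩⟩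
      rw [fourier_apply, AddCircle.toCircle_zsmul, Circle.coe_zpow,
        ← zpow_natCast (x.toCircle : ℂ) p,
        ← zpow_add₀ (Circle.coe_ne_zero _)]
      dsimp only
      rw [← zpow_natCast (x.toCircle : ℂ), Int.toNat_of_nonneg (by omega)]
    · exact ⟨0, fun p _ => ⟨fun _ => 0, by fun_prop, by simp⟩⟩
    · rintro f₁ f₂ - - ⟨p₁, h1⟩ ⟨p₂, h2⟩
      refine ⟨max p₁ p₂, fun p hp => ?_⟩
      obtain ⟨A, hA, hA'⟩ := h1 p ((le_max_left _ _).trans hp)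
      obtain ⟨B, hB, hB'⟩ := h2 p ((le_max_right _ _).trans hp)
      exact ⟨_, hA.add hB, fun x => by
        rw [Pi.add_apply, hA', hB', ContinuousMap.add_apply, mul_add]⟩
    · rintro c f₁ - ⟨p₁, h1⟩
      refine ⟨p₁, fun p hp => ?_⟩
      obtain ⟨A, hA, hA'⟩ := h1 p hp
      refine ⟨_, hA.const_mul c, fun x => ?_⟩
      rw [hA', ContinuousMap.smul_apply, smul_eq_mul]
      ring
  obtain ⟨p₀, hp₀⟩ := key
  refine ⟨p₀, fun p hp => ?_⟩
  obtain ⟨A, hA, hA'⟩ := hp₀ p hp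
  refine ⟨A, hA, fun w hw => ?_⟩
  have hw1 : ‖w‖ = 1 := by simpa using hw
  obtain ⟨x, hx⟩ := (AddCircle.homeomorphCircle (one_ne_zero (α := ℝ))).surjective
    ⟨w, mem_sphere_zero_iff_norm.2 hw1⟩
  rw [AddCircle.homeomorphCircle_apply] at hx
  have hxw : (x.toCircle : ℂ) = w := by rw [hx]
  have h1 := hA' x
  have h2 : ‖f x - g x‖ ≤ δ := by
    rw [← dist_eq_norm]
    exact (ContinuousMap.dist_apply_le_dist x).trans (by rw [dist_comm]; exact hfg.le)
  have h3 : g x = h w := by simp [hg, hxw]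
  rw [hxw] at h1
  rw [h1, ← mul_sub, norm_mul, norm_pow, hw1, one_pow, one_mul, ← h3]
  exact h2

/-- A continuous function on the circle is uniformly close to nonvanishing ones. -/
theorem exists_ne_zero_near_on_sphere {h : ℂ → ℂ} (hh : ContinuousOn h (sphere 0 1)) {δ : ℝ}
    (hδ : 0 < δ) : ∃ h' : ℂ → ℂ, ContinuousOn h' (sphere 0 1) ∧
      ∀ w ∈ sphere (0 : ℂ) 1, h' w ≠ 0 ∧ ‖h' w - h w‖ ≤ δ := by
  obtain ⟨p, hp⟩ := exists_laurent_near hh (half_pos hδ)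
  obtain ⟨A, hA, hAh⟩ := hp p le_rfl
  have hcd : ContDiff ℝ 1 fun t : ℝ =>
      (Complex.exp (t * Complex.I) ^ p)⁻¹ * A (Complex.exp (t * Complex.I)) := by
    have h1 : ContDiff ℝ 1 fun t : ℝ => Complex.exp (t * Complex.I) :=
      (Complex.ofRealCLM.contDiff.mul contDiff_const).cexp
    exact ((h1.pow p).inv fun t => pow_ne_zero _ (Complex.exp_ne_zero _)).mul
      ((hA.contDiff.restrict_scalars ℝ).comp h1)
  obtain ⟨c, hc, hc0⟩ := (hcd.dense_compl_range_of_finrank_lt_finrank (by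
    rw [Complex.finrank_real_complex, Module.finrank_self]; norm_num)).exists_dist_lt 0
      (half_pos hδ)
  have hw0 : ∀ w ∈ sphere (0 : ℂ) 1, w ≠ 0 := fun w hw h => by simp [h] at hw
  refine ⟨fun w => (w ^ p)⁻¹ * A w - c, ?_, fun w hw => ⟨fun h => hc ?_, ?_⟩⟩
  · exact (((continuousOn_id.pow p).inv₀ fun w hw => pow_ne_zero _ (hw0 w hw)).mul
      hA.continuous.continuousOn).sub continuousOn_const
  · obtain ⟨t, -, ht⟩ : ∃ t : ℝ, True ∧ Complex.exp (t * Complex.I) = w := by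
      refine ⟨Complex.arg w, trivial, ?_⟩
      have := Complex.norm_mul_exp_arg_mul_I w
      rwa [show ‖w‖ = 1 by simpa using hw, Complex.ofReal_one, one_mul] at this
    exact ⟨t, by simp only [ht]; exact sub_eq_zero.1 h⟩
  · have h1 : ‖(w ^ p)⁻¹ * A w - h w‖ ≤ δ / 2 := by
      have hwp : w ^ p ≠ 0 := pow_ne_zero _ (hw0 w hw)
      have : (w ^ p)⁻¹ * A w - h w = (w ^ p)⁻¹ * (A w - w ^ p * h w) := by
        rw [mul_sub, inv_mul_cancel_left₀ hwp]
      rw [this, norm_mul, norm_inv, norm_pow, show ‖w‖ = 1 by simpa using hw, one_pow, inv_one,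
        one_mul]
      exact hAh w hw
    rw [dist_zero_left] at hc0
    calc ‖(w ^ p)⁻¹ * A w - c - h w‖ = ‖((w ^ p)⁻¹ * A w - h w) - c‖ := by ring_nf
      _ ≤ δ / 2 + δ / 2 := (norm_sub_le _ _).trans (add_le_add h1 hc0.le)
      _ = δ := by ring

namespace Surf

/-- The minimum of the conformal factor over circles centred at the origin. -/
def m (S : Surf) (t : ℝ) : ℝ :=
  sInf ((fun w : ℂ => S.mu ((projIcc (0 : ℝ) 1 zero_le_one t : ℝ) * w)) '' sphere 0 1)

theorem projIcc_mul_mem (t : ℝ) {w : ℂ} (hw : w ∈ sphere (0 : ℂ) 1) :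
    ((projIcc (0 : ℝ) 1 zero_le_one t : ℝ) : ℂ) * w ∈ closedBall (0 : ℂ) 1 := by
  have h := (projIcc (0 : ℝ) 1 zero_le_one t).2
  rw [mem_closedBall_zero_iff, norm_mul, Complex.norm_real, Real.norm_of_nonneg h.1,
    show ‖w‖ = 1 by simpa using hw, mul_one]
  exact h.2

theorem continuous_m (S : Surf) : Continuous S.m := by
  have h := IsCompact.continuous_sInf (K := (univ : Set (sphere (0 : ℂ) 1)))
    (f := fun (t : ℝ) (w : sphere (0 : ℂ) 1) =>
      S.mu ((projIcc (0 : ℝ) 1 zero_le_one t : ℝ) * (w : ℂ))) isCompact_univ (by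
      refine (S.continuousOn_mu.mono S.closedBall_subset).comp_continuous
        (f := fun x : ℝ × sphere (0 : ℂ) 1 =>
          ((projIcc (0 : ℝ) 1 zero_le_one x.1 : ℝ) : ℂ) * (x.2 : ℂ)) ?_
        fun x => projIcc_mul_mem x.1 x.2.2
      have : Continuous (projIcc (0 : ℝ) 1 zero_le_one) := continuous_projIcc
      fun_prop)
  convert h using 2 with t
  rw [m]
  congr 1
  ext y
  simp [Subtype.exists]

theorem bddBelow_m (S : Surf) (t : ℝ) : BddBelow
    ((fun w : ℂ => S.mu ((projIcc (0 : ℝ) 1 zero_le_one t : ℝ) * w)) '' sphere 0 1) :=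
  ⟨0, by rintro _ ⟨w, -, rfl⟩; exact S.mu_nonneg _⟩

theorem m_le (S : Surf) {z : ℂ} (hz : ‖z‖ ≤ 1) : S.m ‖z‖ ≤ S.mu z := by
  refine csInf_le (S.bddBelow_m _) ?_
  rw [projIcc_of_mem _ (⟨norm_nonneg z, hz⟩ : ‖z‖ ∈ Icc (0 : ℝ) 1)]
  refine ⟨Complex.exp (Complex.arg z * Complex.I), by simp, ?_⟩
  simp only [Complex.norm_mul_exp_arg_mul_I]

theorem le_m (S : Surf) {t c : ℝ} (ht : t ∈ Icc (0 : ℝ) 1) (h : ∀ z : ℂ, ‖z‖ = t → c ≤ S.mu z) :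
    c ≤ S.m t := by
  refine le_csInf (Set.Nonempty.image _ ⟨1, by simp⟩) ?_
  rintro _ ⟨w, hw, rfl⟩
  rw [projIcc_of_mem _ ht]
  refine h _ ?_
  rw [norm_mul, Complex.norm_real, Real.norm_of_nonneg ht.1, show ‖w‖ = 1 by simpa using hw,
    mul_one]

theorem m_nonneg (S : Surf) (t : ℝ) : 0 ≤ S.m t :=
  Real.sInf_nonneg (by rintro _ ⟨w, -, rfl⟩; exact S.mu_nonneg _)

end Surf

theorem inner_reV_nul_eq_zero (l h : ℂ) (y s : ℝ) (ν : R3) (h0 : ν 0 = h.re) (h1 : ν 1 = h.im)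
    (h2 : ν 2 = y) {n : ℝ} (hn : n ^ 2 = ‖h‖ ^ 2 + y ^ 2) :
    inner ℝ (reV fun i => l * nul (s * (n - y : ℝ)) (s * h) i) ν = 0 := by
  have hn' : n ^ 2 = h.re ^ 2 + h.im ^ 2 + y ^ 2 := by
    rw [hn, Complex.sq_norm, Complex.normSq_apply]; ring
  have key : (∑ i, l * nul (s * (n - y : ℝ)) (s * h) i * (ν i : ℂ)) = 0 := by
    rw [Fin.sum_univ_three, h0, h1, h2]
    simp only [nul_apply_zero, nul_apply_one, nul_apply_two]
    obtain ⟨x, z⟩ := h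
    have e : (⟨x, z⟩ : ℂ) = x + z * Complex.I := Complex.mk_eq_add_mul_I x z
    have hn2 : (n : ℂ) ^ 2 = x ^ 2 + z ^ 2 + y ^ 2 := by exact_mod_cast hn'
    simp only [e]
    push_cast
    have hI := Complex.I_sq
    linear_combination (l * s ^ 2 * (x + z * Complex.I)) * hn2 +
      l * s ^ 2 * (x * z ^ 2 + z ^ 3 * Complex.I) * hI
  have : inner ℝ (reV fun i => l * nul (s * (n - y : ℝ)) (s * h) i) ν =
      (∑ i, l * nul (s * (n - y : ℝ)) (s * h) i * (ν i : ℂ)).re := by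
    rw [PiLp.inner_apply, Complex.re_sum]
    refine Finset.sum_congr rfl fun i _ => ?_
    rw [reV_apply, Complex.re_mul_ofReal]
    simp [mul_comm]
  rw [this, key, Complex.zero_re]

/-- Null frames of prescribed length, almost orthogonal to a given field on the circle. -/
theorem exists_null_frame {ν : ℂ → R3} (hν : ContinuousOn ν (sphere 0 1)) {r e : ℝ} (hr : 0 < r)
    (he : 0 < e) : ∃ a b : ℂ → ℂ, ContinuousOn a (sphere 0 1) ∧ ContinuousOn b (sphere 0 1) ∧
      ∀ w ∈ sphere (0 : ℂ) 1, ‖a w‖ ^ 2 + ‖b w‖ ^ 2 = r ∧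
        ∀ l : ℂ, |inner ℝ (reV fun i => l * nul (a w) (b w) i) (ν w)| ≤ ‖l‖ * e := by
  have hνi : ∀ i, ContinuousOn (fun w => ν w i) (sphere 0 1) := fun i =>
    (EuclideanSpace.proj (𝕜 := ℝ) i).continuous.comp_continuousOn hν
  have hh : ContinuousOn (fun w => (ν w 0 : ℂ) + ν w 1 * Complex.I) (sphere 0 1) :=
    ((Complex.continuous_ofReal.comp_continuousOn (hνi 0))).add
      ((Complex.continuous_ofReal.comp_continuousOn (hνi 1)).mul continuousOn_const)
  obtain ⟨h, hhc, hh'⟩ := exists_ne_zero_near_on_sphere hh (div_pos he hr)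
  set n : ℂ → ℝ := fun w => √(‖h w‖ ^ 2 + ν w 2 ^ 2) with hn
  have hnc : ContinuousOn n (sphere 0 1) := ((hhc.norm.pow 2).add ((hνi 2).pow 2)).sqrt
  set q : ℂ → ℝ := fun w => (n w - ν w 2) ^ 2 + ‖h w‖ ^ 2 with hq
  have hqc : ContinuousOn q (sphere 0 1) := ((hnc.sub (hνi 2)).pow 2).add (hhc.norm.pow 2)
  have hq0 : ∀ w ∈ sphere (0 : ℂ) 1, 0 < q w := fun w hw => by
    have := norm_pos_iff.2 (hh' w hw).1
    positivity
  set s : ℂ → ℝ := fun w => √(r / q w) with hs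
  have hsc : ContinuousOn s (sphere 0 1) :=
    (continuousOn_const.div hqc fun w hw => (hq0 w hw).ne').sqrt
  refine ⟨fun w => s w * (n w - ν w 2 : ℝ), fun w => s w * h w, ?_, ?_, fun w hw => ?_⟩
  · exact (Complex.continuous_ofReal.comp_continuousOn hsc).mul
      (Complex.continuous_ofReal.comp_continuousOn (hnc.sub (hνi 2)))
  · exact (Complex.continuous_ofReal.comp_continuousOn hsc).mul hhc
  · have hlen : ‖(s w : ℂ) * (n w - ν w 2 : ℝ)‖ ^ 2 + ‖(s w : ℂ) * h w‖ ^ 2 = r := by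
      rw [norm_mul, norm_mul, mul_pow, mul_pow, Complex.norm_real, Complex.norm_real,
        Real.norm_eq_abs, Real.norm_eq_abs, sq_abs, sq_abs, ← mul_add, hs,
        Real.sq_sqrt (div_nonneg hr.le (hq0 w hw).le)]
      exact div_mul_cancel₀ _ (hq0 w hw).ne'
    refine ⟨hlen, fun l => ?_⟩
    set ν' : R3 := !₂[(h w).re, (h w).im, ν w 2] with hν'
    have horth := inner_reV_nul_eq_zero l (h w) (ν w 2) (s w) ν' rfl rfl rfl
      (n := n w) (by rw [hn, Real.sq_sqrt (by positivity)])
    have hdist : ‖ν w - ν'‖ ≤ e / r := by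
      refine le_trans (le_of_eq ?_) (hh' w hw).2
      rw [← sq_eq_sq₀ (norm_nonneg _) (norm_nonneg _), EuclideanSpace.real_norm_sq_eq,
        Fin.sum_univ_three, Complex.sq_norm, Complex.normSq_apply]
      simp [hν']
      ring
    have h3 : inner ℝ (reV fun i => l * nul (s w * (n w - ν w 2 : ℝ)) (s w * h w) i) (ν w) =
        inner ℝ (reV fun i => l * nul (s w * (n w - ν w 2 : ℝ)) (s w * h w) i) (ν w - ν') := by
      rw [inner_sub_right, horth, sub_zero]
    rw [h3]
    refine (abs_real_inner_le_norm _ _).trans ?_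
    rw [norm_reV_mul_nul, hlen]
    calc ‖l‖ * r * ‖ν w - ν'‖ ≤ ‖l‖ * r * (e / r) := by gcongr
      _ = ‖l‖ * e := by field_simp

theorem integral_osc (c d q : ℝ) (k : ℕ) :
    ∫ t in q..1, (c * ((2 * k + 1) * t ^ (2 * k)) - d * t ^ k) =
      c * (1 - q ^ (2 * k + 1)) - d * ((1 - q ^ (k + 1)) / (k + 1)) := by
  have h1 : IntervalIntegrable (fun t : ℝ => c * ((2 * k + 1) * t ^ (2 * k)))
      MeasureTheory.volume q 1 := Continuous.intervalIntegrable (by fun_prop) _ _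
  have h2 : IntervalIntegrable (fun t : ℝ => d * t ^ k) MeasureTheory.volume q 1 :=
    Continuous.intervalIntegrable (by fun_prop) _ _
  rw [intervalIntegral.integral_sub h1 h2, intervalIntegral.integral_const_mul,
    intervalIntegral.integral_const_mul, intervalIntegral.integral_const_mul, integral_pow,
    integral_pow]
  have h3 : (2 * (k : ℝ) + 1) ≠ 0 := by positivity
  push_cast
  rw [mul_div_cancel₀ _ h3, one_pow, one_pow]

namespace Surf

theorem mu_osc_ge (S : Surf) {A B : ℂ → ℂ} (hA : Differentiable ℂ A) (hB : Differentiable ℂ B)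
    (k : ℕ) {K L : ℝ} {z : ℂ} (hu : ‖S.u z‖ ≤ K) (hv : ‖S.v z‖ ≤ K) (ha : ‖A z‖ ≤ L)
    (hb : ‖B z‖ ≤ L) :
    S.mu z + (2 * k + 1) * ‖z‖ ^ (2 * k) * (‖A z‖ ^ 2 + ‖B z‖ ^ 2) -
      4 * (K * L) * (√(2 * k + 1) * ‖z‖ ^ k) ≤ (S.osc hA hB k).mu z := by
  set σ : ℝ := √(2 * k + 1) with hσ
  have hσ0 : 0 ≤ σ := Real.sqrt_nonneg _
  have hσ2 : σ ^ 2 = 2 * k + 1 := Real.sq_sqrt (by positivity)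
  have key : ∀ x y : ℂ, ‖x‖ ≤ K → ‖y‖ ≤ L →
      ‖x‖ ^ 2 + (2 * k + 1) * ‖z‖ ^ (2 * k) * ‖y‖ ^ 2 - 2 * (K * L) * (σ * ‖z‖ ^ k) ≤
        ‖x + ((σ : ℂ) * z ^ k) * y‖ ^ 2 := by
    intro x y hx hy
    have h1 : ‖((σ : ℂ) * z ^ k) * y‖ = σ * ‖z‖ ^ k * ‖y‖ := by
      rw [norm_mul, norm_mul, norm_pow, Complex.norm_real, Real.norm_of_nonneg hσ0]
    have h2 := abs_norm_sub_norm_le x (-(((σ : ℂ) * z ^ k) * y))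
    rw [sub_neg_eq_add, norm_neg, h1] at h2
    have h3 : (‖x‖ - σ * ‖z‖ ^ k * ‖y‖) ^ 2 ≤ ‖x + ((σ : ℂ) * z ^ k) * y‖ ^ 2 := by
      rw [← sq_abs]
      exact pow_le_pow_left₀ (abs_nonneg _) h2 2
    have h4 : ‖x‖ * ‖y‖ ≤ K * L :=
      mul_le_mul hx hy (norm_nonneg _) ((norm_nonneg _).trans hx)
    have h5 : 0 ≤ σ * ‖z‖ ^ k := by positivity
    have h6 := mul_le_mul_of_nonneg_left h4 h5
    rw [pow_mul', ← hσ2]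
    linarith
  have h1 := key _ _ hu ha
  have h2 := key _ _ hv hb
  simp only [mu, osc]
  linarith

set_option maxHeartbeats 1000000 in
open Filter Topology in
/-- Push the boundary of a surface by a prescribed distance, almost orthogonally to a field. -/
theorem exists_push (S : Surf) {ν : ℂ → R3} (hν : ContinuousOn ν (sphere 0 1)) {r e ρ : ℝ}
    (hr : 0 < r) (he : 0 < e) (hρ0 : 0 ≤ ρ) (hρ1 : ρ < 1) : ∃ S' : Surf,
    (∀ z ∈ closedBall (0 : ℂ) 1, ∃ D : R3, ‖S'.X z - S.X z - D‖ ≤ e ∧ ‖D‖ ≤ r ∧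
      |inner ℝ D (ν (z / ‖z‖))| ≤ e ∧ (‖z‖ ≤ ρ → D = 0) ∧ (‖z‖ = 1 → ‖D‖ = r)) ∧
    (∀ t ∈ Icc 0 ρ, S.m t - e ≤ S'.m t) ∧ r - e ≤ ∫ t in ρ..1, S'.m t := by
  obtain ⟨a, b, hac, hbc, hab⟩ := exists_null_frame hν hr he
  set N : ℝ := √r + 1 with hN
  have hN1 : 1 ≤ N := by rw [hN]; linarith [Real.sqrt_nonneg r]
  set δ : ℝ := min 1 (e / (8 * (4 * N + 2))) with hδ
  have hδ0 : 0 < δ := lt_min one_pos (by positivity)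
  have hδ1 : δ ≤ 1 := min_le_left _ _
  have hδe : (4 * N + 2) * δ ≤ e / 8 := by
    have := min_le_right 1 (e / (8 * (4 * N + 2)))
    rw [← hδ, le_div_iff₀ (by positivity)] at this
    linarith
  obtain ⟨p₁, hp₁⟩ := exists_laurent_near hac (half_pos hδ0)
  obtain ⟨p₂, hp₂⟩ := exists_laurent_near hbc (half_pos hδ0)
  set p := max p₁ p₂
  obtain ⟨A, hA, hAa⟩ := hp₁ p (le_max_left _ _)
  obtain ⟨B, hB, hBb⟩ := hp₂ p (le_max_right _ _)
  obtain ⟨K, hK, hKb⟩ := S.exists_norm_le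
  obtain ⟨L₁, hL₁⟩ := (isCompact_closedBall (0 : ℂ) 1).exists_bound_of_continuousOn
    hA.continuous.continuousOn
  obtain ⟨L₂, hL₂⟩ := (isCompact_closedBall (0 : ℂ) 1).exists_bound_of_continuousOn
    hB.continuous.continuousOn
  set L := max L₁ L₂
  have hLA : ∀ z ∈ closedBall (0 : ℂ) 1, ‖A z‖ ≤ L := fun z hz =>
    (hL₁ z hz).trans (le_max_left _ _)
  have hLB : ∀ z ∈ closedBall (0 : ℂ) 1, ‖B z‖ ≤ L := fun z hz =>
    (hL₂ z hz).trans (le_max_right _ _)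
  have hL0 : 0 ≤ L := (norm_nonneg _).trans (hLA 0 (by simp))
  have hunif : ∀ {f : ℂ → ℂ}, Continuous f → ∃ η > 0, ∀ z ∈ closedBall (0 : ℂ) 1,
      ∀ w ∈ closedBall (0 : ℂ) 1, dist z w < η → dist (f z) (f w) < δ / 2 := fun hf =>
    Metric.uniformContinuousOn_iff.1
      ((isCompact_closedBall (0 : ℂ) 1).uniformContinuousOn_of_continuous hf.continuousOn) _
      (half_pos hδ0)
  obtain ⟨η₁, hη₁, hη₁'⟩ := hunif hA.continuous
  obtain ⟨η₂, hη₂, hη₂'⟩ := hunif hB.continuous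
  obtain ⟨ρ₁, hρ₁, hρ₁'⟩ : ∃ ρ₁, max ρ (1 - min η₁ η₂) < ρ₁ ∧ ρ₁ < 1 :=
    exists_between (max_lt hρ1 (by linarith [lt_min hη₁ hη₂]))
  have hρρ₁ : ρ < ρ₁ := (le_max_left _ _).trans_lt hρ₁
  have hρ₁0 : 0 < ρ₁ := hρ0.trans_lt hρρ₁
  have hnear : ∀ z ∈ closedBall (0 : ℂ) 1, ρ₁ ≤ ‖z‖ → z / ‖z‖ ∈ sphere (0 : ℂ) 1 ∧
      ‖A z - (z / ‖z‖) ^ p * a (z / ‖z‖)‖ ≤ δ ∧ ‖B z - (z / ‖z‖) ^ p * b (z / ‖z‖)‖ ≤ δ := by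
    intro z hz hz1
    have hz0 : 0 < ‖z‖ := hρ₁0.trans_le hz1
    have hzle : ‖z‖ ≤ 1 := by simpa using hz
    have hw : z / ‖z‖ ∈ sphere (0 : ℂ) 1 := by
      rw [mem_sphere_zero_iff_norm, norm_div, Complex.norm_real, norm_norm, div_self hz0.ne']
    have hd : dist z (z / ‖z‖) < min η₁ η₂ := by
      have : z - z / ‖z‖ = ((‖z‖ - 1 : ℝ) : ℂ) * (z / ‖z‖) := by
        have : (‖z‖ : ℂ) ≠ 0 := by exact_mod_cast hz0.ne'
        push_cast
        field_simp
      rw [dist_eq_norm, this, norm_mul, Complex.norm_real, mem_sphere_zero_iff_norm.1 hw, mul_one,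
        Real.norm_eq_abs, abs_of_nonpos (by linarith)]
      linarith [le_max_right ρ (1 - min η₁ η₂)]
    have hwc := sphere_subset_closedBall hw
    refine ⟨hw, ?_, ?_⟩
    · have h1 := hη₁' z hz _ hwc (hd.trans_le (min_le_left _ _))
      rw [dist_eq_norm] at h1
      have h2 := norm_add_le (A z - A (z / ‖z‖)) (A (z / ‖z‖) - (z / ‖z‖) ^ p * a (z / ‖z‖))
      rw [sub_add_sub_cancel] at h2
      linarith [hAa _ hw]
    · have h1 := hη₂' z hz _ hwc (hd.trans_le (min_le_right _ _))
      rw [dist_eq_norm] at h1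
      have h2 := norm_add_le (B z - B (z / ‖z‖)) (B (z / ‖z‖) - (z / ‖z‖) ^ p * b (z / ‖z‖))
      rw [sub_add_sub_cancel] at h2
      linarith [hBb _ hw]
  have hNab : ∀ w ∈ sphere (0 : ℂ) 1, ‖w ^ p * a w‖ ≤ N ∧ ‖w ^ p * b w‖ ≤ N ∧
      ‖w ^ p * a w‖ ^ 2 + ‖w ^ p * b w‖ ^ 2 = r := by
    intro w hw
    have h1 := (hab w hw).1
    have hw1 : ‖w‖ = 1 := by simpa using hw
    have h2 : √r ^ 2 = r := Real.sq_sqrt hr.le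
    rw [norm_mul, norm_mul, norm_pow, hw1, one_pow, one_mul, one_mul]
    refine ⟨?_, ?_, h1⟩
    · have := abs_le_of_sq_le_sq (a := ‖a w‖) (b := √r) (by nlinarith [sq_nonneg ‖b w‖])
        (Real.sqrt_nonneg r)
      linarith [(abs_le.1 this).2]
    · have := abs_le_of_sq_le_sq (a := ‖b w‖) (b := √r) (by nlinarith [sq_nonneg ‖a w‖])
        (Real.sqrt_nonneg r)
      linarith [(abs_le.1 this).2]
  have hev1 := S.eventually_osc hA hB (e := e / 8) (by positivity)
  have hev2 : ∀ᶠ k : ℕ in atTop, 4 * (K * L) * (√(2 * k + 1) * ρ ^ k) < e := by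
    have := (tendsto_sqrt_mul_pow hρ0 hρ1).const_mul (4 * (K * L))
    rw [mul_zero] at this
    exact this.eventually_lt_const he
  have hpow : ∀ C e' : ℝ, 0 < e' → ∀ᶠ k : ℕ in atTop, C * ρ₁ ^ k < e' := fun C e' he' => by
    have := (tendsto_pow_atTop_nhds_zero_of_lt_one hρ₁0.le hρ₁').const_mul C
    rw [mul_zero] at this
    exact this.eventually_lt_const he'
  have hev5 := (tendsto_sqrt_div_atTop (4 * (K * L)) 0).eventually_lt_const
    (by positivity : 0 < e / 4)
  obtain ⟨k, h1, h2, h3, h4, h5⟩ := (hev1.and (hev2.and ((hpow (2 * L ^ 2) (e / 8)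
    (by positivity)).and ((hpow r (e / 4) (by positivity)).and hev5)))).exists
  have hρk : ρ₁ ^ (2 * k + 1) ≤ ρ₁ ^ k :=
    pow_le_pow_of_le_one hρ₁0.le hρ₁'.le (by omega)
  refine ⟨S.osc hA hB k, fun z hz => ?_, fun t ht => ?_, ?_⟩
  · have hzle : ‖z‖ ≤ 1 := by simpa using hz
    have herr : ∀ d : Fin 3 → ℂ, (∀ i, ‖z ^ (2 * k + 1) * nul (A z) (B z) i - d i‖ ≤ e / 8) →
        ‖(S.osc hA hB k).X z - S.X z - reV d‖ ≤ e := by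
      intro d hd
      rw [X, X, reV_sub, reV_sub]
      have := norm_reV_le (r := e / 4) (by positivity)
        (w := fun i => (S.osc hA hB k).H i z - S.H i z - d i) fun i => by
          have h6 := norm_add_le ((S.osc hA hB k).H i z - S.H i z -
            z ^ (2 * k + 1) * nul (A z) (B z) i) (z ^ (2 * k + 1) * nul (A z) (B z) i - d i)
          rw [sub_add_sub_cancel] at h6
          linarith [h1 z hz i, hd i]
      linarith
    by_cases hz1 : ρ₁ ≤ ‖z‖
    · obtain ⟨hw, hAz, hBz⟩ := hnear z hz hz1
      set w : ℂ := z / ‖z‖ with hw_def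
      have hw1 : ‖w‖ = 1 := by simpa using hw
      have hl : ‖z ^ (2 * k + 1) * w ^ (2 * p)‖ ≤ 1 := by
        rw [norm_mul, norm_pow, norm_pow, hw1, one_pow, mul_one]
        exact pow_le_one₀ (norm_nonneg _) hzle
      refine ⟨reV fun i => (z ^ (2 * k + 1) * w ^ (2 * p)) * nul (a w) (b w) i, herr _ fun i => ?_,
        ?_, ?_, fun h => absurd (hz1.trans h) (not_le.2 hρρ₁), fun h => ?_⟩
      · have h6 := norm_nul_add_sub_le (hNab w hw).1 (hNab w hw).2.1 hAz hBz i
        rw [add_sub_cancel, add_sub_cancel] at h6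
        have h7 : nul (w ^ p * a w) (w ^ p * b w) i = w ^ (2 * p) * nul (a w) (b w) i := by
          have := nul_add_mul 0 0 (a w) (b w) (w ^ p) i
          rw [zero_add, zero_add, ← pow_mul, mul_comm p] at this
          rw [this]
          fin_cases i <;> simp [nulPol, nul]
        rw [mul_assoc, ← h7, ← mul_sub, norm_mul, norm_pow]
        have h8 : ‖z‖ ^ (2 * k + 1) ≤ 1 := pow_le_one₀ (norm_nonneg _) hzle
        calc _ ≤ 1 * (4 * N * δ + 2 * δ ^ 2) := by gcongr
          _ ≤ e / 8 := by nlinarith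
      · rw [norm_reV_mul_nul, (hab w hw).1]
        exact mul_le_of_le_one_left hr.le hl
      · refine ((hab w hw).2 _).trans ?_
        exact mul_le_of_le_one_left he.le hl
      · rw [norm_reV_mul_nul, (hab w hw).1, norm_mul, norm_pow, norm_pow, hw1, h]
        simp
    · rw [not_le] at hz1
      refine ⟨0, ?_, by simpa using hr.le, by simpa using he.le, fun _ => rfl, fun h => ?_⟩
      · have h0 : (0 : R3) = reV fun _ => 0 := by ext i; simp
        rw [h0]
        refine herr _ fun i => ?_
        have h6 := norm_nul_add_sub_le (a := 0) (b := 0) (K := 0) (by simp) (by simp)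
          (hLA z hz) (hLB z hz) i
        have h7 : nul (0 : ℂ) 0 i = 0 := by fin_cases i <;> simp [nul]
        rw [zero_add, zero_add, h7, sub_zero] at h6
        rw [sub_zero, norm_mul, norm_pow]
        calc _ ≤ ρ₁ ^ (2 * k + 1) * (4 * 0 * L + 2 * L ^ 2) := by gcongr
          _ ≤ ρ₁ ^ k * (2 * L ^ 2) := by
              rw [mul_zero, zero_mul, zero_add]
              gcongr
          _ ≤ e / 8 := by linarith
      · linarith
  · refine (S.osc hA hB k).le_m ⟨ht.1, ht.2.trans hρ1.le⟩ fun z hz => ?_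
    have hzle : ‖z‖ ≤ 1 := by rw [hz]; exact ht.2.trans hρ1.le
    have hzc : z ∈ closedBall (0 : ℂ) 1 := by simpa using hzle
    have h6 := S.mu_osc_ge hA hB k (hKb z hzc).1 (hKb z hzc).2 (hLA z hzc) (hLB z hzc)
    have h7 : 4 * (K * L) * (√(2 * k + 1) * ‖z‖ ^ k) ≤ 4 * (K * L) * (√(2 * k + 1) * ρ ^ k) := by
      rw [hz]
      have := ht.1
      have := ht.2
      gcongr
    have h8 := S.m_le hzle
    rw [hz] at h8
    have h9 : 0 ≤ (2 * k + 1) * ‖z‖ ^ (2 * k) * (‖A z‖ ^ 2 + ‖B z‖ ^ 2) := by positivity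
    linarith
  · set S' := S.osc hA hB k
    have hInt : ∀ x y : ℝ, IntervalIntegrable S'.m MeasureTheory.volume x y := fun x y =>
      S'.continuous_m.intervalIntegrable x y
    rw [← intervalIntegral.integral_add_adjacent_intervals (hInt ρ ρ₁) (hInt ρ₁ 1)]
    have hfirst : 0 ≤ ∫ t in ρ..ρ₁, S'.m t :=
      intervalIntegral.integral_nonneg hρρ₁.le fun t _ => S'.m_nonneg t
    set c : ℝ := r - e / 2 with hc
    have hlow : ∀ t ∈ Icc ρ₁ 1, c * ((2 * k + 1) * t ^ (2 * k)) -
        4 * (K * L) * √(2 * k + 1) * t ^ k ≤ S'.m t := by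
      intro t ht
      have ht0 : 0 ≤ t := hρ₁0.le.trans ht.1
      refine S'.le_m ⟨ht0, ht.2⟩ fun z hz => ?_
      have hzc : z ∈ closedBall (0 : ℂ) 1 := by simpa [hz] using ht.2
      have h6 := S.mu_osc_ge hA hB k (hKb z hzc).1 (hKb z hzc).2 (hLA z hzc) (hLB z hzc)
      obtain ⟨hw, hAz, hBz⟩ := hnear z hzc (hz ▸ ht.1)
      obtain ⟨h7, h8, h9⟩ := hNab _ hw
      have hsq : ∀ x y : ℂ, ‖y‖ ≤ N → ‖x - y‖ ≤ δ → ‖y‖ ^ 2 - 2 * (N * δ) ≤ ‖x‖ ^ 2 := by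
        intro x y hy hxy
        have h10 : ‖y‖ ≤ ‖x‖ + ‖x - y‖ := by
          have := norm_sub_le x (x - y)
          rwa [sub_sub_cancel] at this
        nlinarith [sq_nonneg (‖x‖ - ‖y‖), mul_le_mul hy hxy (norm_nonneg _) (by linarith),
          norm_nonneg y]
      have h10 := hsq _ _ h7 hAz
      have h11 := hsq _ _ h8 hBz
      have h12 : c ≤ ‖A z‖ ^ 2 + ‖B z‖ ^ 2 := by nlinarith
      have h13 : 0 ≤ (2 * k + 1) * ‖z‖ ^ (2 * k) := by positivity
      have h14 := mul_le_mul_of_nonneg_left h12 h13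
      have h15 := S.mu_nonneg z
      rw [hz] at h6 h14
      linarith
    have hprim : ∫ t in ρ₁..1, (c * ((2 * k + 1) * t ^ (2 * k)) -
        4 * (K * L) * √(2 * k + 1) * t ^ k) = c * (1 - ρ₁ ^ (2 * k + 1)) -
        4 * (K * L) * √(2 * k + 1) * ((1 - ρ₁ ^ (k + 1)) / (k + 1)) := by
      exact integral_osc _ _ _ _
    have hlast := intervalIntegral.integral_mono_on hρ₁'.le
      (Continuous.intervalIntegrable (by fun_prop) _ _) (hInt ρ₁ 1) hlow
    rw [hprim] at hlast
    have h6 : 4 * (K * L) * √(2 * k + 1) * ((1 - ρ₁ ^ (k + 1)) / (k + 1)) ≤ e / 4 := by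
      refine le_trans ?_ h5.le
      rw [add_zero, mul_comm √(2 * (k : ℝ) + 1), ← mul_div_assoc]
      refine div_le_div_of_nonneg_right ?_ (by positivity)
      have h9 : 0 ≤ 4 * (K * L) * √(2 * (k : ℝ) + 1) := by positivity
      exact mul_le_of_le_one_right h9 (by linarith [pow_pos hρ₁0 (k + 1)])
    have h7 : r * ρ₁ ^ (2 * k + 1) ≤ e / 4 := by nlinarith
    have h8 : 0 ≤ ρ₁ ^ (2 * k + 1) := by positivity
    nlinarith

end Surf

theorem div_norm_mem_sphere {z : ℂ} (hz : 0 < ‖z‖) : z / ‖z‖ ∈ sphere (0 : ℂ) 1 := by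
  rw [mem_sphere_zero_iff_norm, norm_div, Complex.norm_real, norm_norm, div_self hz.ne']

theorem exists_collar {F : Type*} [NormedAddCommGroup F] {f : ℂ → F}
    (hf : ContinuousOn f (closedBall 0 1)) {δ ρ : ℝ} (hδ : 0 < δ) (hρ : ρ < 1) :
    ∃ ρ₁, ρ < ρ₁ ∧ 0 < ρ₁ ∧ ρ₁ < 1 ∧ ∀ z ∈ closedBall (0 : ℂ) 1, ρ₁ ≤ ‖z‖ →
      z / ‖z‖ ∈ sphere (0 : ℂ) 1 ∧ ‖f z - f (z / ‖z‖)‖ ≤ δ := by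
  obtain ⟨η, hη, hη'⟩ := Metric.uniformContinuousOn_iff.1
    ((isCompact_closedBall (0 : ℂ) 1).uniformContinuousOn_of_continuous hf) _ hδ
  obtain ⟨ρ₁, hρ₁, hρ₁'⟩ : ∃ ρ₁, max (max ρ 0) (1 - η) < ρ₁ ∧ ρ₁ < 1 :=
    exists_between (max_lt (max_lt hρ one_pos) (by linarith))
  have h0 : 0 < ρ₁ := ((le_max_right ρ 0).trans (le_max_left _ _)).trans_lt hρ₁
  refine ⟨ρ₁, ((le_max_left ρ 0).trans (le_max_left _ _)).trans_lt hρ₁, h0, hρ₁',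
    fun z hz hz1 => ?_⟩
  have hz0 : 0 < ‖z‖ := h0.trans_le hz1
  have hzle : ‖z‖ ≤ 1 := by simpa using hz
  have hw := div_norm_mem_sphere hz0
  refine ⟨hw, ?_⟩
  rw [← dist_eq_norm]
  refine (hη' z hz _ (sphere_subset_closedBall hw) ?_).le
  have : z - z / ‖z‖ = ((‖z‖ - 1 : ℝ) : ℂ) * (z / ‖z‖) := by
    have : (‖z‖ : ℂ) ≠ 0 := by exact_mod_cast hz0.ne'
    push_cast
    field_simp
  rw [dist_eq_norm, this, norm_mul, Complex.norm_real, mem_sphere_zero_iff_norm.1 hw, mul_one,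
    Real.norm_eq_abs, abs_of_nonpos (by linarith)]
  linarith [le_max_right (max ρ 0) (1 - η)]

namespace Surf

theorem exists_step_length (S S₁ : Surf) {r e c l ρ : ℝ} (hr : 0 < r) (he : 0 < e) (hρ0 : 0 ≤ ρ)
    (hρ1 : ρ < 1) (hc : 0 ≤ c) (h1 : ∀ z ∈ closedBall (0 : ℂ) 1, ‖S₁.X z - S.X z‖ ^ 2 ≤ c)
    (hl : l ≤ ∫ t in ρ..1, S₁.m t) : ∃ S' : Surf,
      (∀ z ∈ closedBall (0 : ℂ) 1, ‖S'.X z - S.X z‖ ^ 2 ≤ c + r ^ 2 + e) ∧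
      l + r - e ≤ ∫ t in ρ..1, S'.m t := by
  have hV : ContinuousOn (fun z => S₁.X z - S.X z) (closedBall 0 1) :=
    (S₁.continuousOn_X.mono S₁.closedBall_subset).sub (S.continuousOn_X.mono S.closedBall_subset)
  set Q : ℝ := c + r ^ 2 + e with hQ
  have hQ0 : 0 < Q := by positivity
  set e₂ : ℝ := min 1 (e / (16 * (Q + 2))) with he₂
  have he₂0 : 0 < e₂ := lt_min one_pos (by positivity)
  have he₂1 : e₂ ≤ 1 := min_le_left _ _
  have he₂e : e₂ * (Q + 2) ≤ e / 16 := by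
    have := min_le_right 1 (e / (16 * (Q + 2)))
    rw [← he₂, le_div_iff₀ (by positivity)] at this
    linarith
  have he₂e' : e₂ ≤ e / 32 := by nlinarith
  obtain ⟨C, hC⟩ := isCompact_Icc.exists_bound_of_continuousOn (s := Icc (0 : ℝ) 1)
    S₁.continuous_m.continuousOn
  have hC0 : 0 ≤ C := (norm_nonneg _).trans (hC 0 (by simp))
  obtain ⟨ρ₁, hρ₁, hρ₁0, hρ₁1, hcol⟩ := exists_collar hV (δ := e / (16 * r))
    (ρ := max ρ (1 - e / (4 * (C + 1)))) (by positivity) (max_lt hρ1 (by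
      have : 0 < e / (4 * (C + 1)) := by positivity
      linarith))
  have hρρ₁ : ρ < ρ₁ := (le_max_left _ _).trans_lt hρ₁
  have htail : ∫ t in ρ₁..1, S₁.m t ≤ e / 4 := by
    have h2 := intervalIntegral.norm_integral_le_of_norm_le_const (a := ρ₁) (b := 1) (C := C)
      (f := S₁.m) fun t ht => hC t (by
        rw [uIoc_of_le hρ₁1.le] at ht
        exact ⟨hρ₁0.le.trans ht.1.le, ht.2⟩)
    rw [abs_of_pos (by linarith)] at h2
    have h3 := (le_max_right ρ (1 - e / (4 * (C + 1)))).trans hρ₁.le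
    have h4 : 1 - ρ₁ ≤ e / (4 * (C + 1)) := by linarith
    rw [le_div_iff₀ (by positivity)] at h4
    have h5 := (Real.le_norm_self _).trans h2
    nlinarith
  obtain ⟨S', hS', hm, hInt⟩ := S₁.exists_push (hV.mono sphere_subset_closedBall) hr he₂0
    hρ₁0.le hρ₁1
  refine ⟨S', fun z hz => ?_, ?_⟩
  · obtain ⟨D, hD1, hD2, hD3, hD4, -⟩ := hS' z hz
    set V : R3 := S₁.X z - S.X z with hVdef
    have hin : inner ℝ V D ≤ e₂ + e / 16 := by
      by_cases hzρ : ‖z‖ ≤ ρ₁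
      · rw [hD4 hzρ, inner_zero_right]
        positivity
      · obtain ⟨-, hc2⟩ := hcol z hz (not_le.1 hzρ).le
        set W : R3 := S₁.X (z / ‖z‖) - S.X (z / ‖z‖) with hW
        have h6 : inner ℝ V D = inner ℝ D W + inner ℝ D (V - W) := by
          rw [← inner_add_right, add_sub_cancel, real_inner_comm]
        have h7 := real_inner_le_norm D (V - W)
        have h8 : ‖D‖ * ‖V - W‖ ≤ r * (e / (16 * r)) :=
          mul_le_mul hD2 hc2 (norm_nonneg _) hr.le
        have h9 : r * (e / (16 * r)) = e / 16 := by field_simp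
        have h10 := (abs_le.1 hD3).2
        linarith
    have hVD : ‖V + D‖ ^ 2 ≤ c + r ^ 2 + 2 * (e₂ + e / 16) := by
      rw [norm_add_sq_real]
      have := h1 z hz
      have : ‖D‖ ^ 2 ≤ r ^ 2 := pow_le_pow_left₀ (norm_nonneg _) hD2 2
      linarith
    have hVDQ : ‖V + D‖ ≤ Q + 1 := by
      have h6 : ‖V + D‖ ^ 2 ≤ Q := by linarith
      nlinarith [norm_nonneg (V + D)]
    have hfin : ‖S'.X z - S.X z‖ ≤ ‖V + D‖ + e₂ := by
      have h6 : S'.X z - S.X z = (V + D) + (S'.X z - S₁.X z - D) := by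
        rw [hVdef]; abel
      rw [h6]
      exact (norm_add_le _ _).trans (by linarith)
    calc ‖S'.X z - S.X z‖ ^ 2 ≤ (‖V + D‖ + e₂) ^ 2 := pow_le_pow_left₀ (norm_nonneg _) hfin 2
      _ ≤ c + r ^ 2 + e := by nlinarith [norm_nonneg (V + D)]
  · have hi : ∀ (T : Surf) (x y : ℝ), IntervalIntegrable T.m MeasureTheory.volume x y :=
      fun T x y => T.continuous_m.intervalIntegrable x y
    rw [← intervalIntegral.integral_add_adjacent_intervals (hi S₁ ρ ρ₁) (hi S₁ ρ₁ 1)] at hl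
    rw [← intervalIntegral.integral_add_adjacent_intervals (hi S' ρ ρ₁) (hi S' ρ₁ 1)]
    have h2 := intervalIntegral.integral_mono_on hρρ₁.le
      ((hi S₁ ρ ρ₁).sub (intervalIntegrable_const (c := e₂))) (hi S' ρ ρ₁)
      fun t ht => hm t ⟨hρ0.trans ht.1, ht.2⟩
    rw [intervalIntegral.integral_sub (hi S₁ ρ ρ₁) intervalIntegrable_const,
      intervalIntegral.integral_const, smul_eq_mul] at h2
    nlinarith

/-- Surfaces can be made arbitrarily long by small perturbations. -/
theorem exists_long (S : Surf) {e l ρ : ℝ} (he : 0 < e) (hl : 0 < l) (hρ0 : 0 ≤ ρ) (hρ1 : ρ < 1) :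
    ∃ S' : Surf, (∀ z ∈ closedBall (0 : ℂ) 1, ‖S'.X z - S.X z‖ ≤ e) ∧
      l ≤ ∫ t in ρ..1, S'.m t := by
  obtain ⟨k, hk⟩ := exists_nat_gt (8 * l ^ 2 / e ^ 2)
  have hk0 : (0 : ℝ) < k := lt_of_le_of_lt (by positivity) hk
  set r : ℝ := 2 * l / k with hr
  have hr0 : 0 < r := by positivity
  have claim : ∀ j : ℕ, ∀ e' > 0, ∃ S' : Surf,
      (∀ z ∈ closedBall (0 : ℂ) 1, ‖S'.X z - S.X z‖ ^ 2 ≤ j * r ^ 2 + e') ∧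
      j * r - e' ≤ ∫ t in ρ..1, S'.m t := by
    intro j
    induction j with
    | zero =>
      intro e' he'
      refine ⟨S, fun z _ => by simpa using he'.le, ?_⟩
      have : 0 ≤ ∫ t in ρ..1, S.m t :=
        intervalIntegral.integral_nonneg hρ1.le fun t _ => S.m_nonneg t
      push_cast
      linarith
    | succ j ih =>
      intro e' he'
      obtain ⟨S₁, h1, h2⟩ := ih (e' / 2) (half_pos he')
      obtain ⟨S', h3, h4⟩ := S.exists_step_length S₁ hr0 (half_pos he') hρ0 hρ1 (by positivity)
        h1 h2
      refine ⟨S', fun z hz => (h3 z hz).trans (le_of_eq ?_), le_trans (le_of_eq ?_) h4⟩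
      · push_cast; ring
      · push_cast; ring
  obtain ⟨S', h1, h2⟩ := claim k (min (e ^ 2 / 2) l) (lt_min (by positivity) hl)
  refine ⟨S', fun z hz => ?_, ?_⟩
  · refine abs_le_of_sq_le_sq' ?_ he.le |>.2
    refine (h1 z hz).trans ?_
    have h3 : k * r ^ 2 ≤ e ^ 2 / 2 := by
      rw [hr]
      rw [div_lt_iff₀ (by positivity)] at hk
      field_simp
      nlinarith
    linarith [min_le_left (e ^ 2 / 2) l]
  · have h3 : k * r = 2 * l := by rw [hr]; field_simp
    linarith [min_le_right (e ^ 2 / 2) l]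

end Surf

/-- Points of `E` near its frontier lie radially below a touching exterior ball. -/
theorem ExtSphereRadius.exists_normal {E : Set R3} {R a : ℝ} (hR : ExtSphereRadius E R)
    (hEo : IsOpen E) (hEb : Bornology.IsBounded E) {x : R3} (hx : x ∈ E)
    (hxa : infDist x Eᶜ ≤ a) :
    ∃ (o n : R3) (d : ℝ), closure E ⊆ closedBall o R ∧ ‖n‖ = 1 ∧ 0 ≤ d ∧ d ≤ a ∧ d ≤ R ∧
      x = o + (R - d) • n := by
  have hne : (Eᶜ).Nonempty := by
    rw [nonempty_compl]
    rintro rfl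
    exact NormedSpace.unbounded_univ ℝ R3 hEb
  obtain ⟨p, hp, hpd⟩ := hEo.isClosed_compl.exists_infDist_eq_dist hne x
  set d := infDist x Eᶜ with hd
  have hd0 : 0 < d := (hEo.isClosed_compl.notMem_iff_infDist_pos hne).1 (by simpa using hx)
  have hball : closedBall x d ⊆ closure E := by
    rw [← closure_ball x hd0.ne']
    exact closure_mono ball_infDist_compl_subset
  have hpf : p ∈ frontier E :=
    ⟨hball (by rw [mem_closedBall, dist_comm, hpd]), by rw [hEo.interior_eq]; exact hp⟩
  obtain ⟨o, hpo, hEo'⟩ := hR.2 p hpf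
  rw [mem_sphere] at hpo
  have h1 : R ≤ d + dist x o := by
    rw [← hpo, hpd, dist_comm x p]
    exact dist_triangle _ _ _
  by_cases hxo : x = o
  · refine ⟨o, EuclideanSpace.single 0 1, d, hEo', by simp, hd0.le, hxa, ?_, ?_⟩
    · rw [← hpo, hpd, hxo, dist_comm]
    · have : d = R := by rw [← hpo, hpd, hxo, dist_comm]
      rw [this, sub_self, zero_smul, add_zero, hxo]
  · have hn : 0 < ‖x - o‖ := norm_pos_iff.2 (sub_ne_zero.2 hxo)
    have h2 : ‖x - o‖ + d ≤ R := by
      have : x + (d / ‖x - o‖) • (x - o) ∈ closedBall o R := by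
        refine hEo' (hball ?_)
        rw [mem_closedBall, dist_eq_norm, add_sub_cancel_left, norm_smul, Real.norm_eq_abs,
          abs_of_pos (by positivity), div_mul_cancel₀ _ hn.ne']
      rw [mem_closedBall, dist_eq_norm, show x + (d / ‖x - o‖) • (x - o) - o =
        (1 + d / ‖x - o‖) • (x - o) by rw [add_smul, one_smul]; abel, norm_smul,
        Real.norm_eq_abs, abs_of_pos (by positivity), add_mul, one_mul,
        div_mul_cancel₀ _ hn.ne'] at this
      exact this
    rw [dist_eq_norm] at h1
    have h3 : R - d = ‖x - o‖ := by linarith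
    refine ⟨o, ‖x - o‖⁻¹ • (x - o), d, hEo', ?_, hd0.le, hxa, by linarith, ?_⟩
    · rw [norm_smul, norm_inv, norm_norm, inv_mul_cancel₀ hn.ne']
    · rw [h3, smul_smul, mul_inv_cancel₀ hn.ne', one_smul, add_sub_cancel]

/-- `x` is approximately a point of `E` at depth at most `a` in direction `n`. -/
def NearNormal (E : Set R3) (R a σ : ℝ) (x n : R3) : Prop :=
  ∃ (o : R3) (d : ℝ), closure E ⊆ closedBall o R ∧ ‖n‖ = 1 ∧ 0 ≤ d ∧ d ≤ a ∧ d ≤ R ∧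
    ‖o + (R - d) • n - x‖ < σ

theorem NearNormal.mono {E : Set R3} {R a σ τ : ℝ} {x y n : R3} (h : NearNormal E R a σ x n)
    (hxy : ‖x - y‖ + σ ≤ τ) : NearNormal E R a τ y n := by
  obtain ⟨o, d, h1, h2, h3, h4, h5, h6⟩ := h
  refine ⟨o, d, h1, h2, h3, h4, h5, ?_⟩
  rw [← sub_add_sub_cancel _ x y]
  exact (norm_add_le _ _).trans_lt (by linarith)

theorem NearNormal.norm_sub_le {E E' : Set R3} {R a b σ δ : ℝ} {x n y : R3}
    (h : NearNormal E R a σ x n)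
    (hEne : E.Nonempty) (hEb : Bornology.IsBounded E) (hE'b : Bornology.IsBounded E')
    (hδ : δ = hausdorffDist (closure E) (closure E')) (hb : 0 < b) (hσ : 0 ≤ σ)
    (hσa : 2 * σ ≤ a / 2)
    (hy : y ∈ E') (hyn : -σ ≤ inner ℝ (y - x) n) :
    ‖y - x‖ ≤ √((2 * (2 * a + b) + R + δ) ^ 2 - (2 * (a + b) + R) ^ 2 + (2 * b) ^ 2) + σ ∧
      y ∉ innerParallel E (2 * (a + b)) := by
  obtain ⟨o, d, h1, h2, h3, h4, h5, h6⟩ := h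
  set w : R3 := o + (R - d) • n with hw
  have hδ0 : 0 ≤ δ := hδ ▸ hausdorffDist_nonneg
  have hR : 0 ≤ R := h3.trans h5
  have hyw : -(2 * σ) ≤ inner ℝ (y - w) n := by
    have h7 : inner ℝ (y - w) n = inner ℝ (y - x) n - inner ℝ (w - x) n := by
      rw [← inner_sub_left, sub_sub_sub_cancel_right]
    have h8 := real_inner_le_norm (w - x) n
    rw [h2, mul_one] at h8
    linarith
  have hyo : y - o = (y - w) + (R - d) • n := by rw [hw]; abel
  have hsq : ‖y - o‖ ^ 2 = ‖y - w‖ ^ 2 + 2 * (R - d) * inner ℝ (y - w) n + (R - d) ^ 2 := by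
    rw [hyo, norm_add_sq_real, inner_smul_right, norm_smul, h2, mul_one, Real.norm_eq_abs, sq_abs]
    ring
  constructor
  · have hdist : ‖y - o‖ ≤ R + δ := by
      have hcb : Bornology.IsBounded (closure E) := hEb.closure
      obtain ⟨z, hz, hzd⟩ := (isCompact_of_isClosed_isBounded isClosed_closure
        hcb).exists_infDist_eq_dist hEne.closure y
      have h9 : infDist y (closure E) ≤ hausdorffDist (closure E') (closure E) :=
        infDist_le_hausdorffDist_of_mem (subset_closure hy)
          (hausdorffEDist_ne_top_of_nonempty_of_bounded ⟨y, subset_closure hy⟩ hEne.closure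
            hE'b.closure hcb)
      rw [hausdorffDist_comm, ← hδ, hzd] at h9
      have h10 := mem_closedBall.1 (h1 hz)
      rw [← dist_eq_norm]
      linarith [dist_triangle y z o]
    have h11 : ‖y - o‖ ^ 2 ≤ (R + δ) ^ 2 := pow_le_pow_left₀ (norm_nonneg _) hdist 2
    have h12 : ‖y - w‖ ≤
        √((2 * (2 * a + b) + R + δ) ^ 2 - (2 * (a + b) + R) ^ 2 + (2 * b) ^ 2) := by
      refine Real.le_sqrt_of_sq_le ?_
      have ha : 0 ≤ a := h3.trans h4
      have hRd : 0 ≤ R - d := by linarith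
      have h13 : -(2 * (R - d) * inner ℝ (y - w) n) ≤ R * a := by
        have := mul_le_mul_of_nonneg_left hyw hRd
        nlinarith
      nlinarith [mul_nonneg hR (sub_nonneg.2 h4), sq_nonneg d, mul_nonneg ha hδ0,
        mul_nonneg hb.le hδ0, mul_nonneg ha hb.le, mul_nonneg hR ha]
    calc ‖y - x‖ ≤ ‖y - w‖ + ‖w - x‖ := by
          rw [← sub_add_sub_cancel y w x]; exact norm_add_le _ _
      _ ≤ _ := by linarith
  · rintro ⟨hyE, hyd⟩
    set t := 2 * (a + b) with ht
    have ha : 0 ≤ a := h3.trans h4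
    have ht0 : 0 < t := by positivity
    have hmem : y + t • n ∈ closure E := by
      have : closedBall y t ⊆ closure E := by
        rw [← closure_ball y ht0.ne']
        exact closure_mono ((ball_subset_ball hyd.le).trans ball_infDist_compl_subset)
      refine this ?_
      rw [mem_closedBall, dist_eq_norm, add_sub_cancel_left, norm_smul, h2, mul_one,
        Real.norm_eq_abs, abs_of_pos ht0]
    have h7 := mem_closedBall.1 (h1 hmem)
    rw [dist_eq_norm] at h7
    have h8 := real_inner_le_norm (y + t • n - o) n
    have h9 : inner ℝ (y + t • n - o) n = inner ℝ (y - w) n + (R - d) + t := by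
      rw [show y + t • n - o = (y - w) + (R - d) • n + t • n by rw [hw]; abel, inner_add_left,
        inner_add_left, inner_smul_left, inner_smul_left, real_inner_self_eq_norm_sq, h2]
      simp
    rw [h2, mul_one] at h8
    linarith

theorem exists_le_inner_of_mem_convexHull {s : Set R3} {v w : R3} {c : ℝ} (hv : v ∈ convexHull ℝ s)
    (hc : c ≤ inner ℝ w v) : ∃ n ∈ s, c ≤ inner ℝ w n := by
  by_contra! h
  have hs : convexHull ℝ s ⊆ {x | inner ℝ w x < c} :=
    convexHull_min h ((convex_Iio c).linear_preimage (innerSL ℝ w).toLinearMap)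
  exact absurd (hs hv) (not_lt.2 hc)

theorem exists_continuousOn_normal {E : Set R3} {R a σ : ℝ} {f : ℂ → R3}
    (hf : ContinuousOn f (sphere 0 1))
    (h : ∀ z ∈ sphere (0 : ℂ) 1, ∃ n, NearNormal E R a σ (f z) n) :
    ∃ ν : ℂ → R3, ContinuousOn ν (sphere 0 1) ∧
      ∀ z ∈ sphere (0 : ℂ) 1, ν z ∈ convexHull ℝ {n | NearNormal E R a σ (f z) n} := by
  obtain ⟨g, hg⟩ := exists_continuous_forall_mem_convex_of_local_const
    (X := sphere (0 : ℂ) 1) (t := fun z => convexHull ℝ {n | NearNormal E R a σ (f z) n})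
    (fun z => convex_convexHull ℝ _) (fun z => by
      obtain ⟨n, o, d, h1, h2, h3, h4, h5, h6⟩ := h z z.2
      refine ⟨n, ?_⟩
      have hc : Continuous fun z : sphere (0 : ℂ) 1 => ‖o + (R - d) • n - f z‖ :=
        (continuous_const.sub (continuousOn_iff_continuous_domRestrict.1 hf)).norm
      filter_upwards [hc.continuousAt.eventually_lt continuousAt_const h6] with y hy
      exact subset_convexHull ℝ _ ⟨o, d, h1, h2, h3, h4, h5, hy⟩)
  classical
  refine ⟨fun z => if hz : z ∈ sphere (0 : ℂ) 1 then g ⟨z, hz⟩ else 0, ?_, fun z hz => ?_⟩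
  · rw [continuousOn_iff_continuous_domRestrict]
    refine g.continuous.congr fun z => ?_
    simp [mem_sphere_zero_iff_norm.1 z.2]
  · simp only [dif_pos hz]
    exact hg ⟨z, hz⟩

namespace Surf

/-- Pushing a surface in the tangential directions of a convex body. -/
theorem exists_push_normal (S : Surf) {E : Set R3} {R a σ r ρ₀ ρ₁ : ℝ}
    (hn : ∀ z ∈ closedBall (0 : ℂ) 1, ρ₀ ≤ ‖z‖ → ∃ n, NearNormal E R a σ (S.X z) n)
    (hσ : 0 < σ) (hr : 0 < r) (hρ₀ : ρ₀ < 1) (hρ₁ : ρ₁ < 1) :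
    ∃ (S' : Surf) (ρ : ℝ), ρ₁ < ρ ∧ ρ₀ < ρ ∧ 0 < ρ ∧ ρ < 1 ∧
      (∀ z ∈ closedBall (0 : ℂ) 1, ρ₀ ≤ ‖z‖ → ∃ n, NearNormal E R a (2 * σ) (S.X z) n ∧
        -(2 * σ) ≤ inner ℝ (S'.X z - S.X z) n) ∧
      (∀ z, ‖z‖ ≤ ρ → ‖S'.X z - S.X z‖ ≤ σ) ∧
      (∀ z ∈ sphere (0 : ℂ) 1, r - σ ≤ ‖S'.X z - S.X z‖) ∧
      ∀ t ∈ Icc 0 ρ, S.m t - σ ≤ S'.m t := by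
  have hc := S.continuousOn_X.mono S.closedBall_subset
  obtain ⟨ρ, hρ, hρ0, hρ1, hcol⟩ := exists_collar hc hσ (max_lt hρ₀ hρ₁)
  obtain ⟨ν, hν, hνm⟩ := exists_continuousOn_normal (E := E) (R := R) (a := a) (σ := σ)
    (hc.mono sphere_subset_closedBall) fun z hz => hn z (sphere_subset_closedBall hz) (by
      rw [mem_sphere_zero_iff_norm.1 hz]; exact hρ₀.le)
  obtain ⟨S', hS', hm, -⟩ := S.exists_push hν hr hσ hρ0.le hρ1
  refine ⟨S', ρ, (le_max_right _ _).trans_lt hρ, (le_max_left _ _).trans_lt hρ, hρ0, hρ1,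
    fun z hz hz0 => ?_, fun z hz => ?_, fun z hz => ?_, hm⟩
  · obtain ⟨D, h1, -, h3, h4, -⟩ := hS' z hz
    by_cases hzρ : ‖z‖ ≤ ρ
    · obtain ⟨n, hnn⟩ := hn z hz hz0
      refine ⟨n, hnn.mono (by rw [sub_self, norm_zero]; linarith), ?_⟩
      rw [h4 hzρ, sub_zero] at h1
      obtain ⟨-, -, -, hn1, -⟩ := hnn
      have := neg_le_of_abs_le (abs_real_inner_le_norm (S'.X z - S.X z) n)
      rw [hn1, mul_one] at this
      linarith
    · obtain ⟨hw, hw2⟩ := hcol z hz (not_le.1 hzρ).le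
      have hle : -σ ≤ inner ℝ D (ν (z / ‖z‖)) := neg_le_of_abs_le h3
      obtain ⟨n, hnn, hn2⟩ := exists_le_inner_of_mem_convexHull (hνm _ hw) hle
      refine ⟨n, NearNormal.mono hnn (by rw [norm_sub_rev]; linarith), ?_⟩
      obtain ⟨-, -, -, hn1, -⟩ := hnn
      have := neg_le_of_abs_le (abs_real_inner_le_norm (S'.X z - S.X z - D) n)
      rw [hn1, mul_one, inner_sub_left] at this
      linarith
  · have hz1 : z ∈ closedBall (0 : ℂ) 1 := by simpa using hz.trans hρ1.le
    obtain ⟨D, h1, -, -, h4, -⟩ := hS' z hz1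
    rwa [h4 hz, sub_zero] at h1
  · obtain ⟨D, h1, -, -, -, h5⟩ := hS' z (sphere_subset_closedBall hz)
    have h6 := h5 (mem_sphere_zero_iff_norm.1 hz)
    have h7 := norm_sub_norm_le D (S'.X z - S.X z)
    have h8 : ‖D - (S'.X z - S.X z)‖ = ‖S'.X z - S.X z - D‖ := norm_sub_rev _ _
    linarith

end Surf

namespace Surf

/-- Linear functions of a surface are real parts of holomorphic functions. -/
theorem exists_re_eq (S : Surf) (f : R3 →L[ℝ] ℝ) : ∃ h : ℂ → ℂ,
    DifferentiableOn ℂ h (ball 0 S.R) ∧ ∀ z, f (S.X z) = (h z).re := by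
  refine ⟨fun z => ∑ i, (f (EuclideanSpace.single i 1) : ℂ) * S.H i z, ?_, fun z => ?_⟩
  · refine DifferentiableOn.fun_sum fun i _ => DifferentiableOn.const_mul ?_ _
    exact fun z hz => (S.hasDerivAt_H i hz).differentiableAt.differentiableWithinAt
  · have h1 : S.X z = ∑ i, (S.H i z).re • EuclideanSpace.single i (1 : ℝ) := by
      ext j
      simp [Surf.X, reV_apply, Fin.sum_univ_three]
      fin_cases j <;> simp
    rw [h1, map_sum, Complex.re_sum]
    refine Finset.sum_congr rfl fun i _ => ?_
    rw [map_smul, smul_eq_mul, Complex.re_ofReal_mul, mul_comm]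

theorem le_of_frontier_le (S : Surf) (f : R3 →L[ℝ] ℝ) {U : Set ℂ} {c : ℝ}
    (hU : Bornology.IsBounded U) (hUS : closure U ⊆ ball 0 S.R)
    (hc : ∀ z ∈ frontier U, f (S.X z) ≤ c) {z : ℂ} (hz : z ∈ closure U) : f (S.X z) ≤ c := by
  obtain ⟨h, hd, hf⟩ := S.exists_re_eq f
  have h1 := Complex.norm_le_of_forall_mem_frontier_norm_le (f := fun z => Complex.exp (h z))
    (C := Real.exp c) hU
    ((DifferentiableOn.mono hd hUS).cexp.diffContOnCl) (fun z hz => by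
      rw [Complex.norm_exp, ← hf, Real.exp_le_exp]
      exact hc z hz) hz
  rwa [Complex.norm_exp, ← hf, Real.exp_le_exp] at h1

theorem not_isLocalMax (S : Surf) (f : R3 →L[ℝ] ℝ) {z w : ℂ} (hz : z ∈ ball 0 S.R)
    (hw : w ∈ ball 0 S.R) (hzw : f (S.X w) ≠ f (S.X z)) :
    ¬ IsLocalMax (fun z => f (S.X z)) z := by
  intro hmax
  obtain ⟨h, hd, hf⟩ := S.exists_re_eq f
  have hd' : DifferentiableOn ℂ (fun z => Complex.exp (h z)) (ball 0 S.R) := hd.cexp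
  have hn : ∀ z, ‖Complex.exp (h z)‖ = Real.exp (f (S.X z)) := fun z => by
    rw [Complex.norm_exp, ← hf]
  have h1 : ∀ᶠ y in nhds z, Complex.exp (h y) = Complex.exp (h z) := by
    refine Complex.eventually_eq_of_isLocalMax_norm ?_ ?_
    · filter_upwards [isOpen_ball.mem_nhds hz] with y hy
      exact hd'.differentiableAt (isOpen_ball.mem_nhds hy)
    · filter_upwards [hmax] with y hy
      simp only [Function.comp_apply, hn]
      exact Real.exp_le_exp.2 hy
  have h2 := (hd'.analyticOnNhd isOpen_ball).eqOn_of_preconnected_of_eventuallyEq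
    analyticOnNhd_const (convex_ball (0 : ℂ) S.R).isPreconnected hz h1 hw
  apply hzw
  have h3 := congrArg norm h2
  rw [hn, hn] at h3
  exact Real.exp_injective h3

/-- The convex hull property of minimal surfaces. -/
theorem mem_of_sphere_subset (S : Surf) {C : Set R3} (hC : Convex ℝ C) (hCo : IsOpen C)
    (h : ∀ z ∈ sphere (0 : ℂ) 1, S.X z ∈ C) {z : ℂ} (hz : z ∈ closedBall (0 : ℂ) 1) :
    S.X z ∈ C := by
  by_contra hn
  obtain ⟨f, hf⟩ := geometric_hahn_banach_open_point hC hCo hn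
  have hcont : ContinuousOn (fun z => f (S.X z)) (sphere 0 1) :=
    f.continuous.comp_continuousOn (S.continuousOn_X.mono
      (sphere_subset_closedBall.trans S.closedBall_subset))
  obtain ⟨w, hw, hmax⟩ := (isCompact_sphere (0 : ℂ) 1).exists_isMaxOn
    ⟨1, by simp⟩ hcont
  have h1 := S.le_of_frontier_le f (U := ball 0 1) (c := f (S.X w)) isBounded_ball
    (by rw [closure_ball _ one_ne_zero]; exact S.closedBall_subset)
    (fun y hy => by
      rw [frontier_ball _ one_ne_zero] at hy
      exact hmax hy) (z := z) (by rwa [closure_ball _ one_ne_zero])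
  exact absurd (hf _ (h w hw)) (not_lt.2 h1)

/-- The part of a surface in a convex set has no holes. -/
theorem noHole_component (S : Surf) {C : Set R3} (hC : Convex ℝ C) (hCo : IsOpen C) (h0 : 0 ∈ C)
    {O : Set ℂ} (hO : O = ball 0 1 ∩ S.X ⁻¹' C) (hcl : closure O ⊆ ball 0 1) :
    NoHole (connectedComponentIn O 0) := by
  have h1R := S.hR
  have hballR : ball (0 : ℂ) 1 ⊆ ball 0 S.R := ball_subset_ball h1R.le
  have hOo : IsOpen O := hO ▸ (S.continuousOn_X.mono hballR).isOpen_inter_preimage isOpen_ball hCo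
  set W := connectedComponentIn O 0 with hW
  have hWO : W ⊆ O := connectedComponentIn_subset _ _
  have hWcl : closure W ⊆ ball 0 1 := (closure_mono hWO).trans hcl
  intro K hKW hK hKc
  set U := W ∪ K with hUdef
  have hU : IsOpen U := by
    rw [← isClosed_compl_iff]
    convert hKc using 1
    rw [hUdef, compl_union]; rfl
  have hbW : Bornology.IsBounded W :=
    isBounded_ball.subset (subset_closure.trans hWcl)
  have hbU : Bornology.IsBounded U := hbW.union hK.isBounded
  have hfr : frontier U ⊆ closure W := by
    intro z hz
    rw [frontier, hUdef, closure_union, hK.isClosed.closure_eq, ← hUdef, hU.interior_eq] at hz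
    rcases hz.1 with h | h
    · exact h
    · exact absurd (mem_union_right W h) hz.2
  have hcK : closure U = closure W ∪ K := by rw [hUdef, closure_union, hK.isClosed.closure_eq]
  have hUball : closure U ⊆ ball 0 1 := by
    rcases U.eq_empty_or_nonempty with hUe | hUne
    · rw [hUe, closure_empty]; exact empty_subset _
    obtain ⟨z, hz, hmax⟩ := hbU.isCompact_closure.exists_isMaxOn hUne.closure
      continuous_norm.continuousOn
    have hzf : z ∈ closure W := by
      refine hfr ⟨hz, fun hzi => ?_⟩
      have h1 : IsLocalMax (norm : ℂ → ℝ) z :=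
        (hmax.on_subset subset_closure).isLocalMax (mem_interior_iff_mem_nhds.1 hzi)
      have hev : ∀ᶠ t : ℝ in nhdsWithin 1 (Ioi 1), ‖(t : ℂ) * z‖ ≤ ‖z‖ := by
        have hc : Filter.Tendsto (fun t : ℝ => (t : ℂ) * z) (nhdsWithin 1 (Ioi 1)) (nhds z) := by
          have : Continuous fun t : ℝ => (t : ℂ) * z := by fun_prop
          simpa using (this.tendsto 1).mono_left nhdsWithin_le_nhds
        exact hc.eventually h1
      obtain ⟨t, ht1, ht2⟩ := (hev.and self_mem_nhdsWithin).exists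
      rw [norm_mul, Complex.norm_real, Real.norm_eq_abs, abs_of_pos (one_pos.trans ht2)] at ht1
      have hz0 : z = 0 := by
        rw [← norm_eq_zero]
        have : (1 : ℝ) < t := ht2
        nlinarith [norm_nonneg z]
      subst hz0
      have h2 : U ⊆ {0} := fun y hy => by
        have := hmax (subset_closure hy)
        simpa using this
      have h3 : (interior ({0} : Set ℂ)).Nonempty :=
        hUne.mono (hU.subset_interior_iff.2 h2)
      rw [interior_singleton] at h3
      exact h3.ne_empty rfl
    intro y hy
    have h2 := hmax hy
    have h3 := mem_ball_zero_iff.1 (hWcl hzf)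
    rw [mem_ball_zero_iff]
    exact lt_of_le_of_lt h2 h3
  have hKC : ∀ k ∈ K, S.X k ∈ C := by
    intro k hk
    by_contra hn
    obtain ⟨f, hf⟩ := geometric_hahn_banach_open_point hC hCo hn
    have hkU : k ∈ U := mem_union_right _ hk
    refine S.not_isLocalMax f (hballR (hUball (subset_closure hkU)))
      (mem_ball_self (one_pos.trans h1R)) (z := k) (w := 0) ?_ ?_
    · rw [S.X_zero]
      exact (hf _ h0).ne
    · filter_upwards [hU.mem_nhds hkU] with y hy
      refine S.le_of_frontier_le f hbU (hUball.trans hballR) (fun w hw => ?_) (subset_closure hy)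
      have hcW : ContinuousOn (fun z => f (S.X z)) (closure W) :=
        f.continuous.comp_continuousOn (S.continuousOn_X.mono (hWcl.trans hballR))
      have h4 := hcW.image_closure ⟨w, hfr hw, rfl⟩
      have h5 : closure ((fun z => f (S.X z)) '' W) ⊆ Iic (f (S.X k)) := by
        refine closure_minimal ?_ isClosed_Iic
        rintro _ ⟨y, hy, rfl⟩
        have : y ∈ O := hWO hy
        rw [hO] at this
        exact (hf _ this.2).le
      exact h5 h4
  have hUO : U ⊆ O := by
    rintro z (hz | hz)
    · exact hWO hz
    · rw [hO]
      exact ⟨hUball (subset_closure (mem_union_right _ hz)), hKC z hz⟩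
  have hKo : IsOpen K := by
    rw [isOpen_iff_mem_nhds]
    intro k hk
    have hkU : k ∈ U := mem_union_right _ hk
    have h6 : connectedComponentIn O k ∈ nhds k :=
      hOo.connectedComponentIn.mem_nhds (mem_connectedComponentIn (hUO hkU))
    filter_upwards [h6, hU.mem_nhds hkU] with y hy hyU
    rcases hyU with hyW | hyK
    · exfalso
      have h7 := connectedComponentIn_eq hy
      have h8 := connectedComponentIn_eq hyW
      apply hKW hk
      rw [hW, h8, ← h7]
      exact mem_connectedComponentIn (hUO hkU)
    · exact hyK
  by_contra hKne
  have h9 := IsClopen.eq_univ ⟨hK.isClosed, hKo⟩ (nonempty_iff_ne_empty.2 hKne)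
  rw [h9] at hK
  exact NormedSpace.unbounded_univ ℝ ℂ hK.isBounded

end Surf

theorem exists_pos_le_infDist_compl {E E' : Set R3} (hEb : Bornology.IsBounded E)
    (hne : E.Nonempty) (hE'o : IsOpen E') (hE'b : Bornology.IsBounded E') (h : closure E ⊆ E') :
    ∃ θ > 0, ∀ x ∈ E, θ ≤ infDist x E'ᶜ := by
  have hne' : (E'ᶜ).Nonempty := by
    rw [nonempty_compl]
    rintro rfl
    exact NormedSpace.unbounded_univ ℝ R3 hE'b
  obtain ⟨x, hx, hmin⟩ := hEb.isCompact_closure.exists_isMinOn hne.closure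
    (continuous_infDist_pt E'ᶜ).continuousOn
  refine ⟨infDist x E'ᶜ, ?_, fun y hy => hmin (subset_closure hy)⟩
  exact (hE'o.isClosed_compl.notMem_iff_infDist_pos hne').1 (by simpa using h hx)

namespace Surf

theorem exists_integral_le (S : Surf) {ρ₀ L : ℝ} (hρ₀ : 0 ≤ ρ₀)
    (hL : L + 1 ≤ ∫ t in ρ₀..1, S.m t) :
    ∃ ρ₁ < 1, ∀ ρ, ρ₁ < ρ → ρ₀ < ρ → ρ < 1 → L ≤ ∫ t in ρ₀..ρ, S.m t := by
  obtain ⟨C, hC⟩ := isCompact_Icc.exists_bound_of_continuousOn (s := Icc (0 : ℝ) 1)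
    S.continuous_m.continuousOn
  have hC0 : 0 ≤ C := (norm_nonneg _).trans (hC 0 (by simp))
  refine ⟨1 - 1 / (C + 1), by have : 0 < 1 / (C + 1) := by positivity
                              linarith, fun ρ h1 h2 h3 => ?_⟩
  have hi : ∀ x y : ℝ, IntervalIntegrable S.m MeasureTheory.volume x y :=
    fun x y => S.continuous_m.intervalIntegrable x y
  rw [← intervalIntegral.integral_add_adjacent_intervals (hi ρ₀ ρ) (hi ρ 1)] at hL
  have h4 := intervalIntegral.norm_integral_le_of_norm_le_const (a := ρ) (b := 1) (C := C)
    (f := S.m) fun t ht => hC t (by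
      rw [uIoc_of_le h3.le] at ht
      exact ⟨hρ₀.trans (h2.le.trans ht.1.le), ht.2⟩)
  rw [abs_of_pos (by linarith)] at h4
  have h5 : 1 - ρ ≤ 1 / (C + 1) := by linarith
  rw [le_div_iff₀ (by positivity)] at h5
  have h6 := (Real.le_norm_self _).trans h4
  nlinarith

/-- The analytic heart of the construction: a surface close to `E` is lengthened, pushed out of a
larger convex set `E'` along tangent planes, and cut along a level set of `∂E'`. -/
theorem exists_cut (S₀ : Surf) {E E' : Set R3} {R a b δ ρ₀ e L : ℝ} (hE : Convex ℝ E)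
    (hEo : IsOpen E) (hEb : Bornology.IsBounded E) (h0 : 0 ∈ E) (hE' : Convex ℝ E')
    (hE'o : IsOpen E') (hE'b : Bornology.IsBounded E') (hEE' : closure E ⊆ E')
    (hR : ExtSphereRadius E R) (hδ : δ = hausdorffDist (closure E) (closure E')) (ha : 0 < a)
    (hb : 0 < b) (he : 0 < e) (hL : 0 < L) (hρ₀ : 0 ≤ ρ₀) (hρ₀1 : ρ₀ < 1)
    (hX : ∀ z ∈ closedBall (0 : ℂ) 1, ρ₀ ≤ ‖z‖ → S₀.X z ∈ E ∧ infDist (S₀.X z) Eᶜ ≤ a) :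
    ∃ (S : Surf) (ρ b₀ : ℝ) (W : Set ℂ), ρ₀ < ρ ∧ ρ < 1 ∧ 0 < b₀ ∧ b₀ < b ∧ IsOpen W ∧
      IsPreconnected W ∧ NoHole W ∧ closedBall 0 ρ ⊆ W ∧ closure W ⊆ ball 0 1 ∧
      (∀ z ∈ ball (0 : ℂ) S.R, S.u z ≠ 0 ∨ S.v z ≠ 0) ∧
      (∀ z ∈ closedBall (0 : ℂ) ρ, ‖S.X z - S₀.X z‖ ≤ e) ∧
      (∀ z ∈ closure W, ρ₀ ≤ ‖z‖ →
        ‖S.X z - S₀.X z‖ ≤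
          √((2 * (2 * a + b) + R + δ) ^ 2 - (2 * (a + b) + R) ^ 2 + (2 * b) ^ 2) + e ∧
        S.X z ∉ innerParallel E (2 * (a + b))) ∧
      (∀ z ∈ closure W, S.X z ∈ E') ∧ (∀ z ∈ frontier W, infDist (S.X z) E'ᶜ = b₀) ∧
      L ≤ ∫ t in ρ₀..ρ, S.m t := by
  obtain ⟨θ, hθ, hθE⟩ := exists_pos_le_infDist_compl hEb ⟨0, h0⟩ hE'o hE'b hEE'
  obtain ⟨K, hK⟩ := hE'b.exists_norm_le
  have hK0 : 0 ≤ K := (norm_nonneg _).trans (hK 0 (hEE' (subset_closure h0)))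
  set e₁ : ℝ := min (min (1 / 3) (a / 24)) (min (e / 6) (θ / 16)) with he₁
  have he₁0 : 0 < e₁ := lt_min (lt_min (by norm_num) (by positivity))
    (lt_min (by positivity) (by positivity))
  have he₁3 : e₁ ≤ 1 / 3 := (min_le_left _ _).trans (min_le_left _ _)
  have he₁a : e₁ ≤ a / 24 := (min_le_left _ _).trans (min_le_right _ _)
  have he₁e : e₁ ≤ e / 6 := (min_le_right _ _).trans (min_le_left _ _)
  have he₁θ : e₁ ≤ θ / 16 := (min_le_right _ _).trans (min_le_right _ _)
  obtain ⟨S₁, hS₁, hL₁⟩ := S₀.exists_long (l := L + 1 + 1) he₁0 (by positivity) hρ₀ hρ₀1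
  obtain ⟨ρ₁, hρ₁, hL₂⟩ := S₁.exists_integral_le hρ₀ hL₁
  have hball : sphere (0 : ℂ) 1 ⊆ closedBall 0 1 := sphere_subset_closedBall
  obtain ⟨S₂, ρ, hρ₁ρ, hρ₀ρ, hρ0, hρ1, hn₂, hin₂, hout₂, hm₂⟩ := S₁.exists_push_normal
    (E := E) (R := R) (a := a) (σ := 2 * e₁) (r := 2 * K + 1 + 5 * e₁) (ρ₀ := ρ₀) (ρ₁ := ρ₁)
    (fun z hz hz0 => by
      obtain ⟨h1, h2⟩ := hX z hz hz0
      obtain ⟨o, n, d, g1, g2, g3, g4, g5, g6⟩ := hR.exists_normal hEo hEb h1 h2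
      refine ⟨n, o, d, g1, g2, g3, g4, g5, ?_⟩
      rw [← g6, norm_sub_rev]
      have := hS₁ z hz
      linarith) (by positivity) (by positivity) hρ₀1 hρ₁
  obtain ⟨S, -, hne, hS⟩ := S₂.exists_ne_zero_near he₁0
  have hcb : ContinuousOn S.X (closedBall 0 1) := S.continuousOn_X.mono S.closedBall_subset
  set b₀ : ℝ := min b θ / 2 with hb₀
  have hb₀0 : 0 < b₀ := half_pos (lt_min hb hθ)
  have hb₀b : b₀ < b := by linarith [min_le_left b θ]
  have hb₀θ : b₀ ≤ θ / 2 := by linarith [min_le_right b θ]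
  set C : Set R3 := innerParallel E' b₀ with hC
  have hE'ne : (E'ᶜ).Nonempty := by
    rw [nonempty_compl]
    rintro rfl
    exact NormedSpace.unbounded_univ ℝ R3 hE'b
  have hposE' : ∀ x, 0 < infDist x E'ᶜ → x ∈ E' := fun x hx => by
    simpa using (hE'o.isClosed_compl.notMem_iff_infDist_pos hE'ne).2 hx
  have hCeq : C = {x | b₀ < infDist x E'ᶜ} := by
    ext x
    exact ⟨fun h => h.2, fun h => ⟨hposE' x (hb₀0.trans h), h⟩⟩
  have hCo : IsOpen C := by
    rw [hCeq]
    exact isOpen_lt continuous_const (continuous_infDist_pt _)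
  have hCc : Convex ℝ C := by
    intro x hx y hy s t hs ht hst
    refine hCeq ▸ ?_
    have key : ∀ w ∈ ball (0 : R3) (min (infDist x E'ᶜ) (infDist y E'ᶜ)),
        s • x + t • y + w ∈ E' := by
      intro w hw
      rw [mem_ball_zero_iff] at hw
      have h1 : x + w ∈ E' := ball_infDist_compl_subset (x := x) (by
        rw [mem_ball, dist_eq_norm, add_sub_cancel_left]
        exact hw.trans_le (min_le_left _ _))
      have h2 : y + w ∈ E' := ball_infDist_compl_subset (x := y) (by
        rw [mem_ball, dist_eq_norm, add_sub_cancel_left]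
        exact hw.trans_le (min_le_right _ _))
      have h3 := hE' h1 h2 hs ht hst
      have h4 : s • (x + w) + t • (y + w) = s • x + t • y + (s + t) • w := by
        rw [smul_add, smul_add, add_smul]; abel
      rwa [h4, hst, one_smul] at h3
    rw [mem_ofPred_eq]
    refine (lt_min hx.2 hy.2).trans_le ((le_infDist hE'ne).2 fun w hw => ?_)
    by_contra! hlt
    have := key (w - (s • x + t • y)) (by
      rw [mem_ball_zero_iff, ← dist_eq_norm, dist_comm]; exact hlt)
    rw [add_sub_cancel] at this
    exact hw this
  set O : Set ℂ := ball 0 1 ∩ S.X ⁻¹' C with hO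
  have hXE : ∀ z ∈ closedBall (0 : ℂ) 1, S₀.X z ∈ E := fun z hz =>
    S₀.mem_of_sphere_subset hE hEo (fun w hw => (hX w (hball hw) (by
      rw [mem_sphere_zero_iff_norm.1 hw]; exact hρ₀1.le)).1) hz
  have hclose : ∀ z ∈ closedBall (0 : ℂ) ρ, ‖S.X z - S₀.X z‖ ≤ 4 * e₁ := by
    intro z hz
    have hz1 : z ∈ closedBall (0 : ℂ) 1 := closedBall_subset_closedBall hρ1.le hz
    have h1 := hin₂ z (by simpa using hz)
    have h2 := hS₁ z hz1
    have h3 := (hS z hz1).1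
    rw [show S.X z - S₀.X z = (S.X z - S₂.X z) + (S₂.X z - S₁.X z) + (S₁.X z - S₀.X z) by abel]
    refine (norm_add₃_le).trans ?_
    linarith
  have hρO : closedBall 0 ρ ⊆ O := by
    intro z hz
    refine ⟨closedBall_subset_ball hρ1 hz, ?_⟩
    rw [mem_preimage, hCeq]
    have h1 := hθE _ (hXE z (closedBall_subset_closedBall hρ1.le hz))
    have h2 : infDist (S₀.X z) E'ᶜ ≤ infDist (S.X z) E'ᶜ + dist (S₀.X z) (S.X z) :=
      infDist_le_infDist_add_dist
    have h3 := hclose z hz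
    rw [norm_sub_rev, ← dist_eq_norm] at h3
    show b₀ < infDist (S.X z) E'ᶜ
    linarith
  have hOcl' : closure O ⊆ closedBall 0 1 ∩ {z | b₀ ≤ infDist (S.X z) E'ᶜ} := by
    have h1 : closure O ⊆ closedBall (0 : ℂ) 1 := by
      refine closure_minimal ?_ isClosed_closedBall
      exact inter_subset_left.trans ball_subset_closedBall
    intro z hz
    refine ⟨h1 hz, ?_⟩
    have h2 : ContinuousOn (fun z => infDist (S.X z) E'ᶜ) (closure O) :=
      (continuous_infDist_pt _).comp_continuousOn (hcb.mono h1)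
    have h3 := h2.image_closure ⟨z, hz, rfl⟩
    refine closure_minimal ?_ isClosed_Ici h3
    rintro _ ⟨y, hy, rfl⟩
    exact hy.2.2.le
  have hOcl : closure O ⊆ ball 0 1 := by
    intro z hz
    obtain ⟨h1, h2⟩ := hOcl' hz
    rw [mem_ball_zero_iff]
    refine lt_of_le_of_ne (by simpa using h1) fun hz1 => ?_
    have hzs : z ∈ sphere (0 : ℂ) 1 := by simpa using hz1
    have g1 := hout₂ z hzs
    have g2 := hS₁ z h1
    have g3 := (hS z h1).1
    have g4 := hK _ (hposE' _ (hb₀0.trans_le h2))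
    have g5 := hK _ (hEE' (subset_closure (hXE z h1)))
    have g6 : ‖S₂.X z - S₁.X z‖ ≤ e₁ + (K + K) + e₁ := by
      rw [show S₂.X z - S₁.X z = -(S.X z - S₂.X z) + (S.X z - S₀.X z) + -(S₁.X z - S₀.X z) by abel]
      refine (norm_add₃_le).trans ?_
      rw [norm_neg, norm_neg]
      have := norm_sub_le (S.X z) (S₀.X z)
      linarith
    linarith
  set W := connectedComponentIn O 0 with hW
  have hOo : IsOpen O := (hcb.mono ball_subset_closedBall).isOpen_inter_preimage isOpen_ball hCo
  have h0ρ : (0 : ℂ) ∈ closedBall 0 ρ := mem_closedBall_self hρ0.le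
  have hWO : W ⊆ O := connectedComponentIn_subset _ _
  have hWcl : closure W ⊆ closure O := closure_mono hWO
  refine ⟨S, ρ, b₀, W, hρ₀ρ, hρ1, hb₀0, hb₀b, hOo.connectedComponentIn,
    isPreconnected_connectedComponentIn, ?_, ?_, hWcl.trans hOcl, hne, fun z hz => ?_,
    fun z hz hz0 => ?_, fun z hz => ?_, fun z hz => ?_, ?_⟩
  · refine S.noHole_component hCc hCo ?_ hO hOcl
    have := (hρO h0ρ).2
    rwa [mem_preimage, S.X_zero] at this
  · exact (convex_closedBall (0 : ℂ) ρ).isPreconnected.subset_connectedComponentIn h0ρ hρO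
  · exact (hclose z hz).trans (by linarith)
  · obtain ⟨h1, h2⟩ := hOcl' (hWcl hz)
    obtain ⟨n, hn, hin⟩ := hn₂ z h1 hz0
    have g2 := hS₁ z h1
    have g3 := (hS z h1).1
    have hn' : NearNormal E R a (6 * e₁) (S₀.X z) n := hn.mono (by linarith)
    have hn1 : ‖n‖ = 1 := by
      obtain ⟨-, -, -, hn1, -⟩ := hn
      exact hn1
    have hinner : -(6 * e₁) ≤ inner ℝ (S.X z - S₀.X z) n := by
      rw [show S.X z - S₀.X z = (S.X z - S₂.X z) + (S₂.X z - S₁.X z) + (S₁.X z - S₀.X z) by abel,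
        inner_add_left, inner_add_left]
      have g4 := neg_le_of_abs_le (abs_real_inner_le_norm (S.X z - S₂.X z) n)
      have g5 := neg_le_of_abs_le (abs_real_inner_le_norm (S₁.X z - S₀.X z) n)
      rw [hn1, mul_one] at g4 g5
      linarith
    obtain ⟨r1, r2⟩ := hn'.norm_sub_le ⟨0, h0⟩ hEb hE'b hδ hb (by positivity) (by linarith)
      (hposE' _ (hb₀0.trans_le h2)) hinner
    exact ⟨r1.trans (by linarith), r2⟩
  · exact hposE' _ (hb₀0.trans_le (hOcl' (hWcl hz)).2)
  · refine le_antisymm (not_lt.1 fun hlt => ?_) (hOcl' (hWcl hz.1)).2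
    have hzO : z ∈ O := ⟨hOcl (hWcl hz.1), by rw [mem_preimage, hCeq]; exact hlt⟩
    obtain ⟨y, hy, hyW⟩ := mem_closure_iff.1 hz.1 _ hOo.connectedComponentIn
      (mem_connectedComponentIn hzO)
    have h7 := connectedComponentIn_eq hy
    have h8 := connectedComponentIn_eq hyW
    have : z ∈ W := by
      rw [hW, h8, ← h7]
      exact mem_connectedComponentIn hzO
    refine hz.2 ?_
    rwa [hOo.connectedComponentIn.interior_eq]
  · have hi : ∀ T : Surf, IntervalIntegrable T.m MeasureTheory.volume ρ₀ ρ :=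
      fun T => T.continuous_m.intervalIntegrable _ _
    have h1 := hL₂ ρ hρ₁ρ hρ₀ρ hρ1
    have h2 := intervalIntegral.integral_mono_on hρ₀ρ.le
      ((hi S₁).sub (intervalIntegrable_const (c := 3 * e₁))) (hi S) fun t ht => by
        have ht0 : 0 ≤ t := hρ₀.trans ht.1
        refine S.le_m ⟨ht0, ht.2.trans hρ1.le⟩ fun z hz => ?_
        have hz1 : z ∈ closedBall (0 : ℂ) 1 := by simpa [hz] using ht.2.trans hρ1.le
        have g1 := hm₂ t ⟨ht0, ht.2⟩
        have g2 := (hS z hz1).2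
        have g3 := S₂.m_le (z := z) (by rw [hz]; exact ht.2.trans hρ1.le)
        rw [hz] at g3
        linarith
    rw [intervalIntegral.integral_sub (hi S₁) intervalIntegrable_const,
      intervalIntegral.integral_const, smul_eq_mul] at h2
    nlinarith

end Surf

/-- Piecewise linear interpolation of a curve at the points `k / N`. -/
def interp (c : ℝ → ℂ) (N : ℕ) (t : ℝ) : ℂ :=
  c (⌊t * N⌋ / N) + (Int.fract (t * N)) • (c ((⌊t * N⌋ + 1) / N) - c (⌊t * N⌋ / N))

section

variable {c : ℝ → ℂ} {N : ℕ}

theorem continuous_interp (c : ℝ → ℂ) (N : ℕ) : Continuous (interp c N) := by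
  have h := continuous_floor_fract
    (ψ := fun n : ℤ => fun t : ℝ => c (n / N) + t • (c ((n + 1) / N) - c (n / N)))
    (fun n => by fun_prop) (fun n => by simp)
  exact h.comp (continuous_mul_const (N : ℝ))

theorem interp_eq (hN : 0 < N) {k : ℤ} {t : ℝ} (ht : t ∈ Icc ((k : ℝ) / N) ((k + 1) / N)) :
    interp c N t = c (k / N) + (t * N - k) • (c ((k + 1) / N) - c (k / N)) := by
  have hN' : (0 : ℝ) < N := by exact_mod_cast hN
  have h1 : (k : ℝ) ≤ t * N := (div_le_iff₀ hN').1 ht.1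
  have h2 : t * N ≤ k + 1 := (le_div_iff₀ hN').1 ht.2
  rcases h2.lt_or_eq with h2 | h2
  · have h3 : ⌊t * N⌋ = k := Int.floor_eq_iff.2 ⟨h1, h2⟩
    rw [interp, Int.fract, h3]
  · have h3 : ⌊t * N⌋ = k + 1 := by
      rw [h2]
      exact_mod_cast Int.floor_intCast (k + 1)
    rw [interp, Int.fract, h3, h2]
    push_cast
    simp

theorem interp_node (hN : 0 < N) (k : ℤ) : interp c N (k / N) = c (k / N) := by
  have hN' : (0 : ℝ) < N := by exact_mod_cast hN
  rw [interp_eq hN (k := k) ⟨le_rfl, by gcongr; linarith⟩, div_mul_cancel₀ _ hN'.ne', sub_self,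
    zero_smul, add_zero]

theorem mem_Ico_floor (hN : 0 < N) (t : ℝ) :
    t ∈ Ico ((⌊t * N⌋ : ℝ) / N) ((⌊t * N⌋ + 1) / N) := by
  have hN' : (0 : ℝ) < N := by exact_mod_cast hN
  exact ⟨(div_le_iff₀ hN').2 (Int.floor_le _), (lt_div_iff₀ hN').2 (Int.lt_floor_add_one _)⟩

theorem hasDerivWithinAt_interp (hN : 0 < N) (t : ℝ) :
    HasDerivWithinAt (interp c N)
      ((N : ℝ) • (c ((⌊t * N⌋ + 1) / N) - c (⌊t * N⌋ / N))) (Ici t) t := by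
  set k := ⌊t * N⌋ with hk
  have hmem := mem_Ico_floor hN t
  rw [← hk] at hmem
  have h1 : HasDerivWithinAt (fun s : ℝ => c (k / N) + (s * N - k) • (c ((k + 1) / N) - c (k / N)))
      ((N : ℝ) • (c ((k + 1) / N) - c (k / N))) (Ici t) t := by
    have h2 : HasDerivAt (fun s : ℝ => s * N - k) (N : ℝ) t := by
      simpa using ((hasDerivAt_id t).mul_const (N : ℝ)).sub_const (k : ℝ)
    exact ((h2.smul_const _).const_add _).hasDerivWithinAt
  refine h1.congr_of_eventuallyEq ?_ (interp_eq hN (Ico_subset_Icc_self hmem))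
  filter_upwards [Ico_mem_nhdsGE hmem.2] with s hs
  exact interp_eq hN ⟨hmem.1.trans hs.1, hs.2.le⟩

/-- A closed `C¹` curve with a lower Lipschitz bound has inscribed polygons close to it. -/
theorem exists_polygon_near {c' : ℝ → ℂ} {κ τ : ℝ} (hc : ∀ t, HasDerivAt c (c' t) t)
    (hc' : Continuous c') (hper : Periodic c 1) (hκ0 : 0 < κ)
    (hκ : ∀ s t, |s - t| ≤ 1 / 2 → κ * |s - t| ≤ ‖c s - c t‖) (hτ : 0 < τ) :
    ∃ q, PolygonParam q ∧ ∀ t, ‖q t - c t‖ ≤ τ := by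
  have hper' : Periodic c' 1 := fun t => by
    have h1 := (hc (t + 1)).comp_add_const t 1
    have h2 : (fun x => c (x + 1)) = c := funext hper
    rw [h2] at h1
    exact h1.unique (hc t)
  set η := min τ (κ / 2) with hη
  have hη0 : 0 < η := lt_min hτ (by positivity)
  obtain ⟨δ, hδ, huc⟩ :=
    Metric.uniformContinuous_iff.1 (uniformContinuous_of_periodic hc' hper') η hη0
  obtain ⟨n, hn⟩ := exists_nat_one_div_lt hδ
  set N : ℕ := n + 1 with hN
  have hN0 : 0 < N := Nat.succ_pos n
  have hN' : (0 : ℝ) < N := by exact_mod_cast hN0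
  have hNδ : 1 / (N : ℝ) < δ := by rw [hN]; push_cast; exact hn
  have hlip : ∀ s t, s ≤ t → ‖(interp c N t - c t) - (interp c N s - c s)‖ ≤ η * (t - s) := by
    intro s t hst
    refine norm_image_sub_le_of_norm_deriv_right_le_segment (a := s) (b := t)
      (f := fun t => interp c N t - c t)
      (((continuous_interp c N).sub (continuous_iff_continuousAt.2
        fun t => (hc t).continuousAt)).continuousOn)
      (fun x _ => (hasDerivWithinAt_interp hN0 x).sub (hc x).hasDerivWithinAt)
      (fun x _ => ?_) t ⟨hst, le_rfl⟩
    have hmem := mem_Ico_floor hN0 x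
    set k := ⌊x * N⌋ with hk
    have hlen : ((k : ℝ) + 1) / N - k / N = 1 / N := by field_simp; ring
    have h1 := norm_image_sub_le_of_norm_deriv_right_le_segment (a := (k : ℝ) / N)
      (b := (k + 1) / N) (f := fun s => c s - s • c' x) (f' := fun s => c' s - c' x) (C := η)
      ((continuous_iff_continuousAt.2 fun t => (hc t).continuousAt).sub
        (by fun_prop)).continuousOn
      (fun s _ =>
        ((hc s).sub (by simpa using (hasDerivAt_id s).smul_const (c' x))).hasDerivWithinAt)
      (fun s hs => by
        rw [← dist_eq_norm]
        refine (huc ?_).le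
        rw [Real.dist_eq, abs_lt]
        constructor <;> linarith [hs.1, hs.2, hmem.1, hmem.2]) ((k + 1) / N)
      ⟨by gcongr; linarith, le_rfl⟩
    rw [hlen] at h1
    have h2 : (N : ℝ) • (c ((k + 1) / N) - c (k / N)) - c' x =
        (N : ℝ) • (c ((k + 1) / N) - (((k : ℝ) + 1) / N) • c' x -
          (c (k / N) - ((k : ℝ) / N) • c' x)) := by
      have : c ((k + 1) / N) - (((k : ℝ) + 1) / N) • c' x - (c (k / N) - ((k : ℝ) / N) • c' x) =
          (c ((k + 1) / N) - c (k / N)) - (((k : ℝ) + 1) / N - k / N) • c' x := by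
        rw [sub_smul]; abel
      rw [this, hlen, smul_sub (N : ℝ) (c ((k + 1) / N) - c (k / N)), smul_smul,
        mul_one_div_cancel hN'.ne', one_smul]
    rw [h2, norm_smul, Real.norm_eq_abs, abs_of_pos hN']
    calc (N : ℝ) * _ ≤ N * (η * (1 / N)) := by gcongr
      _ = η := by field_simp
  have hperq : Periodic (interp c N) 1 := fun t => by
    have : (t + 1) * (N : ℝ) = t * N + (N : ℤ) := by push_cast; ring
    rw [interp, interp, this, Int.floor_add_intCast, Int.fract_add_intCast]
    have h1 : ((⌊t * N⌋ + (N : ℤ) : ℤ) : ℝ) / N = ⌊t * N⌋ / N + 1 := by push_cast; field_simp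
    have h2 : (((⌊t * N⌋ + (N : ℤ) : ℤ) : ℝ) + 1) / N = (⌊t * N⌋ + 1) / N + 1 := by
      push_cast; field_simp; ring
    rw [h1, h2, hper, hper]
  have hinj : ∀ s t, s < t → t - s ≤ 1 / 2 → interp c N s ≠ interp c N t := by
    intro s t hst h h1
    have h2 := hlip s t hst.le
    rw [h1, sub_sub_sub_cancel_left] at h2
    have h3 := hκ s t (by rw [abs_sub_comm, abs_of_pos (sub_pos.2 hst)]; exact h)
    rw [abs_sub_comm, abs_of_pos (sub_pos.2 hst)] at h3
    have h4 : η ≤ κ / 2 := min_le_right _ _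
    nlinarith
  have hinj' : ∀ s ∈ Ico (0 : ℝ) 1, ∀ t ∈ Ico (0 : ℝ) 1, s < t → interp c N s ≠ interp c N t := by
    intro s hs t ht hst
    by_cases h : t - s ≤ 1 / 2
    · exact hinj s t hst h
    · have := hinj t (s + 1) (by linarith [hs.1, ht.2]) (by linarith)
      rw [hperq s] at this
      exact this.symm
  refine ⟨interp c N, ⟨continuous_interp c N, hperq, fun s hs t ht h => ?_, N, hN0,
    fun k _ s hs => ?_⟩, fun t => ?_⟩
  · rcases lt_trichotomy s t with h1 | h1 | h1
    · exact absurd h (hinj' s hs t ht h1)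
    · exact h1
    · exact absurd h.symm (hinj' t ht s hs h1)
  · have h1 := interp_node (c := c) hN0 k
    have h2 := interp_node (c := c) hN0 (k + 1)
    push_cast at h1 h2
    rw [h1, h2, interp_eq hN0 (k := k) (by rwa [Int.cast_natCast])]
    push_cast
    rw [sub_mul, div_mul_cancel₀ _ hN'.ne']
  · have h1 := hlip (⌊t * N⌋ / N) t (mem_Ico_floor hN0 t).1
    rw [interp_node hN0, sub_self, sub_zero] at h1
    have h2 := (mem_Ico_floor hN0 t).2
    have h3 : t - ⌊t * N⌋ / N ≤ 1 := by
      have : ((⌊t * N⌋ : ℝ) + 1) / N = ⌊t * N⌋ / N + 1 / N := by field_simp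
      have h4 : 1 / (N : ℝ) ≤ 1 := by
        rw [div_le_one hN']
        exact_mod_cast hN0
      linarith
    refine h1.trans ((mul_le_of_le_one_right hη0.le h3).trans (min_le_left _ _))

end

/-- `F : A → B` is biholomorphic with inverse `G`. -/
structure BiholOn (F G : ℂ → ℂ) (A B : Set ℂ) : Prop where
  isOpen_source : IsOpen A
  isOpen_target : IsOpen B
  differentiableOn : DifferentiableOn ℂ F A
  differentiableOn_symm : DifferentiableOn ℂ G B
  mapsTo : MapsTo F A B
  mapsTo_symm : MapsTo G B A
  left_inv : ∀ z ∈ A, G (F z) = z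
  right_inv : ∀ z ∈ B, F (G z) = z

namespace BiholOn

variable {F G F' G' : ℂ → ℂ} {A B C U : Set ℂ}

theorem symm (h : BiholOn F G A B) : BiholOn G F B A :=
  ⟨h.2, h.1, h.4, h.3, h.6, h.5, h.8, h.7⟩

theorem deriv_ne_zero (h : BiholOn F G A B) {z : ℂ} (hz : z ∈ A) : deriv F z ≠ 0 := by
  intro h0
  have h1 := (h.differentiableOn.differentiableAt (h.isOpen_source.mem_nhds hz)).hasDerivAt
  have h2 := (h.differentiableOn_symm.differentiableAt
    (h.isOpen_target.mem_nhds (h.mapsTo hz))).hasDerivAt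
  have h3 := h2.comp z h1
  have h4 : HasDerivAt (G ∘ F) 1 z := (hasDerivAt_id z).congr_of_eventuallyEq (by
    filter_upwards [h.isOpen_source.mem_nhds hz] with w hw
    exact h.left_inv w hw)
  have := h3.unique h4
  rw [h0, mul_zero] at this
  exact zero_ne_one this

theorem image_eq (h : BiholOn F G A B) (hU : U ⊆ A) : F '' U = B ∩ G ⁻¹' U := by
  ext z
  constructor
  · rintro ⟨w, hw, rfl⟩
    exact ⟨h.mapsTo (hU hw), by rw [mem_preimage, h.left_inv w (hU hw)]; exact hw⟩
  · rintro ⟨hz, hz'⟩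
    exact ⟨G z, hz', h.right_inv z hz⟩

theorem isOpen_image (h : BiholOn F G A B) (hU : U ⊆ A) (hUo : IsOpen U) : IsOpen (F '' U) := by
  rw [h.image_eq hU]
  exact h.differentiableOn_symm.continuousOn.isOpen_inter_preimage h.isOpen_target hUo

theorem mem_of_image (h : BiholOn F G A B) (hU : U ⊆ A) {z : ℂ} (hz : z ∈ A)
    (hzU : F z ∈ F '' U) : z ∈ U := by
  rw [h.image_eq hU] at hzU
  have := hzU.2
  rwa [mem_preimage, h.left_inv z hz] at this

theorem mono (h : BiholOn F G A B) (hU : U ⊆ A) (hUo : IsOpen U) : BiholOn F G U (F '' U) := by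
  have hsub : F '' U ⊆ B := h.mapsTo.image_subset.trans' (image_mono hU)
  refine ⟨hUo, h.isOpen_image hU hUo, h.differentiableOn.mono hU,
    h.differentiableOn_symm.mono hsub, mapsTo_image F U, ?_, fun z hz => h.left_inv z (hU hz),
    fun z hz => h.right_inv z (hsub hz)⟩
  rintro _ ⟨w, hw, rfl⟩
  rw [h.left_inv w (hU hw)]
  exact hw

theorem trans (h : BiholOn F G A B) (h' : BiholOn F' G' B C) :
    BiholOn (F' ∘ F) (G ∘ G') A C :=
  ⟨h.1, h'.2, h'.3.comp h.3 h.5, h.4.comp h'.4 h'.6, h'.5.comp h.5, h.6.comp h'.6,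
    fun z hz => by rw [comp_apply, comp_apply, h'.7 _ (h.5 hz), h.7 z hz],
    fun z hz => by rw [comp_apply, comp_apply, h.8 _ (h'.6 hz), h'.8 z hz]⟩

theorem const_mul {r : ℝ} (hr : 0 < r) (hA : IsOpen A) :
    BiholOn (fun z => r * z) (fun z => z / r) A {z | z / r ∈ A} := by
  have hr' : (r : ℂ) ≠ 0 := by exact_mod_cast hr.ne'
  refine ⟨hA, hA.preimage (by fun_prop), by fun_prop, by fun_prop, fun z hz => ?_,
    fun z hz => hz, fun z _ => by field_simp, fun z _ => by field_simp⟩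
  rw [mem_ofPred_eq, mul_div_cancel_left₀ _ hr']
  exact hz

theorem hasWind_circle {R : ℝ} {V : Set ℂ} (h : BiholOn F G (ball 0 R) V) (hR : 1 < R) {σ : ℤ}
    {w : ℂ} (hw : ‖w‖ < 1) :
    HasWind (fun t : ℝ => F (Complex.exp (σ * (2 * Real.pi * Complex.I) * t)) - F w) σ := by
  set e : ℝ → ℂ := fun t => Complex.exp (σ * (2 * Real.pi * Complex.I) * t) with he
  have heW := HasWind.exp_two_pi σ
  have hen : ∀ t, ‖e t‖ = 1 := fun t => by
    simp only [he]
    rw [Complex.norm_exp]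
    simp
  have hep : Periodic e 1 := fun t => by
    simp only [he]
    push_cast
    rw [mul_add, mul_one, Complex.exp_add, Complex.exp_int_mul_two_pi_mul_I, mul_one]
  have heR : ∀ t, e t ∈ ball (0 : ℂ) R := fun t => by rw [mem_ball_zero_iff, hen]; exact hR
  have hwR : w ∈ ball (0 : ℂ) R := by rw [mem_ball_zero_iff]; linarith
  have hd : DifferentiableOn ℂ (dslope F w) (ball 0 R) :=
    (Complex.differentiableOn_dslope (isOpen_ball.mem_nhds hwR)).2 h.differentiableOn
  obtain ⟨L, hL, hexp⟩ := (noHole_ball (one_pos.trans hR)).exists_log isOpen_ball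
    (convex_ball _ _).isPreconnected hd (fun z hz => by
      by_cases hzw : z = w
      · rw [hzw, dslope_same]
        exact h.deriv_ne_zero hwR
      · intro h0
        have h1 := sub_smul_dslope F w z
        rw [h0, smul_zero, eq_comm, sub_eq_zero] at h1
        apply hzw
        rw [← h.left_inv z hz, h1, h.left_inv w hwR])
  have h1 : HasWind (fun t => dslope F w (e t)) 0 := by
    refine ⟨fun t => L (e t), hL.continuousOn.comp_continuous heW.continuous heR,
      fun t => hexp _ (heR t), fun t => ?_⟩
    simp [hep t]
  have h2 : HasWind (fun t => e t - w) σ := by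
    refine heW.congr_of_near (by fun_prop) hep (fun t => by simp only [hep t]) fun t => ?_
    rw [sub_sub_cancel_left, norm_neg]
    exact hw.trans_eq (hen t).symm
  have h3 := h2.mul h1
  rw [add_zero] at h3
  convert h3 using 2 with t
  exact (sub_smul_dslope F w (e t)).symm

/-- Inscribed polygons of the conformal image of the unit circle. -/
theorem exists_polygon {R τ : ℝ} {V : Set ℂ} (h : BiholOn F G (ball 0 R) V) (hR : 1 < R) {σ : ℤ}
    (hσ : σ = 1 ∨ σ = -1) (hτ : 0 < τ) (hτR : 1 + τ ≤ R) :
    ∃ q, PolygonParam q ∧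
      (∀ t : ℝ, ‖q t - F (Complex.exp (σ * (2 * Real.pi * Complex.I) * t))‖ ≤ τ) ∧
      F '' closedBall 0 (1 - τ) ⊆ polyInt (range q) ∧
      closure (polyInt (range q)) ⊆ F '' ball 0 (1 + τ) ∧
      ∀ z ∈ F '' closedBall 0 (1 - τ), HasWind (fun t => q t - z) σ := by
  set e : ℝ → ℂ := fun t => Complex.exp (σ * (2 * Real.pi * Complex.I) * t) with he
  have heW := HasWind.exp_two_pi σ
  have hen : ∀ t, ‖e t‖ = 1 := fun t => by
    simp only [he]
    rw [Complex.norm_exp]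
    simp
  have hep : Periodic e 1 := fun t => by
    simp only [he]
    push_cast
    rw [mul_add, mul_one, Complex.exp_add, Complex.exp_int_mul_two_pi_mul_I, mul_one]
  have heR : ∀ t, e t ∈ ball (0 : ℂ) R := fun t => by rw [mem_ball_zero_iff, hen]; exact hR
  have hsR : sphere (0 : ℂ) 1 ⊆ ball 0 R := fun z hz => by
    rw [mem_ball_zero_iff, mem_sphere_zero_iff_norm.1 hz]; exact hR
  set K : Set ℂ := F '' sphere 0 1 with hK
  have hKc : IsCompact K := (isCompact_sphere _ _).image_of_continuousOn
    (h.differentiableOn.continuousOn.mono hsR)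
  have hKV : K ⊆ V := (h.mapsTo.mono_left hsR).image_subset
  have hcK : ∀ t, F (e t) ∈ K := fun t => ⟨e t, by simpa using hen t, rfl⟩
  obtain ⟨k, hk⟩ : ∃ k, LipschitzOnWith k G K := by
    refine LocallyLipschitzOn.exists_lipschitzOnWith_of_compact hKc fun x hx => ?_
    have h1 : ContDiffAt ℂ 1 G x := ((h.differentiableOn_symm.analyticOnNhd h.isOpen_target)
      x (hKV hx)).contDiffAt
    obtain ⟨k, t, ht, hk⟩ := h1.exists_lipschitzOnWith
    exact ⟨k, t, mem_nhdsWithin_of_mem_nhds ht, hk⟩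
  have hchord : ∀ s t : ℝ, |s - t| ≤ 1 / 2 → 4 * |s - t| ≤ ‖e s - e t‖ := by
    intro s t hst
    have h1 : e s - e t =
        e t * (Complex.exp (Complex.I * ((σ * (2 * Real.pi * (s - t)) : ℝ) : ℂ)) - 1) := by
      rw [mul_sub, mul_one]
      simp only [he]
      rw [← Complex.exp_add]
      congr 2
      push_cast
      ring
    have h2 : |Real.sin (σ * (2 * Real.pi * (s - t)) / 2)| = Real.sin (Real.pi * |s - t|) := by
      have h3 : 0 ≤ Real.sin (Real.pi * |s - t|) := by
        refine Real.sin_nonneg_of_nonneg_of_le_pi (by positivity) ?_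
        nlinarith [Real.pi_pos]
      have h4 : σ * (2 * Real.pi * (s - t)) / 2 = σ * (Real.pi * (s - t)) := by ring
      rw [h4]
      rcases abs_cases (s - t) with ⟨h5, -⟩ | ⟨h5, -⟩ <;> rw [h5] at h3 ⊢ <;>
        rcases hσ with rfl | rfl <;> push_cast <;>
        simp only [one_mul, neg_mul, mul_neg, Real.sin_neg, abs_neg] at h3 ⊢
      · exact abs_of_nonneg h3
      · exact abs_of_nonneg h3
      · exact abs_of_nonpos (by linarith)
      · exact abs_of_nonpos (by linarith)
    rw [h1, norm_mul, hen, one_mul, Complex.norm_exp_I_mul_ofReal_sub_one, Real.norm_eq_abs,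
      abs_mul, h2, abs_of_pos (two_pos (α := ℝ))]
    have h6 := Real.mul_le_sin (x := Real.pi * |s - t|) (by positivity)
      (by nlinarith [Real.pi_pos])
    have h7 : 2 / Real.pi * (Real.pi * |s - t|) = 2 * |s - t| := by
      field_simp
    linarith
  obtain ⟨d₁, hd₁, hT₁⟩ := hKc.exists_thickening_subset_open
    (t := (F '' closedBall 0 (1 - τ))ᶜ) (by
      refine IsCompact.isClosed ?_ |>.isOpen_compl
      refine (isCompact_closedBall _ _).image_of_continuousOn
        (h.differentiableOn.continuousOn.mono (closedBall_subset_ball (by linarith))))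
    (by
      rintro _ ⟨z, hz, rfl⟩ hz'
      have := h.mem_of_image (closedBall_subset_ball (by linarith)) (hsR hz) hz'
      rw [mem_closedBall_zero_iff, mem_sphere_zero_iff_norm.1 hz] at this
      linarith)
  obtain ⟨d₂, hd₂, hT₂⟩ := hKc.exists_thickening_subset_open
    (h.isOpen_image (ball_subset_ball hτR) isOpen_ball)
    (image_mono fun z hz => by
      rw [mem_ball_zero_iff, mem_sphere_zero_iff_norm.1 hz]; linarith)
  have hder : ∀ t : ℝ, HasDerivAt (fun t => F (e t))
      (deriv F (e t) * (e t * (σ * (2 * Real.pi * Complex.I)))) t := fun t => by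
    have h1 := (h.differentiableOn.differentiableAt (isOpen_ball.mem_nhds (heR t))).hasDerivAt
    have h2 : HasDerivAt e (e t * (σ * (2 * Real.pi * Complex.I))) t := by
      have h3 : HasDerivAt (fun t : ℝ => σ * (2 * Real.pi * Complex.I) * (t : ℂ))
          (σ * (2 * Real.pi * Complex.I)) t := by
        simpa using (Complex.ofRealCLM.hasDerivAt (x := t)).const_mul
          (σ * (2 * Real.pi * Complex.I))
      exact h3.cexp
    exact h1.comp t h2
  obtain ⟨q, hq, hqc⟩ := exists_polygon_near (κ := 4 / (k + 1)) (τ := min τ (min d₁ d₂ / 2)) hder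
    ((((h.differentiableOn.deriv isOpen_ball).continuousOn.comp_continuous heW.continuous heR)).mul
      (heW.continuous.mul continuous_const)) (fun t => by simp only [hep t]) (by positivity)
    (fun s t hst => by
      have h1 := hk.dist_le_mul _ (hcK s) _ (hcK t)
      rw [h.left_inv _ (heR s), h.left_inv _ (heR t), dist_eq_norm, dist_eq_norm] at h1
      have h2 := hchord s t hst
      rw [div_mul_eq_mul_div, div_le_iff₀ (by positivity)]
      nlinarith [norm_nonneg (F (e s) - F (e t))])
    (lt_min hτ (half_pos (lt_min hd₁ hd₂)))
  have hq₁ : ∀ t, ‖q t - F (e t)‖ < d₁ := fun t => (hqc t).trans_lt (by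
    have := min_le_right τ (min d₁ d₂ / 2)
    have := min_le_left d₁ d₂
    linarith)
  have hq₂ : ∀ t, ‖q t - F (e t)‖ < d₂ := fun t => (hqc t).trans_lt (by
    have := min_le_right τ (min d₁ d₂ / 2)
    have := min_le_right d₁ d₂
    linarith)
  have hnear : ∀ {z : ℂ} {j : ℤ} {d : ℝ}, HasWind (fun t => F (e t) - z) j →
      (∀ t, ‖q t - F (e t)‖ < d) → (∀ t, d ≤ ‖F (e t) - z‖) → HasWind (fun t => q t - z) j := by
    intro z j d hw h1 h2
    refine hw.congr_of_near (hq.continuous.sub continuous_const) (fun t => by simp only [hep t])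
      (fun t => by simp only [hq.periodic t]) fun t => ?_
    rw [sub_sub_sub_cancel_right]
    exact (h1 t).trans_le (h2 t)
  obtain ⟨σ', hσ', hin, hout⟩ := hq.exists_wind
  have hwind : ∀ z ∈ F '' closedBall 0 (1 - τ), HasWind (fun t => q t - z) σ := by
    intro z hz
    have hz' := hz
    obtain ⟨w, hw, rfl⟩ := hz'
    refine hnear (h.hasWind_circle hR (σ := σ) (w := w) ?_) hq₁ fun t => ?_
    · rw [mem_closedBall_zero_iff] at hw
      linarith
    · by_contra! hlt
      refine hT₁ (mem_thickening_iff.2 ⟨F (e t), hcK t, ?_⟩) hz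
      rwa [dist_comm, dist_eq_norm]
  refine ⟨q, hq, fun t => (hqc t).trans (min_le_left _ _), fun z hz => ?_, fun z hz => ?_, hwind⟩
  · by_contra hn
    have h1 := hwind z hz
    have h2 : z ∉ range q := by
      rintro ⟨t, ht⟩
      exact h1.ne_zero t (sub_eq_zero.2 ht)
    have := h1.unique (hout z h2 hn)
    omega
  · rw [hq.closure_polyInt] at hz
    rcases hz with hz | ⟨t, rfl⟩
    · by_contra hn
      have h1 : HasWind (fun t => F (e t) - z) 0 := by
        have hτ1 : (1 : ℝ) < 1 + τ := by linarith
        have heτ : ∀ t, e t ∈ ball (0 : ℂ) (1 + τ) := fun t => by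
          rw [mem_ball_zero_iff, hen]; exact hτ1
        obtain ⟨L, hL, hexp⟩ := (noHole_ball (one_pos.trans hτ1)).exists_log isOpen_ball
          (convex_ball _ _).isPreconnected (h := fun w => F w - z)
          ((h.differentiableOn.mono (ball_subset_ball hτR)).sub_const z)
          (fun w hw h0 => hn ⟨w, hw, sub_eq_zero.1 h0⟩)
        refine ⟨fun t => L (e t), hL.continuousOn.comp_continuous heW.continuous heτ,
          fun t => hexp _ (heτ t), fun t => ?_⟩
        simp [hep t]
      have h2 := hnear h1 hq₂ fun t => by
        by_contra! hlt
        refine hn (hT₂ (mem_thickening_iff.2 ⟨F (e t), hcK t, ?_⟩))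
        rwa [dist_comm, dist_eq_norm]
      have := (hin z hz).unique h2
      omega
    · refine hT₂ (mem_thickening_iff.2 ⟨F (e t), hcK t, ?_⟩)
      rw [dist_eq_norm]
      exact hq₂ t

end BiholOn

theorem continuous_reV : Continuous reV :=
  (PiLp.continuous_toLp 2 _).comp (continuous_pi fun i =>
    Complex.continuous_re.comp (continuous_apply i))

namespace Surf

theorem exists_integral_m_le (S : Surf) (hne : ∀ z ∈ ball (0 : ℂ) S.R, S.u z ≠ 0 ∨ S.v z ≠ 0)
    {δ : ℝ} (hδ : 0 < δ) :
    ∃ d > 0, ∀ z ∈ closedBall (0 : ℂ) 1, ∀ w ∈ closedBall (0 : ℂ) 1, ‖z - w‖ < d →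
      ∫ t in ‖w‖..‖z‖, S.m t ≤ (1 + δ) * ‖S.X z - S.X w‖ := by
  set D : ℂ → ℂ →L[ℝ] R3 := fun z => reVFDeriv fun i => nul (S.u z) (S.v z) i with hD
  have hDc : ContinuousOn D (closedBall 0 1) := by
    rw [continuousOn_clm_apply]
    intro v
    refine continuous_reV.comp_continuousOn (continuousOn_pi.2 fun i => ?_)
    exact continuousOn_const.mul ((S.differentiableOn_nul i).continuousOn.mono S.closedBall_subset)
  have hDn : ∀ z v, ‖D z v‖ = ‖v‖ * S.mu z := fun z v => norm_reV_mul_nul _ _ _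
  have hXD : ∀ z ∈ ball (0 : ℂ) S.R, HasFDerivAt S.X (D z) z := fun z hz =>
    hasFDerivAt_reV fun i => S.hasDerivAt_H i hz
  obtain ⟨z₀, hz₀, hmin⟩ := (isCompact_closedBall (0 : ℂ) 1).exists_isMinOn ⟨0, by simp⟩
    (S.continuousOn_mu.mono S.closedBall_subset)
  have hμ : 0 < S.mu z₀ := by
    unfold mu
    rcases hne z₀ (S.closedBall_subset hz₀) with h | h
    · have := norm_pos_iff.2 h
      positivity
    · have := norm_pos_iff.2 h
      positivity
  set η : ℝ := δ * S.mu z₀ / (2 + δ) with hη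
  have hη0 : 0 < η := by positivity
  have hηe : η * (2 + δ) = δ * S.mu z₀ := div_mul_cancel₀ _ (by positivity)
  obtain ⟨d₁, hd₁, h₁⟩ := Metric.uniformContinuousOn_iff.1
    ((isCompact_closedBall (0 : ℂ) 1).uniformContinuousOn_of_continuous hDc) η hη0
  obtain ⟨d₂, hd₂, h₂⟩ := Metric.uniformContinuousOn_iff.1
    ((isCompact_Icc (a := (0 : ℝ)) (b := 1)).uniformContinuousOn_of_continuous
      S.continuous_m.continuousOn) η hη0
  refine ⟨min d₁ d₂, lt_min hd₁ hd₂, fun z hz w hw hzw => ?_⟩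
  have hz1 := mem_closedBall_zero_iff.1 hz
  have hw1 := mem_closedBall_zero_iff.1 hw
  have h3 : ‖S.X w - S.X z - D z (w - z)‖ ≤ η * ‖w - z‖ := by
    refine Convex.norm_image_sub_le_of_norm_hasFDerivWithin_le' (f' := D)
      (s := closedBall 0 1 ∩ ball z d₁)
      (fun x hx => (hXD x (S.closedBall_subset hx.1)).hasFDerivWithinAt) (fun x hx => ?_)
      ((convex_closedBall _ _).inter (convex_ball _ _)) ⟨hz, mem_ball_self hd₁⟩
      ⟨hw, ?_⟩
    · rw [← dist_eq_norm]
      exact (h₁ x hx.1 z hz hx.2).le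
    · rw [mem_ball, dist_comm, dist_eq_norm]
      exact hzw.trans_le (min_le_left _ _)
  have h4 : ‖w - z‖ * S.mu z ≤ ‖S.X z - S.X w‖ + η * ‖w - z‖ := by
    rw [← hDn, norm_sub_rev (S.X z)]
    have := norm_sub_norm_le (D z (w - z)) (S.X w - S.X z)
    rw [norm_sub_rev (D z (w - z))] at this
    linarith
  have h5 : |‖z‖ - ‖w‖| ≤ ‖w - z‖ := by
    rw [norm_sub_rev]
    exact abs_norm_sub_norm_le z w
  have h6 : ‖∫ t in ‖w‖..‖z‖, S.m t‖ ≤ (S.mu z + η) * |‖z‖ - ‖w‖| := by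
    refine intervalIntegral.norm_integral_le_of_norm_le_const fun t ht => ?_
    have ht' := uIoc_subset_uIcc ht
    have ht1 : t ∈ Icc (0 : ℝ) 1 :=
      uIcc_subset_Icc (⟨norm_nonneg _, hw1⟩ : ‖w‖ ∈ Icc (0 : ℝ) 1) ⟨norm_nonneg _, hz1⟩ ht'
    have h7 := h₂ t ht1 ‖z‖ ⟨norm_nonneg _, hz1⟩ (by
      rw [Real.dist_eq, abs_sub_comm]
      refine (abs_sub_right_of_mem_uIcc ht').trans_lt (h5.trans_lt ?_)
      rw [norm_sub_rev]
      exact hzw.trans_le (min_le_right _ _))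
    rw [Real.norm_of_nonneg (S.m_nonneg t)]
    rw [Real.dist_eq] at h7
    linarith [(abs_lt.1 h7).2, S.m_le hz1]
  have h7 : S.mu z₀ ≤ S.mu z := hmin hz
  have h8 : S.mu z + η ≤ (1 + δ) * (S.mu z - η) := by nlinarith
  calc ∫ t in ‖w‖..‖z‖, S.m t ≤ (S.mu z + η) * |‖z‖ - ‖w‖| := (Real.le_norm_self _).trans h6
    _ ≤ (S.mu z + η) * ‖w - z‖ := by gcongr; linarith
    _ ≤ (1 + δ) * (S.mu z - η) * ‖w - z‖ := by gcongr
    _ = (1 + δ) * (‖w - z‖ * S.mu z - η * ‖w - z‖) := by ring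
    _ ≤ _ := by gcongr; linarith

/-- The radial length function bounds the lengths of curves on an immersed surface from below. -/
theorem integral_le_eVariationOn (S : Surf)
    (hne : ∀ z ∈ ball (0 : ℂ) S.R, S.u z ≠ 0 ∨ S.v z ≠ 0) {β : ℝ → ℂ}
    (hβ : ContinuousOn β (Icc 0 1)) (hβ1 : MapsTo β (Icc 0 1) (closedBall 0 1)) :
    ENNReal.ofReal (∫ t in ‖β 1‖..‖β 0‖, S.m t) ≤ eVariationOn (S.X ∘ β) (Icc 0 1) := by
  by_cases htop : eVariationOn (S.X ∘ β) (Icc 0 1) = ⊤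
  · rw [htop]; exact le_top
  rw [ENNReal.ofReal_le_iff_le_toReal htop]
  set ℓ : ℝ := (eVariationOn (S.X ∘ β) (Icc 0 1)).toReal with hℓ
  have hi : ∀ x y : ℝ, IntervalIntegrable S.m MeasureTheory.volume x y :=
    fun x y => S.continuous_m.intervalIntegrable x y
  have key : ∀ δ > 0, ∫ t in ‖β 1‖..‖β 0‖, S.m t ≤ (1 + δ) * ℓ := by
    intro δ hδ
    obtain ⟨d, hd, h⟩ := S.exists_integral_m_le hne hδ
    obtain ⟨e, he, hu⟩ := Metric.uniformContinuousOn_iff.1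
      (isCompact_Icc.uniformContinuousOn_of_continuous hβ) d hd
    obtain ⟨n, hn⟩ := exists_nat_one_div_lt he
    set τ : ℕ → ℝ := fun i => min ((i : ℝ) / (n + 1)) 1 with hτ
    have hn0 : (0 : ℝ) < n + 1 := by positivity
    have hτm : Monotone τ := fun i j hij => by
      refine min_le_min_right _ ?_
      gcongr
    have hτI : ∀ i, τ i ∈ Icc (0 : ℝ) 1 := fun i => ⟨le_min (by positivity) zero_le_one,
      min_le_right _ _⟩
    have hstep : ∀ i, dist (τ i) (τ (i + 1)) < e := fun i => by
      rw [dist_comm, Real.dist_eq, abs_of_nonneg (sub_nonneg.2 (hτm i.le_succ))]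
      refine lt_of_le_of_lt ?_ hn
      have h1 : ((i + 1 : ℕ) : ℝ) / (n + 1) = i / (n + 1) + 1 / (n + 1) := by
        push_cast; ring
      have h2 : (0 : ℝ) < 1 / (n + 1) := by positivity
      simp only [hτ]
      rw [h1]
      rcases min_cases ((i : ℝ) / (n + 1)) 1 with ⟨h3, -⟩ | ⟨h3, -⟩ <;> rw [h3]
      · linarith [min_le_left ((i : ℝ) / (n + 1) + 1 / (n + 1)) 1]
      · linarith [min_le_right ((i : ℝ) / (n + 1) + 1 / (n + 1)) 1]
    have htel : ∀ N : ℕ, ∫ t in ‖β (τ N)‖..‖β (τ 0)‖, S.m t ≤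
        (1 + δ) * ∑ i ∈ Finset.range N, ‖S.X (β (τ (i + 1))) - S.X (β (τ i))‖ := by
      intro N
      induction N with
      | zero => simp
      | succ N ih =>
        rw [Finset.sum_range_succ, mul_add,
          ← intervalIntegral.integral_add_adjacent_intervals (hi _ ‖β (τ N)‖) (hi _ _), add_comm]
        refine add_le_add ih ?_
        rw [norm_sub_rev]
        refine h _ (hβ1 (hτI _)) _ (hβ1 (hτI _)) ?_
        rw [← dist_eq_norm]
        exact hu _ (hτI _) _ (hτI _) (hstep N)
    have h0 : τ 0 = 0 := by simp [hτ]
    have h1 : τ (n + 1) = 1 := by simp [hτ, div_self hn0.ne']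
    have h2 := htel (n + 1)
    rw [h0, h1] at h2
    refine h2.trans (mul_le_mul_of_nonneg_left ?_ (by positivity))
    have h3 := eVariationOn.sum_le (f := S.X ∘ β) (s := Icc 0 1) (n := n + 1) hτm hτI
    rw [hℓ, ← ENNReal.ofReal_le_iff_le_toReal htop, ENNReal.ofReal_sum_of_nonneg
      fun _ _ => norm_nonneg _]
    refine le_trans (le_of_eq (Finset.sum_congr rfl fun i _ => ?_)) h3
    rw [comp_apply, comp_apply, edist_dist, dist_eq_norm]
  have hℓ0 : 0 ≤ ℓ := ENNReal.toReal_nonneg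
  refine le_of_forall_pos_le_add fun x hx => ?_
  have h1 := key (x / (ℓ + 1)) (by positivity)
  have h2 : x / (ℓ + 1) * ℓ ≤ x := by
    rw [div_mul_eq_mul_div, div_le_iff₀ (by positivity)]
    nlinarith
  linarith

end Surf

namespace HomotopicLoopsIn

variable {T T' : Set R3} {f g h : ℝ → R3}

theorem mono (H : HomotopicLoopsIn T f g) (hT : T ⊆ T') : HomotopicLoopsIn T' f g := by
  obtain ⟨H, h1, h2, h3, h4, h5⟩ := H
  exact ⟨H, h1, h2, h3, h4, fun t s hs => hT (h5 t s hs)⟩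

theorem trans (H₁ : HomotopicLoopsIn T f g) (H₂ : HomotopicLoopsIn T g h) :
    HomotopicLoopsIn T f h := by
  obtain ⟨F, a1, a2, a3, a4, a5⟩ := H₁
  obtain ⟨G, b1, b2, b3, b4, b5⟩ := H₂
  refine ⟨fun x => F (x.1, min (2 * x.2) 1) + G (x.1, max 0 (2 * x.2 - 1)) - G (x.1, 0),
    by fun_prop, fun t => ?_, fun t => ?_, fun t s => ?_, fun t s hs => ?_⟩
  · dsimp only
    rw [mul_zero, min_eq_left zero_le_one, max_eq_left (by norm_num), a2, add_sub_cancel_right]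
  · dsimp only
    rw [mul_one, min_eq_right (by norm_num), max_eq_right (by norm_num), a3, b2]
    norm_num [b3]
  · simp only [a4, b4]
  · dsimp only
    rcases le_total (2 * s) 1 with h1 | h1
    · rw [min_eq_left h1, max_eq_left (by linarith), add_sub_cancel_right]
      exact a5 t _ ⟨by linarith [hs.1], h1⟩
    · rw [min_eq_right h1, max_eq_right (by linarith), a3, b2, add_sub_cancel_left]
      exact b5 t _ ⟨by linarith, by linarith [hs.2]⟩

theorem of_near {A : Set R3} {c m r : ℝ} (hf : Continuous f) (hfp : Periodic f 1)
    (hg : Continuous g) (hgp : Periodic g 1) (hfA : ∀ t, f t ∈ thickening c A)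
    (hfg : ∀ t, ‖g t - f t‖ ≤ m) (hr : c + m ≤ r) :
    HomotopicLoopsIn (thickening r A) f g := by
  refine ⟨fun x => f x.1 + x.2 • (g x.1 - f x.1), by fun_prop, fun t => by simp,
    fun t => by simp, fun t s => by simp only [hfp t, hgp t], fun t s hs => ?_⟩
  obtain ⟨y, hy, hd⟩ := mem_thickening_iff.1 (hfA t)
  refine mem_thickening_iff.2 ⟨y, hy, ?_⟩
  have h1 : dist (f t + s • (g t - f t)) (f t) ≤ m := by
    rw [dist_eq_norm, add_sub_cancel_left, norm_smul, Real.norm_of_nonneg hs.1]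
    exact (mul_le_of_le_one_left (norm_nonneg _) hs.2).trans (hfg t)
  linarith [dist_triangle (f t + s • (g t - f t)) (f t) y]

theorem symm (H : HomotopicLoopsIn T f g) : HomotopicLoopsIn T g f := by
  obtain ⟨F, a1, a2, a3, a4, a5⟩ := H
  exact ⟨fun x => F (x.1, 1 - x.2), by fun_prop, fun t => by simp [a3], fun t => by simp [a2],
    fun t s => a4 t _, fun t s hs => a5 t _ ⟨by linarith [hs.2], by linarith [hs.1]⟩⟩

end HomotopicLoopsIn

namespace BiholOn

variable {f g : ℂ → ℂ} {Ω : Set ℂ}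

theorem hasWind_symm (h : BiholOn f g (ball 0 1) Ω) (hf0 : f 0 = 0) (hN : NoHole Ω)
    (hc : IsPreconnected Ω) {q : ℝ → ℂ} {σ : ℤ} (hq : HasWind q σ) (hqp : Periodic q 1)
    (hqΩ : ∀ t, q t ∈ Ω) : HasWind (fun t => g (q t)) σ := by
  have h00 : (0 : ℂ) ∈ ball (0 : ℂ) 1 := by simp
  have h0 : (0 : ℂ) ∈ Ω := hf0 ▸ h.mapsTo h00
  have hg0 : g 0 = 0 := by
    have := h.left_inv 0 h00
    rwa [hf0] at this
  obtain ⟨L, hL, hexp⟩ := hN.exists_log h.isOpen_target hc (h := dslope g 0)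
    ((Complex.differentiableOn_dslope (h.isOpen_target.mem_nhds h0)).2 h.differentiableOn_symm)
    (fun z hz => by
      by_cases hz0 : z = 0
      · rw [hz0, dslope_same]
        exact h.symm.deriv_ne_zero h0
      · intro h1
        have h2 := sub_smul_dslope g 0 z
        rw [h1, smul_zero, hg0, sub_zero] at h2
        apply hz0
        rw [← h.right_inv z hz, ← h2, hf0])
  have h1 : HasWind (fun t => dslope g 0 (q t)) 0 := by
    refine ⟨fun t => L (q t), hL.continuousOn.comp_continuous hq.continuous hqΩ,
      fun t => hexp _ (hqΩ t), fun t => ?_⟩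
    simp [hqp t]
  have h2 := hq.mul h1
  rw [add_zero] at h2
  convert h2 using 2 with t
  have h3 := sub_smul_dslope g 0 (q t)
  rw [hg0, sub_zero, sub_zero, smul_eq_mul] at h3
  exact h3.symm

/-- Loops with the same winding number are freely homotopic in a conformal annulus. -/
theorem homotopicLoopsIn (h : BiholOn f g (ball 0 1) Ω) (hf0 : f 0 = 0) (hN : NoHole Ω)
    (hc : IsPreconnected Ω) {q₁ q₂ : ℝ → ℂ} {σ : ℤ} (h₁ : HasWind q₁ σ) (hp₁ : Periodic q₁ 1)
    (hΩ₁ : ∀ t, q₁ t ∈ Ω) (h₂ : HasWind q₂ σ) (hp₂ : Periodic q₂ 1) (hΩ₂ : ∀ t, q₂ t ∈ Ω)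
    {κ : ℝ} (hκ₁ : ∀ t, κ < ‖g (q₁ t)‖) (hκ₂ : ∀ t, κ < ‖g (q₂ t)‖) {X : ℂ → R3} {T : Set R3}
    (hX : ContinuousOn X Ω) (hXT : ∀ z ∈ Ω, κ < ‖g z‖ → X z ∈ T) :
    HomotopicLoopsIn T (X ∘ q₁) (X ∘ q₂) := by
  obtain ⟨L₁, c₁, e₁, s₁⟩ := h.hasWind_symm hf0 hN hc h₁ hp₁ hΩ₁
  obtain ⟨L₂, c₂, e₂, s₂⟩ := h.hasWind_symm hf0 hN hc h₂ hp₂ hΩ₂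
  beta_reduce at e₁ e₂
  set c : ℝ → ℝ := fun s => max 0 (min 1 s) with hcdef
  have hc01 : ∀ s, 0 ≤ c s ∧ c s ≤ 1 := fun s =>
    ⟨le_max_left _ _, max_le zero_le_one (min_le_left _ _)⟩
  set e : ℝ × ℝ → ℂ := fun x => Complex.exp (L₁ x.1 + c x.2 * (L₂ x.1 - L₁ x.1)) with he
  have hec : Continuous e := by fun_prop
  have hen : ∀ x, κ < ‖e x‖ ∧ ‖e x‖ < 1 := fun x => by
    have n₁ := h.mapsTo_symm (hΩ₁ x.1)
    have n₂ := h.mapsTo_symm (hΩ₂ x.1)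
    have k₁ := hκ₁ x.1
    have k₂ := hκ₂ x.1
    rw [mem_ball_zero_iff, ← e₁, Complex.norm_exp] at n₁
    rw [mem_ball_zero_iff, ← e₂, Complex.norm_exp] at n₂
    rw [← e₁, Complex.norm_exp] at k₁
    rw [← e₂, Complex.norm_exp] at k₂
    obtain ⟨i1, i2⟩ := hc01 x.2
    have hre : (L₁ x.1 + c x.2 * (L₂ x.1 - L₁ x.1)).re =
        (1 - c x.2) * (L₁ x.1).re + c x.2 * (L₂ x.1).re := by
      simp only [Complex.add_re, Complex.re_ofReal_mul, Complex.sub_re]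
      ring
    simp only [he]
    rw [Complex.norm_exp, hre]
    rcases le_total (L₁ x.1).re (L₂ x.1).re with hl | hl
    · exact ⟨k₁.trans_le (Real.exp_le_exp.2 (by nlinarith)),
        (Real.exp_le_exp.2 (by nlinarith)).trans_lt n₂⟩
    · exact ⟨k₂.trans_le (Real.exp_le_exp.2 (by nlinarith)),
        (Real.exp_le_exp.2 (by nlinarith)).trans_lt n₁⟩
  have heb : ∀ x, e x ∈ ball (0 : ℂ) 1 := fun x => mem_ball_zero_iff.2 (hen x).2
  refine ⟨fun x => X (f (e x)), hX.comp_continuous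
    (h.differentiableOn.continuousOn.comp_continuous hec heb) fun x => h.mapsTo (heb x),
    fun t => ?_, fun t => ?_, fun t s => ?_, fun t s _ => ?_⟩
  · have : e (t, 0) = g (q₁ t) := by
      simp only [he, hcdef]
      norm_num
      exact e₁ t
    dsimp only
    rw [this, h.right_inv _ (hΩ₁ t), comp_apply]
  · have : e (t, 1) = g (q₂ t) := by
      simp only [he, hcdef]
      norm_num
      exact e₂ t
    dsimp only
    rw [this, h.right_inv _ (hΩ₂ t), comp_apply]
  · have : e (t + 1, s) = e (t, s) := by
      simp only [he]
      rw [s₁, s₂, add_sub_add_right_eq_sub, add_right_comm, Complex.exp_add,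
        Complex.exp_int_mul_two_pi_mul_I, mul_one]
    dsimp only
    rw [this]
  · refine hXT _ (h.mapsTo (heb _)) ?_
    rw [h.left_inv _ (heb _)]
    exact (hen _).1

end BiholOn

namespace BiholOn

variable {F G : ℂ → ℂ} {Ω : Set ℂ}

theorem scale (h : BiholOn F G (ball 0 1) Ω) {r : ℝ} (hr : 0 < r) :
    BiholOn (fun z => F (r * z)) (fun z => G z / r) (ball 0 (1 / r)) Ω := by
  have h1 := const_mul hr (isOpen_ball (x := (0 : ℂ)) (ε := 1 / r))
  have h2 : {z : ℂ | z / r ∈ ball (0 : ℂ) (1 / r)} = ball 0 1 := by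
    ext z
    rw [mem_ofPred_eq, mem_ball_zero_iff, mem_ball_zero_iff, norm_div, Complex.norm_real,
      Real.norm_of_nonneg hr.le, div_lt_div_iff_of_pos_right hr]
  rw [h2] at h1
  exact h1.trans h

theorem exists_norm_lt (h : BiholOn F G (ball 0 1) Ω) {K : Set ℂ} (hK : IsCompact K)
    (hKΩ : K ⊆ Ω) : ∃ κ : ℝ, 0 < κ ∧ κ < 1 ∧ ∀ z ∈ K, ‖G z‖ < κ := by
  rcases K.eq_empty_or_nonempty with rfl | hne
  · exact ⟨1 / 2, by norm_num, by norm_num, by simp⟩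
  obtain ⟨z₀, hz₀, hmax⟩ := hK.exists_isMaxOn hne
    (h.differentiableOn_symm.continuousOn.norm.mono hKΩ)
  obtain ⟨κ, h1, h2⟩ := exists_between (mem_ball_zero_iff.1 (h.mapsTo_symm (hKΩ hz₀)))
  exact ⟨κ, (norm_nonneg _).trans_lt h1, h2, fun z hz => (hmax hz).trans_lt h1⟩

theorem of_noHole {U : Set ℂ} (hU : IsOpen U) (hN : NoHole U) (hUc : IsPreconnected U)
    (hb : Bornology.IsBounded U) (h0 : (0 : ℂ) ∈ U) :
    ∃ f g : ℂ → ℂ, BiholOn f g (ball 0 1) U ∧ f 0 = 0 ∧ g 0 = 0 := by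
  obtain ⟨f, g, a1, a2, a3, a4, a5, a6, a7, a8⟩ := hN.exists_riemann_map hU hUc hb h0
  exact ⟨f, g, ⟨isOpen_ball, hU, a1, a3, a2, a4, a6, a5⟩, a7, a8⟩

/-- The recursive step in a conformal disc: `X` is deformed near the boundary so that its boundary
escapes from `E` to a neighbourhood of `∂E'`, while crossing the collar becomes long. -/
theorem exists_immersion (h : BiholOn F G (ball 0 1) Ω) (hF0 : F 0 = 0) {U : Set ℂ}
    (hU : IsOpen U) (hΩU : Ω ⊆ U) {X : ℂ → R3} (hXU : ConfMinImmOn X U) (hX0 : X 0 = 0)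
    {E E' : Set R3} {R a b δ ρ₁ e L : ℝ} (hE : Convex ℝ E)
    (hEo : IsOpen E) (hEb : Bornology.IsBounded E) (h0 : 0 ∈ E) (hE' : Convex ℝ E')
    (hE'o : IsOpen E') (hE'b : Bornology.IsBounded E') (hEE' : closure E ⊆ E')
    (hR : ExtSphereRadius E R) (hδ : δ = hausdorffDist (closure E) (closure E')) (ha : 0 < a)
    (hb : 0 < b) (he : 0 < e) (hL : 0 < L) (hρ₁ : 0 < ρ₁) (hρ₁1 : ρ₁ < 1)
    (hX : ∀ z ∈ Ω, ρ₁ ≤ ‖G z‖ → X z ∈ E ∧ infDist (X z) Eᶜ ≤ a) {σ : ℤ}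
    (hσ : σ = 1 ∨ σ = -1) :
    ∃ (q : ℝ → ℂ) (Y : ℂ → R3) (V : Set ℂ), PolygonParam q ∧ IsOpen V ∧
      closure (polyInt (range q)) ⊆ V ∧ V ⊆ Ω ∧ ConfMinImmOn Y V ∧ Y 0 = 0 ∧
      (∀ z ∈ Ω, ‖G z‖ ≤ ρ₁ → z ∈ polyInt (range q)) ∧ (∀ z ∈ range q, ρ₁ < ‖G z‖) ∧
      HasWind q σ ∧ (∀ z ∈ V, ‖G z‖ ≤ ρ₁ → ‖Y z - X z‖ ≤ e) ∧
      (∀ z ∈ V, ρ₁ ≤ ‖G z‖ → ‖Y z - X z‖ ≤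
          √((2 * (2 * a + b) + R + δ) ^ 2 - (2 * (a + b) + R) ^ 2 + (2 * b) ^ 2) + e ∧
        Y z ∉ innerParallel E (2 * (a + b))) ∧
      (∀ z ∈ range q, Y z ∈ E' ∧ infDist (Y z) E'ᶜ ≤ b) ∧
      ∀ α : ℝ → ℂ, ContinuousOn α (Icc 0 1) → MapsTo α (Icc 0 1) V → α 0 ∈ range q →
        ‖G (α 1)‖ ≤ ρ₁ → ENNReal.ofReal L ≤ eVariationOn (Y ∘ α) (Icc 0 1) := by
  set r : ℝ := √ρ₁ with hr
  have hr0 : 0 < r := Real.sqrt_pos.2 hρ₁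
  have hr1 : r < 1 := by
    rw [hr, Real.sqrt_lt' one_pos, one_pow]
    exact hρ₁1
  have hrr : r * r = ρ₁ := Real.mul_self_sqrt hρ₁.le
  have h1r : 1 < 1 / r := (one_lt_div hr0).2 hr1
  set f : ℂ → ℂ := fun z => F (r * z) with hf
  set k : ℂ → ℂ := fun z => G z / r with hk
  have hfk : BiholOn f k (ball 0 (1 / r)) Ω := h.scale hr0
  have hf0 : f 0 = 0 := by simp [hf, hF0]
  have hkn : ∀ z, ‖k z‖ = ‖G z‖ / r := fun z => by
    simp [hk, abs_of_pos hr0]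
  have hk_le : ∀ {z}, ‖G z‖ ≤ ρ₁ → ‖k z‖ ≤ r := fun {z} hz => by
    rw [hkn, div_le_iff₀ hr0, hrr]; exact hz
  have hk_ge : ∀ {z}, ρ₁ ≤ ‖G z‖ → r ≤ ‖k z‖ := fun {z} hz => by
    rw [hkn, le_div_iff₀ hr0, hrr]; exact hz
  obtain ⟨S₀, hS₀R, hS₀⟩ := hXU.exists_surf hU h1r hfk.differentiableOn
    (fun z hz => hΩU (hfk.mapsTo hz)) (fun z hz => hfk.deriv_ne_zero hz) (by rw [hf0, hX0])
  obtain ⟨S, ρ, b₀, W, hrρ, hρ1, hb₀, hb₀b, hWo, hWc, hWN, hρW, hW1, hne, hin, hout, hWE', hfr,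
      hInt⟩ :=
    S₀.exists_cut (L := L) (ρ₀ := r) (e := e) hE hEo hEb h0 hE' hE'o hE'b hEE' hR hδ ha hb he hL
      hr0.le hr1 (fun z hz hrz => by
        rw [hS₀ z (S₀.closedBall_subset hz)]
        have hz' : z ∈ ball (0 : ℂ) (1 / r) := closedBall_subset_ball h1r hz
        refine hX _ (hfk.mapsTo hz') ?_
        have h1 : ‖k (f z)‖ = ‖z‖ := by rw [hfk.left_inv z hz']
        rw [hkn, div_eq_iff hr0.ne'] at h1
        rw [h1, ← hrr]
        gcongr)
  have hρ0 : 0 < ρ := hr0.trans hrρ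
  have hWball : W ⊆ ball 0 1 := subset_closure.trans hW1
  have hWr : W ⊆ ball 0 (1 / r) := hWball.trans (ball_subset_ball h1r.le)
  obtain ⟨φ, ψ, hφ, -, -⟩ := BiholOn.of_noHole hWo hWN hWc (isBounded_ball.subset hWball)
    (hρW (mem_closedBall_self hρ0.le))
  have hSc : ContinuousOn S.X (closure W) := S.continuousOn_X.mono
    (hW1.trans (ball_subset_closedBall.trans S.closedBall_subset))
  have hWcl : IsCompact (closure W) :=
    (isBounded_ball.subset hWball).isCompact_closure
  set C : Set ℂ := (closure W ∩ (fun z => infDist (S.X z) E'ᶜ) ⁻¹' Ici b) ∪ closedBall 0 ρ with hC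
  have hCc : IsCompact C := by
    refine IsCompact.union ?_ (isCompact_closedBall _ _)
    exact hWcl.of_isClosed_subset (((continuous_infDist_pt _).comp_continuousOn
      hSc).preimage_isClosed_of_isClosed isClosed_closure isClosed_Ici) inter_subset_left
  have hCW : C ⊆ W := by
    rintro z (⟨hz, hzb⟩ | hz)
    · by_contra hn
      have := hfr z (by rw [hWo.frontier_eq]; exact ⟨hz, hn⟩)
      rw [mem_preimage, mem_Ici, this] at hzb
      linarith
    · exact hρW hz
  obtain ⟨κ, hκ0, hκ1, hκ⟩ := hφ.exists_norm_lt hCc hCW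
  set s : ℝ := √κ with hs
  have hs0 : 0 < s := Real.sqrt_pos.2 hκ0
  have hs1 : s < 1 := by
    rw [hs, Real.sqrt_lt' one_pos, one_pow]
    exact hκ1
  have hss : s * s = κ := Real.mul_self_sqrt hκ0.le
  have h1s : 1 < 1 / s := (one_lt_div hs0).2 hs1
  have hτ : 1 + (1 - s) ≤ 1 / s := by
    rw [le_div_iff₀ hs0]
    nlinarith [sq_nonneg (s - 1)]
  have hV := hfk.mono hWr hWo
  set V : Set ℂ := f '' W with hVdef
  have hQ := (hφ.scale hs0).trans hV
  obtain ⟨q, hq, -, hqin, hqout, hqw⟩ := hQ.exists_polygon h1s hσ (sub_pos.2 hs1) hτ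
  rw [sub_sub_cancel] at hqin hqw
  have hqV : closure (polyInt (range q)) ⊆ V :=
    hqout.trans (hQ.mapsTo.mono_left (ball_subset_ball hτ)).image_subset
  have hVΩ : V ⊆ Ω := (hfk.mapsTo.mono_left hWr).image_subset
  have hVk : ∀ z ∈ V, k z ∈ W := fun z hz => hV.mapsTo_symm hz
  have hmemV : ∀ z ∈ Ω, k z ∈ W → z ∈ V := fun z hz hkz =>
    ⟨k z, hkz, hfk.right_inv z hz⟩
  have hCq : ∀ z ∈ V, k z ∈ C → z ∈ (f ∘ fun z => φ (s * z)) '' closedBall 0 s := fun z hz hzC => by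
    refine ⟨ψ (k z) / s, ?_, ?_⟩
    · rw [mem_closedBall_zero_iff, norm_div, Complex.norm_real, Real.norm_of_nonneg hs0.le,
        div_le_iff₀ hs0, hss]
      exact (hκ _ hzC).le
    · exact hQ.right_inv z hz
  have hCq' : ∀ z ∈ V, k z ∈ C → z ∈ polyInt (range q) := fun z hz hzC => hqin (hCq z hz hzC)
  have hrange : range q ⊆ closure (polyInt (range q)) := hq.range_subset_closure_polyInt
  have hqC : ∀ z ∈ range q, k z ∉ C := fun z hz hzC =>
    PolygonParam.polyInt_subset_compl_range (hCq' z (hqV (hrange hz)) hzC) hz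
  have hqρ : ∀ z ∈ range q, ρ < ‖k z‖ := fun z hz => by
    by_contra! hlt
    exact hqC z hz (Or.inr (mem_closedBall_zero_iff.2 hlt))
  have hXS : ∀ z ∈ V, X z = S₀.X (k z) := fun z hz => by
    rw [hS₀ _ (S₀.closedBall_subset (ball_subset_closedBall (hWball (hVk z hz)))),
      hfk.right_inv z (hVΩ hz)]
  have hk0 : k 0 = 0 := by
    have := hfk.left_inv 0 (mem_ball_self (by positivity))
    rwa [hf0] at this
  refine ⟨q, fun z => S.X (k z), V, hq, hV.isOpen_target, hqV, hVΩ, ?_, ?_, fun z hz hzρ => ?_,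
    fun z hz => ?_, ?_, fun z hz hzρ => ?_, fun z hz hzρ => ?_, fun z hz => ?_,
    fun α hα hαV hα0 hα1 => ?_⟩
  · refine S.confMinImmOn_comp hV.isOpen_target hV.differentiableOn_symm
      (fun z hz => S.closedBall_subset (ball_subset_closedBall (hWball (hVk z hz))))
      (fun z hz => hV.symm.deriv_ne_zero hz) fun z hz => hne _ ?_
    exact S.closedBall_subset (ball_subset_closedBall (hWball (hVk z hz)))
  · dsimp only
    rw [hk0, S.X_zero]
  · have h1 : k z ∈ closedBall (0 : ℂ) ρ :=
      mem_closedBall_zero_iff.2 ((hk_le hzρ).trans hrρ.le)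
    exact hCq' z (hmemV z hz (hρW h1)) (Or.inr h1)
  · by_contra! hlt
    linarith [hk_le hlt, hqρ z hz]
  · have h0V : (0 : ℂ) ∈ V := ⟨0, hρW (mem_closedBall_self hρ0.le), hf0⟩
    have := hqw 0 (hCq 0 h0V (Or.inr (by rw [hk0]; exact mem_closedBall_self hρ0.le)))
    simpa using this
  · rw [hXS z hz]
    exact hin _ (mem_closedBall_zero_iff.2 ((hk_le hzρ).trans hrρ.le))
  · rw [hXS z hz]
    exact hout _ (subset_closure (hVk z hz)) (hk_ge hzρ)
  · have h1 := subset_closure (hVk z (hqV (hrange hz)))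
    refine ⟨hWE' _ h1, ?_⟩
    by_contra! hlt
    exact hqC z hz (Or.inl ⟨h1, hlt.le⟩)
  · have h1 := S.integral_le_eVariationOn hne (β := k ∘ α)
      (hV.differentiableOn_symm.continuousOn.comp hα hαV)
      fun t ht => ball_subset_closedBall (hWball (hVk _ (hαV ht)))
    refine le_trans (ENNReal.ofReal_le_ofReal (hInt.trans ?_)) h1
    exact intervalIntegral.integral_mono_interval (hk_le hα1) hrρ.le (hqρ _ hα0).le
      (Filter.Eventually.of_forall fun t => S.m_nonneg t)
      (S.continuous_m.intervalIntegrable _ _)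

end BiholOn

theorem exists_finite_net {X : ℂ → R3} {Ω A : Set ℂ} (hΩ : IsCompact (closure Ω))
    (hX : ContinuousOn X (closure Ω)) (hA : IsOpen A) (hAΩ : closure A ⊆ Ω) {η : ℝ} (hη : 0 < η) :
    ∃ N ⊆ Ω \ A, N.Finite ∧ ∀ z ∈ closure Ω \ A, ∃ w ∈ N, dist (X z) (X w) < η := by
  have hD : IsCompact (closure Ω \ A) := hΩ.diff hA
  have hne : ∀ z ∈ closure Ω \ A, ∃ w ∈ Ω \ A, dist (X z) (X w) < η := by
    rintro z ⟨hz, hzA⟩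
    by_cases hzΩ : z ∈ Ω
    · exact ⟨z, ⟨hzΩ, hzA⟩, by rwa [dist_self]⟩
    · have h1 : z ∈ (closure A)ᶜ := fun h => hzΩ (hAΩ h)
      have h2 : {w | dist (X z) (X w) < η} ∈ nhdsWithin z (closure Ω) :=
        (hX z hz).preimage_mem_nhdsWithin (t := {x | dist (X z) x < η}) (by
          filter_upwards [ball_mem_nhds (X z) hη] with x hx
          rwa [dist_comm])
      rw [mem_nhdsWithin] at h2
      obtain ⟨o, ho, hzo, hsub⟩ := h2
      obtain ⟨w, ⟨hwo, hwA⟩, hwΩ⟩ := mem_closure_iff.1 hz _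
        (ho.inter isClosed_closure.isOpen_compl) ⟨hzo, h1⟩
      exact ⟨w, ⟨hwΩ, fun h => hwA (subset_closure h)⟩, hsub ⟨hwo, subset_closure hwΩ⟩⟩
  obtain ⟨N, hN, hNf, hcov⟩ := (hD.image_of_continuousOn (hX.mono sdiff_subset)
    ).elim_finite_subcover_image (b := Ω \ A) (c := fun w => ball (X w) η)
    (fun _ _ => isOpen_ball) (by
      rintro _ ⟨z, hz, rfl⟩
      obtain ⟨w, hw, hd⟩ := hne z hz
      exact mem_iUnion₂.2 ⟨w, hw, hd⟩)
  refine ⟨N, hN, hNf, fun z hz => ?_⟩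
  obtain ⟨w, hw, hd⟩ := mem_iUnion₂.1 (hcov ⟨z, hz, rfl⟩)
  exact ⟨w, hw, hd⟩

/-- **Lemma 3 (main recursive step).** Combination of Meeks' trick and the Properness
Lemma: given a smooth Jordan curve `Γ` whose tube `T(Γ, ρ)` is a solid torus, strictly
convex bodies `E ⊆ E'`, nested polygons `P' ⊆ P`, and a conformal minimal immersion `X`
with the stated position, Hausdorff-distance and homotopy properties, one produces a new
polygon `Q` and immersion `Y` with properties (d.1)–(d.7). -/
theorem statement6 (γ : ℝ → R3) (hγ : SmoothJordan γ) (ρ : ℝ) (hρ : 0 < ρ)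
    (htorus : Nonempty
      ((↥(sphere (0:ℂ) 1) × ↥(ball ((0:ℝ×ℝ)) 1)) ≃ₜ ↥(thickening ρ (range γ))))
    (E E' : Set R3)
    (hE : RegStrictConvexDomain E) (hE' : RegStrictConvexDomain E')
    (h0E : (0:R3) ∈ E) (hEE' : closure E ⊆ E')
    (RE : ℝ) (hRE : ExtSphereRadius E RE)
    (p p' : ℝ → ℂ) (hp : PolygonParam p) (hp' : PolygonParam p')
    (hPP : closure (polyInt (range p')) ⊆ polyInt (range p))
    (h0P' : (0:ℂ) ∈ polyInt (range p'))
    (U : Set ℂ) (hUo : IsOpen U) (hPU : closure (polyInt (range p)) ⊆ U)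
    (X : ℂ → R3) (hX : ConfMinImmOn X U) (hX0 : X 0 = 0)
    (ε a b c : ℝ) (hε : 0 < ε) (ha : 0 < a) (hb : 0 < b) (hc : 0 < c)
    (h1 : X '' (closure (polyInt (range p)) \ polyInt (range p')) ⊆
      E \ innerParallel E a)
    (h2 : hausdorffDist (range γ)
      (X '' (closure (polyInt (range p)) \ polyInt (range p'))) ≤ c)
    (h3 : HomotopicLoopsIn (thickening c (range γ)) (X ∘ p) γ)
    (M : ℝ)
    (hM : M = Real.sqrt ((2*(2*a+b) + RE + hausdorffDist (closure E) (closure E'))^2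
      - (2*(a+b) + RE)^2 + (2*b)^2) + ε)
    (h4 : c + M < ρ) :
    ∃ (q : ℝ → ℂ) (Y : ℂ → R3) (V : Set ℂ),
      PolygonParam q ∧
      IsOpen V ∧ closure (polyInt (range q)) ⊆ V ∧ ConfMinImmOn Y V ∧ Y 0 = 0 ∧
      -- (d.1)
      closure (polyInt (range p')) ⊆ polyInt (range q) ∧
      closure (polyInt (range q)) ⊆ polyInt (range p) ∧
      -- (d.2)
      (∀ z ∈ range q,
        ENNReal.ofReal (1/ε) <
          intrinsicDist Y (closure (polyInt (range q))) z (range p')) ∧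
      -- (d.3)
      Y '' range q ⊆ E' \ innerParallel E' b ∧
      -- (d.4)
      Y '' (polyInt (range q) \ polyInt (range p')) ⊆ (innerParallel E (2*(a+b)))ᶜ ∧
      -- (d.5)
      (∀ z ∈ closure (polyInt (range p')), ‖Y z - X z‖ < ε) ∧
      -- (d.6)
      hausdorffDist (range γ)
        (Y '' (closure (polyInt (range q)) \ polyInt (range p'))) < c + M ∧
      -- (d.7)
      HomotopicLoopsIn (thickening (c + M) (range γ)) (Y ∘ q) γ := by
  obtain ⟨-, hEo, hEc, hEb, -⟩ := hE
  obtain ⟨-, hE'o, hE'c, hE'b, -⟩ := hE'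
  set Ω : Set ℂ := polyInt (range p) with hΩ
  set A : Set ℂ := polyInt (range p') with hA
  set M₀ : ℝ := √((2 * (2 * a + b) + RE + hausdorffDist (closure E) (closure E')) ^ 2 -
    (2 * (a + b) + RE) ^ 2 + (2 * b) ^ 2) with hM₀
  have hM₀0 : 0 ≤ M₀ := Real.sqrt_nonneg _
  set D : Set ℂ := closure Ω \ A with hD
  have hΩo : IsOpen Ω := hp.isOpen_polyInt
  have hAo : IsOpen A := hp'.isOpen_polyInt
  have hΩb : Bornology.IsBounded Ω := hp.isBounded_polyInt
  have hΩcl : IsCompact (closure Ω) := hΩb.isCompact_closure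
  have h0Ω : (0 : ℂ) ∈ Ω := hPP (subset_closure h0P')
  have hpΩ : range p ⊆ closure Ω := hp.range_subset_closure_polyInt
  have hpnΩ : ∀ t, p t ∉ Ω := fun t ht => PolygonParam.polyInt_subset_compl_range ht ⟨t, rfl⟩
  have hpD : ∀ t, p t ∈ D := fun t => ⟨hpΩ ⟨t, rfl⟩, fun h => hpnΩ t (hPP (subset_closure h))⟩
  have hXc : ContinuousOn X (closure Ω) := hX.1.continuousOn.mono hPU
  have hDc : IsCompact D := hΩcl.diff hAo
  have hXD : IsCompact (X '' D) := hDc.image_of_continuousOn (hXc.mono sdiff_subset)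
  have hγc : IsCompact (range γ) := by
    rw [← hγ.2.1.image_Icc one_pos 0]
    exact isCompact_Icc.image hγ.1.continuous
  have hfin : hausdorffEDist (range γ) (X '' D) ≠ ⊤ :=
    hausdorffEDist_ne_top_of_nonempty_of_bounded (range_nonempty γ) ⟨_, p 0, hpD 0, rfl⟩
      hγc.isBounded hXD.isBounded
  set η : ℝ := ε / 8 with hη
  have hη0 : 0 < η := by positivity
  have hγD : ∀ x ∈ range γ, ∃ z ∈ D, dist x (X z) < c + η := fun x hx => by
    obtain ⟨_, ⟨z, hz, rfl⟩, hd⟩ :=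
      exists_dist_lt_of_hausdorffDist_lt hx (h2.trans_lt (lt_add_of_pos_right c hη0)) hfin
    exact ⟨z, hz, hd⟩
  have hDγ : ∀ z ∈ D, ∃ x ∈ range γ, dist (X z) x < c + η := fun z hz => by
    obtain ⟨x, hx, hd⟩ := exists_dist_lt_of_hausdorffDist_lt' (mem_image_of_mem X hz)
      (h2.trans_lt (lt_add_of_pos_right c hη0)) hfin
    exact ⟨x, hx, by rwa [dist_comm]⟩
  obtain ⟨N, hNΩ, hNf, hN⟩ := exists_finite_net hΩcl hXc hAo hPP hη0
  obtain ⟨F, G, hFG, hF0, hG0⟩ := BiholOn.of_noHole hΩo hp.noHole_polyInt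
    hp.isPreconnected_polyInt hΩb h0Ω
  obtain ⟨κ, hκ0, hκ1, hκ⟩ := hFG.exists_norm_lt
    (K := closure A ∪ N) ((hp'.isBounded_polyInt.isCompact_closure).union hNf.isCompact)
    (union_subset hPP fun z hz => (hNΩ hz).1)
  have hκD : ∀ z ∈ Ω, κ ≤ ‖G z‖ → z ∈ D := fun z hz hzκ =>
    ⟨subset_closure hz, fun h => (hκ z (Or.inl (subset_closure h))).not_ge hzκ⟩
  have hDE : ∀ z ∈ D, X z ∈ E ∧ infDist (X z) Eᶜ ≤ a := fun z hz => by
    obtain ⟨h5, h6⟩ := h1 ⟨z, hz, rfl⟩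
    exact ⟨h5, not_lt.1 fun h7 => h6 ⟨h5, h7⟩⟩
  obtain ⟨σ, hσ, hwind, -⟩ := hp.exists_wind
  have hpw : HasWind p σ := by simpa using hwind 0 h0Ω
  set e : ℝ := min η a with he
  have he0 : 0 < e := lt_min hη0 ha
  have heη : e ≤ η := min_le_left _ _
  have hea : e ≤ a := min_le_right _ _
  obtain ⟨q, Y, V, hq, hVo, hqV, hVΩ, hY, hY0, hin, hqκ, hqw, hclose, hfar, hqE', hlen⟩ :=
    hFG.exists_immersion hF0 hUo (subset_closure.trans hPU) hX hX0 (e := e) (L := 1 / ε + 1)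
      hEc hEo hEb h0E hE'c hE'o hE'b hEE' hRE rfl ha hb he0 (by positivity) hκ0 hκ1
      (fun z hz hzκ => hDE z (hκD z hz hzκ)) hσ
  have hqcl : range q ⊆ closure (polyInt (range q)) := hq.range_subset_closure_polyInt
  have hYX : ∀ z ∈ V, ‖Y z - X z‖ ≤ M₀ + e := fun z hz => by
    rcases le_total ‖G z‖ κ with h | h
    · exact (hclose z hz h).trans (by linarith)
    · exact (hfar z hz h).1
  have hAq : closure A ⊆ polyInt (range q) := fun z hz =>
    hin z (hPP hz) (hκ z (Or.inl hz)).le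
  refine ⟨q, Y, V, hq, hVo, hqV, hY, hY0, hAq, hqV.trans hVΩ, fun z hz => ?_, ?_, ?_, ?_, ?_, ?_⟩
  · refine (ENNReal.ofReal_lt_ofReal_iff (by positivity)).2 (lt_add_one (1 / ε)) |>.trans_le ?_
    refine le_iInf fun α => le_iInf fun hα => le_iInf fun hαq => le_iInf fun hα0 =>
      le_iInf fun hα1 => hlen α hα (fun t ht => hqV (hαq ht)) (hα0 ▸ hz) ?_
    exact (hκ _ (Or.inl (hp'.range_subset_closure_polyInt hα1))).le
  · rintro _ ⟨z, hz, rfl⟩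
    exact ⟨(hqE' z hz).1, fun h => (hqE' z hz).2.not_gt h.2⟩
  · rintro _ ⟨z, ⟨hzq, hzA⟩, rfl⟩
    have hzV := hqV (subset_closure hzq)
    rcases le_total ‖G z‖ κ with h | h
    · intro h5
      have h6 := (hDE z ⟨subset_closure (hVΩ hzV), hzA⟩).2
      have h7 := infDist_le_infDist_add_dist (s := Eᶜ) (x := Y z) (y := X z)
      rw [dist_eq_norm] at h7
      have h8 := hclose z hzV h
      have h9 := h5.2
      linarith
    · exact (hfar z hzV h).2
  · intro z hz
    refine (hclose z (hqV (subset_closure (hAq hz))) (hκ z (Or.inl hz)).le).trans_lt ?_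
    linarith
  · refine lt_of_le_of_lt (hausdorffDist_le_of_mem_dist (r := c + M₀ + 3 * η)
      (by positivity) (fun x hx => ?_) ?_) (by linarith)
    · obtain ⟨z, hz, hd⟩ := hγD x hx
      obtain ⟨w, hw, hd'⟩ := hN z hz
      have hwq := hin w (hNΩ hw).1 (hκ w (Or.inr hw)).le
      refine ⟨Y w, ⟨w, ⟨subset_closure hwq, (hNΩ hw).2⟩, rfl⟩, ?_⟩
      have h5 := hYX w (hqV (subset_closure hwq))
      rw [← dist_eq_norm, dist_comm] at h5
      linarith [dist_triangle4 x (X z) (X w) (Y w)]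
    · rintro _ ⟨z, ⟨hzq, hzA⟩, rfl⟩
      obtain ⟨x, hx, hd⟩ := hDγ z ⟨subset_closure (hVΩ (hqV hzq)), hzA⟩
      refine ⟨x, hx, ?_⟩
      have h5 := hYX z (hqV hzq)
      rw [← dist_eq_norm] at h5
      linarith [dist_triangle (Y z) (X z) x]
  · have hqtV : ∀ t, q t ∈ V := fun t => hqV (hqcl ⟨t, rfl⟩)
    have hXq : Continuous (X ∘ q) :=
      hXc.comp_continuous hq.continuous fun t => subset_closure (hVΩ (hqtV t))
    have hYq : Continuous (Y ∘ q) := hY.1.continuousOn.comp_continuous hq.continuous hqtV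
    have hXp : Continuous (X ∘ p) := hXc.comp_continuous hp.continuous fun t => hpΩ ⟨t, rfl⟩
    have hDt : ∀ z ∈ D, X z ∈ thickening (c + η) (range γ) := fun z hz =>
      mem_thickening_iff.2 (hDγ z hz)
    set K : Set ℂ := F '' closedBall 0 κ with hK
    have hKb : closedBall (0 : ℂ) κ ⊆ ball 0 1 := closedBall_subset_ball hκ1
    have hKc : IsCompact K := (isCompact_closedBall _ _).image_of_continuousOn
      (hFG.differentiableOn.continuousOn.mono hKb)
    have h0K : (0 : ℂ) ∈ K := ⟨0, mem_closedBall_self hκ0.le, hF0⟩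
    obtain ⟨d, hd, hdK⟩ := hp.isCompact_range.exists_thickening_subset_open
      hKc.isClosed.isOpen_compl (by
        rintro _ ⟨t, rfl⟩ ⟨z, hz, hzt⟩
        exact hpnΩ t (hzt ▸ hFG.mapsTo (hKb hz)))
    obtain ⟨d', hd', hXd⟩ := Metric.uniformContinuousOn_iff.1
      (hΩcl.uniformContinuousOn_of_continuous hXc) η hη0
    obtain ⟨g, hg, hgp, hgΩ, hgd⟩ := hp.exists_inner_loop (lt_min hd hd')
    have hgw : HasWind g σ := hpw.congr_of_near hg hp.periodic hgp fun t => by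
      refine (hgd t).trans_le ((min_le_left _ _).trans ?_)
      by_contra! hlt
      refine hdK (mem_thickening_iff.2 ⟨p t, ⟨t, rfl⟩, ?_⟩) h0K
      rwa [dist_zero_left]
    have hgκ : ∀ t, κ < ‖G (g t)‖ := fun t => by
      by_contra! hle
      refine hdK (mem_thickening_iff.2 ⟨p t, ⟨t, rfl⟩, ?_⟩)
        ⟨G (g t), mem_closedBall_zero_iff.2 hle, hFG.right_inv _ (hgΩ t)⟩
      rw [dist_eq_norm]
      exact (hgd t).trans_le (min_le_left _ _)
    have hXg : Continuous (X ∘ g) := hXc.comp_continuous hg fun t => subset_closure (hgΩ t)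
    have s1 : HomotopicLoopsIn (thickening (c + M) (range γ)) (X ∘ q) (Y ∘ q) :=
      HomotopicLoopsIn.of_near hXq (hq.periodic.comp X) hYq (hq.periodic.comp Y)
        (fun t => hDt _ (hκD _ (hVΩ (hqtV t)) (hqκ _ ⟨t, rfl⟩).le)) (fun t => hYX _ (hqtV t))
        (by linarith)
    have s2 : HomotopicLoopsIn (thickening (c + η) (range γ)) (X ∘ q) (X ∘ g) :=
      hFG.homotopicLoopsIn hF0 hp.noHole_polyInt hp.isPreconnected_polyInt hqw hq.periodic
        (fun t => hVΩ (hqtV t)) hgw hgp hgΩ (fun t => hqκ _ ⟨t, rfl⟩) hgκ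
        (hXc.mono subset_closure) fun z hz hzκ => hDt _ (hκD z hz hzκ.le)
    have s3 : HomotopicLoopsIn (thickening (c + η + η) (range γ)) (X ∘ p) (X ∘ g) :=
      HomotopicLoopsIn.of_near hXp (hp.periodic.comp X) hXg (hgp.comp X) (fun t => hDt _ (hpD t))
        (fun t => by
          rw [← dist_eq_norm]
          refine (hXd _ (subset_closure (hgΩ t)) _ (hpΩ ⟨t, rfl⟩) ?_).le
          rw [dist_eq_norm]
          exact (hgd t).trans_le (min_le_right _ _)) le_rfl
    have hmono : ∀ x ≤ c + M, thickening x (range γ) ⊆ thickening (c + M) (range γ) :=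
      fun x hx => thickening_mono hx _
    exact s1.symm.trans ((s2.mono (hmono _ (by linarith))).trans
      ((s3.mono (hmono _ (by linarith))).symm.trans (h3.mono (hmono _ (by linarith)))))
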